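/- arXiv:2106.12611 — 2 statements merged into one kernel-verified Lean document; each statement's English description precedes it below -/
import Mathlib

section
/- In the setting of the random ReLU network with ‖x‖ = √d, d_min ≥ (Cℓ log d_max)^{240ℓ} log(1/δ), and R = √(d_min)/(ℓ log d_max)^{80ℓ}: for some absolute constant C', with probability at least 1 − δ over the weight matrices {W_k}, for every y with ‖y − x‖ ≤ R, almost surely over the randomized tie-breaking in the activations at x and y, ‖∇f(x) − ∇f(y)‖ ≤ (C')^ℓ / (log d_max)^ℓ. -/
open MeasureTheory ProbabilityTheory

noncomputable section

/-- Euclidean norm of a finite real vector. -/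
def evNorm {n : ℕ} (v : Fin n → ℝ) : ℝ := Real.sqrt (∑ i, v i ^ 2)

/-- Matrix-vector product. -/
def mulVecFn {a b : ℕ} (M : Fin a → Fin b → ℝ) (v : Fin b → ℝ) : Fin a → ℝ :=
  fun j => ∑ k, M j k * v k

/-- Spectral (ℓ²-operator) norm of a matrix. -/
def specNorm {a b : ℕ} (M : Fin a → Fin b → ℝ) : ℝ :=
  sSup {t | ∃ v : Fin b → ℝ, evNorm v ≤ 1 ∧ t = evNorm (mulVecFn M v)}

/-- The law of an `a × b` random matrix with i.i.d. centered Gaussian entries of variance `v`. -/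
def gaussMat (a b : ℕ) (v : NNReal) : Measure (Fin a → Fin b → ℝ) :=
  Measure.pi fun _ => Measure.pi fun _ => gaussianReal 0 v

instance (a b : ℕ) (v : NNReal) : IsProbabilityMeasure (gaussMat a b v) := by
  unfold gaussMat; infer_instance

/-- Post-activation output of layer `i` of a fully connected ReLU network. -/
def forward (D : ℕ → ℕ) (w : ∀ i : ℕ, Fin (D (i+1)) → Fin (D i) → ℝ) :
    (i : ℕ) → (Fin (D 0) → ℝ) → Fin (D i) → ℝ
  | 0, x => x
  | (i+1), x => fun j => max (∑ k, w i j k * forward D w i x k) 0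

/-- Pre-activation input to layer `i+1` (the quantity `f̃_{i+1}`). -/
def preact (D : ℕ → ℕ) (w : ∀ i : ℕ, Fin (D (i+1)) → Fin (D i) → ℝ)
    (i : ℕ) (x : Fin (D 0) → ℝ) : Fin (D (i+1)) → ℝ :=
  fun j => ∑ k, w i j k * forward D w i x k

/-- Extend a finitely-indexed family of weight matrices to all of `ℕ` (zero beyond `ℓ`). -/
def extendW (ℓ : ℕ) (D : ℕ → ℕ)
    (w : ∀ i : Fin ℓ, Fin (D (i.1+1)) → Fin (D i.1) → ℝ) :
    ∀ i : ℕ, Fin (D (i+1)) → Fin (D i) → ℝ :=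
  fun i => if h : i < ℓ then w ⟨i, h⟩ else fun _ _ => 0

/-- Law of the hidden-layer weight matrices `W_1, …, W_ℓ`. -/
def hiddenMeasure (ℓ : ℕ) (D : ℕ → ℕ) :
    Measure (∀ i : Fin ℓ, Fin (D (i.1+1)) → Fin (D i.1) → ℝ) :=
  Measure.pi fun i => gaussMat (D (i.1+1)) (D i.1) (1 / (D i.1 : NNReal))

/-- Law of all the weights of the network, including the output layer `W_{ℓ+1}`. -/
def weightMeasure (ℓ : ℕ) (D : ℕ → ℕ) :
    Measure ((∀ i : Fin ℓ, Fin (D (i.1+1)) → Fin (D i.1) → ℝ) × (Fin (D ℓ) → ℝ)) :=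
  (hiddenMeasure ℓ D).prod (Measure.pi fun _ : Fin (D ℓ) => gaussianReal 0 (1 / (D ℓ : NNReal)))

/-- Minimum width among layers `0,…,ℓ`. -/
def dminN (ℓ : ℕ) (D : ℕ → ℕ) : ℕ := sInf (D '' Set.Iic ℓ)

/-- Maximum width among layers `0,…,ℓ`. -/
def dmaxN (ℓ : ℕ) (D : ℕ → ℕ) : ℕ := sSup (D '' Set.Iic ℓ)

/-- The radius `R = √(d_min)/(ℓ log d_max)^{80ℓ}`. -/
def Rball (ℓ : ℕ) (D : ℕ → ℕ) : ℝ :=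
  Real.sqrt (dminN ℓ D) / ((ℓ : ℝ) * Real.log (dmaxN ℓ D)) ^ (80 * (ℓ : ℝ))

/-- Diagonal entry of the randomized activation-pattern matrix. -/
def act01 (s : ℝ) (bit : Bool) : ℝ :=
  if 0 < s then 1 else if s = 0 ∧ bit = true then 1 else 0

/-- `Mprod D w b y j i = ∏_{k=i}^{j+1} D_k(f̃_k(y)) W_k` with tie-breaking bits `b`. -/
def Mprod (D : ℕ → ℕ) (w : ∀ i : ℕ, Fin (D (i+1)) → Fin (D i) → ℝ)
    (b : ∀ i : ℕ, Fin (D (i+1)) → Bool) (y : Fin (D 0) → ℝ) (j : ℕ) :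
    (i : ℕ) → Fin (D i) → Fin (D j) → ℝ
  | 0 => fun a c => if 0 = j ∧ (a : ℕ) = (c : ℕ) then 1 else 0
  | (t+1) =>
      if t + 1 = j then (fun a c => if (a : ℕ) = (c : ℕ) then 1 else 0)
      else fun a c =>
        act01 (preact D w t y a) (b t a) * (∑ k, w t a k * Mprod D w b y j t k c)

/-- The gradient of the network output at `z`:
`∇f(z) = W_{ℓ+1} ∏_{i=ℓ}^{1} D_i(f̃_i(z)) W_i`, with tie-breaking bits `b`. -/
def gradVec (ℓ : ℕ) (D : ℕ → ℕ) (w : ∀ i : ℕ, Fin (D (i+1)) → Fin (D i) → ℝ)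
    (b : ∀ i : ℕ, Fin (D (i+1)) → Bool) (v : Fin (D ℓ) → ℝ)
    (z : Fin (D 0) → ℝ) : Fin (D 0) → ℝ :=
  fun c => ∑ a, v a * Mprod D w b z 0 ℓ a c

/-- The fair-coin distribution on `Bool`. -/
def coin : Measure Bool := (PMF.bernoulli (1/2) (by norm_num)).toMeasure

instance : IsProbabilityMeasure coin := by unfold coin; infer_instance

/-- The law of the independent fair tie-breaking bits of the hidden layers. -/
def bitsMeasure (ℓ : ℕ) (D : ℕ → ℕ) : Measure (∀ i : Fin ℓ, Fin (D (i.1+1)) → Bool) :=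
  Measure.pi fun _ => Measure.pi fun _ => coin

/-- Extend a finitely-indexed family of bits to all of `ℕ`. -/
def extendB (ℓ : ℕ) (D : ℕ → ℕ) (b : ∀ i : Fin ℓ, Fin (D (i.1+1)) → Bool) :
    ∀ i : ℕ, Fin (D (i+1)) → Bool :=
  fun i => if h : i < ℓ then b ⟨i, h⟩ else fun _ => false


end

open MeasureTheory ProbabilityTheory
noncomputable section

/-! ### Lower bounds of outer measures along a product -/

lemma outer_prod_ge {α β : Type*} [MeasurableSpace α] [MeasurableSpace β]
    (μ : Measure α) (ν : Measure β) [SFinite ν] (G : Set α) (E : Set (α × β)) (q : ENNReal)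
    (h : ∀ a ∈ G, q ≤ ν {b | (a, b) ∈ E}) : q * μ G ≤ (μ.prod ν) E := by
  set T := toMeasurable (μ.prod ν) E with hT
  have hTm : MeasurableSet T := measurableSet_toMeasurable _ _
  rw [← measure_toMeasurable E, ← hT, Measure.prod_apply hTm]
  refine le_trans ?_ (mul_meas_ge_le_lintegral (measurable_measure_prodMk_left hTm) q)
  gcongr
  intro a ha
  refine (h a ha).trans (measure_mono ?_)
  intro b hb
  exact subset_toMeasurable _ _ hb

lemma outer_pi_chain : ∀ (n : ℕ) (X : Fin n → Type) [∀ i, MeasurableSpace (X i)]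
    (μ : ∀ i, Measure (X i)) [∀ i, IsProbabilityMeasure (μ i)]
    (P : Fin n → (∀ j, X j) → Prop)
    (_hdep : ∀ i w w', (∀ j, j ≤ i → w j = w' j) → P i w → P i w') (q : ENNReal)
    (_h : ∀ i w, (∀ j, j < i → P j w) → q ≤ μ i {a | P i (Function.update w i a)}),
    q ^ n ≤ Measure.pi μ {w | ∀ i, P i w} := by
  intro n
  induction n with
  | zero =>
    intro X _ μ _ P _ q _
    have : {w : ∀ j, X j | ∀ i, P i w} = Set.univ := by
      ext w; simp
    rw [this]; simp
  | succ n ih =>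
    intro X _ μ _ P hdep q h
    have hne : Nonempty (X (Fin.last n)) := (μ (Fin.last n)).nonempty_of_neZero
    obtain ⟨x0⟩ := hne
    let e := MeasurableEquiv.piFinSuccAbove X (Fin.last n)
    have hmp := measurePreserving_piFinSuccAbove μ (Fin.last n)
    let P' : Fin n → (∀ j : Fin n, X ((Fin.last n).succAbove j)) → Prop :=
      fun i w => P ((Fin.last n).succAbove i) (e.symm (x0, w))
    have key : ∀ (x : X (Fin.last n)) (w : ∀ j : Fin n, X ((Fin.last n).succAbove j)) (j : Fin n),
        e.symm (x, w) ((Fin.last n).succAbove j) = w j := by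
      intro x w j
      simp [e, MeasurableEquiv.piFinSuccAbove, Fin.insertNthEquiv]
    have keyl : ∀ (x : X (Fin.last n)) (w : ∀ j : Fin n, X ((Fin.last n).succAbove j)),
        e.symm (x, w) (Fin.last n) = x := by
      intro x w
      simp [e, MeasurableEquiv.piFinSuccAbove, Fin.insertNthEquiv]
    have cases' : ∀ {p : Fin (n+1) → Prop}, (∀ j : Fin n, p ((Fin.last n).succAbove j)) →
        p (Fin.last n) → ∀ i, p i := by
      intro p h1 h2 i
      rcases Fin.eq_self_or_eq_succAbove (Fin.last n) i with rfl | ⟨j, rfl⟩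
      · exact h2
      · exact h1 j
    have hmono : ∀ i j : Fin n, ((Fin.last n).succAbove i ≤ (Fin.last n).succAbove j) ↔ i ≤ j := by
      intro i j; simp
    have hmono' : ∀ i j : Fin n, ((Fin.last n).succAbove i < (Fin.last n).succAbove j) ↔ i < j := by
      intro i j; simp
    have hlt : ∀ i : Fin n, (Fin.last n).succAbove i < Fin.last n := by
      intro i; simp [Fin.castSucc_lt_last]
    -- independence of the last coordinate
    have hind : ∀ (i : Fin n) x x' w, P ((Fin.last n).succAbove i) (e.symm (x, w)) →
        P ((Fin.last n).succAbove i) (e.symm (x', w)) := by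
      intro i x x' w
      apply hdep
      intro j hj
      rcases Fin.eq_self_or_eq_succAbove (Fin.last n) j with rfl | ⟨j, rfl⟩
      · exact absurd hj (not_le.2 (hlt i))
      · rw [key, key]
    have hupd : ∀ (i : Fin n) w a, e.symm (x0, Function.update w i a) =
        Function.update (e.symm (x0, w)) ((Fin.last n).succAbove i) a := by
      intro i w a
      funext j
      revert j
      apply cases'
      · intro j
        rw [key]
        by_cases hij : j = i
        · subst hij; simp
        · rw [Function.update_of_ne hij, Function.update_of_ne, key]
          intro h'; exact hij (Fin.succAbove_right_injective h')
      · rw [keyl, Function.update_of_ne, keyl]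
        exact (hlt i).ne'
    have hupdl : ∀ w x, e.symm (x, w) = Function.update (e.symm (x0, w)) (Fin.last n) x := by
      intro w x
      funext j
      revert j
      apply cases'
      · intro j
        rw [key, Function.update_of_ne (hlt j).ne, key]
      · rw [keyl]; simp
    have IH := ih (fun j => X ((Fin.last n).succAbove j)) (fun j => μ ((Fin.last n).succAbove j)) P'
      (by
        intro i w w' hw
        apply hdep
        apply cases'
        · intro j hj
          rw [key, key]; exact hw j ((hmono _ _).1 hj)
        · intro hj
          rw [keyl, keyl]) q
      (by
        intro i w hw
        have := h ((Fin.last n).succAbove i) (e.symm (x0, w)) (by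
          apply cases' (p := fun j => j < (Fin.last n).succAbove i → P j (e.symm (x0, w)))
          · intro j hj; exact hw j ((hmono' _ _).1 hj)
          · intro hj; exact absurd hj (not_lt.2 (hlt i).le))
        refine this.trans (le_of_eq ?_)
        congr 1
        ext a
        simp only [Set.mem_setOf_eq, P']
        rw [hupd])
    have hsw := (Measure.measurePreserving_swap (μ := Measure.pi fun j => μ ((Fin.last n).succAbove j))
      (ν := μ (Fin.last n)))
    let F := {z : (∀ j : Fin n, X ((Fin.last n).succAbove j)) × X (Fin.last n) |
      ∀ i, P i (e.symm (z.2, z.1))}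
    have h1 : Measure.pi μ {w | ∀ i, P i w} =
        ((Measure.pi fun j => μ ((Fin.last n).succAbove j)).prod (μ (Fin.last n))) F := by
      have e2 := (hmp.symm e)
      rw [← e2.measure_preimage_equiv, ← hsw.measure_preimage_equiv (f := MeasurableEquiv.prodComm)]
      rfl
    rw [h1, pow_succ, mul_comm]
    refine le_trans ?_ (outer_prod_ge _ _ {w | ∀ i, P' i w} F q ?_)
    · gcongr
    · intro w hw
      have := h (Fin.last n) (e.symm (x0, w)) (by
        apply cases' (p := fun j => j < Fin.last n → P j (e.symm (x0, w)))
        · intro j _; exact hw j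
        · intro hj; exact absurd hj (lt_irrefl _))
      refine this.trans (measure_mono ?_)
      intro a ha
      simp only [Set.mem_setOf_eq, F] at ha ⊢
      apply cases'
      · intro j; exact hind j _ _ _ (hw j)
      · rw [hupdl]; exact ha

lemma outer_inter_ge {α : Type*} [MeasurableSpace α] (μ : Measure α) (A B : Set α) (p q : ENNReal)
    (hA : p ≤ μ A) (hB : μ Bᶜ ≤ q) : p - q ≤ μ (A ∩ B) := by
  rw [tsub_le_iff_right]
  calc p ≤ μ A := hA
    _ ≤ μ ((A ∩ B) ∪ Bᶜ) := measure_mono (by intro x hx; by_cases h : x ∈ B <;> simp [hx, h])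
    _ ≤ μ (A ∩ B) + μ Bᶜ := measure_union_le _ _
    _ ≤ _ := by gcongr

end

open MeasureTheory ProbabilityTheory
noncomputable section

/-! ### Gaussian facts -/

/-- squared Euclidean norm -/
def nsq {n : ℕ} (v : Fin n → ℝ) : ℝ := ∑ i, v i ^ 2

lemma nsq_nonneg {n : ℕ} (v : Fin n → ℝ) : 0 ≤ nsq v :=
  Finset.sum_nonneg fun _ _ => sq_nonneg _

/-- standard Gaussian measure on `Fin n → ℝ` -/
def stdG (n : ℕ) : Measure (Fin n → ℝ) := Measure.pi fun _ => gaussianReal 0 1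

instance (n : ℕ) : IsProbabilityMeasure (stdG n) := by unfold stdG; infer_instance

lemma law_row (b : ℕ) (v : NNReal) (u : Fin b → ℝ) :
    (Measure.pi fun _ : Fin b => gaussianReal 0 v).map (fun r => ∑ k, r k * u k) =
      (gaussianReal 0 1).map (fun g => Real.sqrt (v * nsq u) * g) := by
  have hm : Measurable (fun r : Fin b → ℝ => ∑ k, r k * u k) := by fun_prop
  have : IsProbabilityMeasure ((Measure.pi fun _ : Fin b => gaussianReal 0 v).map
      (fun r => ∑ k, r k * u k)) := Measure.isProbabilityMeasure_map hm.aemeasurable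
  rw [gaussianReal_map_const_mul]
  refine Measure.ext_of_charFun ?_
  ext t
  rw [charFun_gaussianReal, charFun_apply_real, integral_map hm.aemeasurable (by fun_prop)]
  have h1 : ∀ r : Fin b → ℝ, Complex.exp (t * ((∑ k, r k * u k : ℝ) : ℂ) * Complex.I) =
      ∏ k, Complex.exp ((t * u k : ℝ) * (r k : ℂ) * Complex.I) := by
    intro r
    rw [← Complex.exp_sum]
    congr 1
    push_cast
    rw [Finset.mul_sum, Finset.sum_mul]
    refine Finset.sum_congr rfl fun k _ => ?_
    ring
  simp_rw [h1]
  rw [integral_fintype_prod_eq_prod (fun k (x : ℝ) => Complex.exp ((t * u k : ℝ) * (x : ℂ) * Complex.I))]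
  simp_rw [← charFun_apply_real, charFun_gaussianReal]
  rw [← Complex.exp_sum]
  congr 1
  have h2 : Real.sqrt (v * nsq u) ^ 2 = v * nsq u :=
    Real.sq_sqrt (mul_nonneg v.2 (nsq_nonneg u))
  have h3 : ((Real.sqrt (v * nsq u) : ℝ) : ℂ) ^ 2 = v * ∑ k, (u k : ℂ) ^ 2 := by
    rw [← Complex.ofReal_pow, h2, nsq]; push_cast; rfl
  simp only [NNReal.coe_mul, NNReal.coe_mk, NNReal.coe_one]
  push_cast
  rw [h3]
  simp only [mul_zero, zero_mul, zero_sub, mul_one]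
  rw [Finset.sum_neg_distrib, ← Finset.sum_div, Finset.mul_sum, Finset.sum_mul]
  congr 2
  refine Finset.sum_congr rfl fun k _ => ?_
  ring

lemma law_mat (a b : ℕ) (v : NNReal) (u : Fin b → ℝ) :
    (gaussMat a b v).map (fun w i => ∑ k, w i k * u k) =
      (stdG a).map (fun g i => Real.sqrt (v * nsq u) * g i) := by
  unfold gaussMat stdG
  have hm : Measurable (fun r : Fin b → ℝ => ∑ k, r k * u k) := by fun_prop
  have := Measure.isProbabilityMeasure_map (μ := (Measure.pi fun _ : Fin b => gaussianReal 0 v))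
     hm.aemeasurable
  have hm2 : Measurable (fun g : ℝ => Real.sqrt (v * nsq u) * g) := by fun_prop
  have := Measure.isProbabilityMeasure_map (μ := (gaussianReal 0 1)) hm2.aemeasurable
  rw [Measure.pi_map_pi (f := fun _ (r : Fin b → ℝ) => ∑ k, r k * u k) (fun _ => hm.aemeasurable),
    Measure.pi_map_pi (f := fun _ (g : ℝ) => Real.sqrt (v * nsq u) * g) (fun _ => hm2.aemeasurable)]
  simp_rw [law_row]

lemma gaussMat_transfer (a b : ℕ) (v : NNReal) (u : Fin b → ℝ) (s : Set (Fin a → ℝ))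
    (hs : MeasurableSet s) :
    gaussMat a b v {w | (fun i => ∑ k, w i k * u k) ∈ s} =
      stdG a {g | (fun i => Real.sqrt (v * nsq u) * g i) ∈ s} := by
  have h : ∀ μ ν : Measure (Fin a → ℝ), μ = ν → μ s = ν s := fun μ ν h => by rw [h]
  have h := h _ _ (law_mat a b v u)
  rw [Measure.map_apply (by fun_prop) hs, Measure.map_apply (by fun_prop) hs] at h
  exact h

lemma chernoff (n : ℕ) (ν : Measure ℝ) [IsProbabilityMeasure ν] (g : ℝ → ℝ)
    (hInt : Integrable (fun x => Real.exp (g x)) ν) (B : ℝ) (hB : ∫ x, Real.exp (g x) ∂ν ≤ B)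
    (S : Finset (Fin n)) (t : ℝ) :
    Measure.pi (fun _ : Fin n => ν) {x | t ≤ ∑ a ∈ S, g (x a)} ≤
      ENNReal.ofReal (B ^ S.card * Real.exp (-t)) := by
  classical
  set μ := Measure.pi (fun _ : Fin n => ν)
  let f : Fin n → ℝ → ℝ := fun a x => if a ∈ S then Real.exp (g x) else 1
  have hf : ∀ a, Integrable (f a) ν := by
    intro a
    by_cases h : a ∈ S
    · simpa [f, h] using hInt
    · simp [f, h]
  have hI : Integrable (fun x : Fin n → ℝ => ∏ a, f a (x a)) μ := Integrable.fintype_prod_dep hf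
  have heq : ∀ x : Fin n → ℝ, ∏ a, f a (x a) = Real.exp (∑ a ∈ S, g (x a)) := by
    intro x
    rw [Real.exp_sum]
    simp only [f]
    rw [Finset.prod_ite]
    simp
  have hval : ∫ x, ∏ a, f a (x a) ∂μ ≤ B ^ S.card := by
    rw [integral_fintype_prod_eq_prod f]
    have : ∀ a, ∫ x, f a x ∂ν = if a ∈ S then ∫ x, Real.exp (g x) ∂ν else 1 := by
      intro a
      by_cases h : a ∈ S <;> simp [f, h]
    simp_rw [this]
    rw [Finset.prod_ite]
    rw [Finset.prod_const, Finset.prod_const_one, mul_one, Finset.filter_univ_mem]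
    exact pow_le_pow_left₀ (integral_nonneg fun x => (Real.exp_pos _).le) hB _
  have hmk := mul_meas_ge_le_integral_of_nonneg (μ := μ) (f := fun x : Fin n → ℝ => ∏ a, f a (x a))
    (ae_of_all _ fun x => by simp only [heq]; exact (Real.exp_pos _).le) hI (Real.exp t)
  have hset : {x : Fin n → ℝ | t ≤ ∑ a ∈ S, g (x a)} = {x | Real.exp t ≤ ∏ a, f a (x a)} := by
    ext x; simp only [Set.mem_ofPred_eq, heq, Real.exp_le_exp]
  rw [hset]
  rw [ENNReal.le_ofReal_iff_toReal_le (measure_ne_top _ _) ]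
  · have hr : Real.exp t * μ.real {x | Real.exp t ≤ ∏ a, f a (x a)} ≤ B ^ S.card :=
      le_trans hmk hval
    rw [Real.exp_neg, ← div_eq_mul_inv, le_div_iff₀ (Real.exp_pos _), mul_comm]
    exact hr
  · have : 0 ≤ B := le_trans (integral_nonneg fun x => (Real.exp_pos _).le) hB
    positivity

lemma pdf_le (x : ℝ) : gaussianPDFReal 0 1 x ≤ 1/2 := by
  unfold gaussianPDFReal
  have h1 : Real.exp (-(x - 0) ^ 2 / (2 * ((1:NNReal):ℝ))) ≤ 1 := by
    rw [Real.exp_le_one_iff]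
    have := sq_nonneg (x-0)
    simp only [NNReal.coe_one]; linarith
  have h2 : (2:ℝ) ≤ Real.sqrt (2 * Real.pi * ((1:NNReal):ℝ)) := by
    apply Real.le_sqrt_of_sq_le
    simp only [NNReal.coe_one]; nlinarith [Real.pi_gt_three]
  have h3 : (Real.sqrt (2 * Real.pi * ((1:NNReal):ℝ)))⁻¹ ≤ 1/2 := by
    rw [one_div]; exact inv_anti₀ (by norm_num) h2
  calc _ ≤ (1/2:ℝ) * 1 := by gcongr
    _ = _ := by norm_num

lemma gauss_Icc_le (p q : ℝ) (hpq : p ≤ q) :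
    gaussianReal 0 1 (Set.Icc p q) ≤ ENNReal.ofReal ((q - p)/2) := by
  rw [gaussianReal_apply _ (by norm_num)]
  calc _ ≤ ∫⁻ x in Set.Icc p q, ENNReal.ofReal (1/2) := by
        apply lintegral_mono; intro x; exact ENNReal.ofReal_le_ofReal (pdf_le x)
    _ = _ := by
      simp only [lintegral_const, MeasurableSet.univ, Measure.restrict_apply, Set.univ_inter,
        Real.volume_Icc]
      rw [← ENNReal.ofReal_mul (by norm_num)]; congr 1; ring

lemma gauss_Iic_le : gaussianReal 0 1 (Set.Iic (1/4)) ≤ ENNReal.ofReal (5/8) := by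
  have hsym : gaussianReal 0 1 (Set.Iio 0) = gaussianReal 0 1 (Set.Ioi 0) := by
    have h := gaussianReal_map_neg (μ := 0) (v := 1)
    rw [neg_zero] at h
    conv_lhs => rw [← h]
    rw [Measure.map_apply (by fun_prop) measurableSet_Iio]
    congr 1; ext x; simp
  have hhalf : gaussianReal 0 1 (Set.Iio 0) ≤ ENNReal.ofReal (1/2) := by
    have h1 : gaussianReal 0 1 (Set.Iio 0) + gaussianReal 0 1 (Set.Ioi 0) ≤ 1 := by
      rw [← measure_union (by
        rw [Set.disjoint_left]; intro x hx hx'; simp at hx hx'; linarith) measurableSet_Ioi]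
      exact prob_le_one
    rw [← hsym] at h1
    rw [ENNReal.le_ofReal_iff_toReal_le (measure_ne_top _ _) (by norm_num)]
    have h2 := ENNReal.toReal_mono (by simp) h1
    rw [ENNReal.toReal_add (measure_ne_top _ _) (measure_ne_top _ _), ENNReal.toReal_one] at h2
    linarith
  calc gaussianReal 0 1 (Set.Iic (1/4)) ≤ gaussianReal 0 1 (Set.Iio 0 ∪ Set.Icc 0 (1/4)) := by
        apply measure_mono; intro x hx
        by_cases h : x < 0
        · exact Or.inl h
        · exact Or.inr ⟨not_lt.mp h, hx⟩
    _ ≤ _ + _ := measure_union_le _ _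
    _ ≤ ENNReal.ofReal (1/2) + ENNReal.ofReal ((1/4 - 0)/2) :=
        add_le_add hhalf (gauss_Icc_le _ _ (by norm_num))
    _ = _ := by rw [← ENNReal.ofReal_add (by norm_num) (by norm_num)]; norm_num

/-- exponential moment of the square -/
lemma gauss_exp_sq :
    Integrable (fun x : ℝ => Real.exp (x^2/4)) (gaussianReal 0 1) ∧
    ∫ x, Real.exp (x^2/4) ∂(gaussianReal 0 1) ≤ 3/2 := by
  have hpdf : ∀ x : ℝ, gaussianPDFReal 0 1 x * Real.exp (x^2/4) =
      (Real.sqrt (2 * Real.pi))⁻¹ * Real.exp (-(1/4) * x^2) := by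
    intro x
    unfold gaussianPDFReal
    rw [mul_assoc, ← Real.exp_add]
    simp only [NNReal.coe_one, mul_one]
    congr 2; ring
  constructor
  · rw [gaussianReal_of_var_ne_zero _ (by norm_num)]
    rw [integrable_withDensity_iff (measurable_gaussianPDF 0 1)
      (ae_of_all _ fun x => gaussianPDF_lt_top)]
    have : (fun x : ℝ => Real.exp (x^2/4) * (gaussianPDF 0 1 x).toReal) =
       fun x => (Real.sqrt (2 * Real.pi))⁻¹ * Real.exp (-(1/4) * x^2) := by
      ext x
      rw [← hpdf, mul_comm, toReal_gaussianPDF]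
    rw [this]
    exact (integrable_exp_neg_mul_sq (by norm_num)).const_mul _
  · rw [integral_gaussianReal_eq_integral_smul (by norm_num)]
    simp only [smul_eq_mul]
    simp_rw [hpdf]
    rw [integral_const_mul, integral_gaussian, inv_mul_eq_div, ← Real.sqrt_div (by positivity)]
    apply Real.sqrt_le_iff.mpr
    constructor
    · norm_num
    · have : Real.pi / (1/4) / (2 * Real.pi) = 2 := by
        field_simp; norm_num
      rw [this]; norm_num

lemma gauss_relu_mgf : ∫ x, Real.exp (-64 * (max x 0)^2) ∂(gaussianReal 0 1) ≤ 65/100 := by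
  have hb : ∀ x : ℝ, Real.exp (-64 * (max x 0)^2) ≤
      (Set.Iic (1/4:ℝ)).indicator (fun _ => (1:ℝ)) x + Real.exp (-4) := by
    intro x
    by_cases hx : x ≤ 1/4
    · rw [Set.indicator_of_mem (by simpa using hx)]
      have : Real.exp (-64 * (max x 0)^2) ≤ 1 := by
        rw [Real.exp_le_one_iff]; nlinarith [sq_nonneg (max x 0)]
      linarith [Real.exp_pos (-4)]
    · rw [Set.indicator_of_notMem (by simpa using hx), zero_add]
      apply Real.exp_le_exp.mpr
      push Not at hx
      have : 1/4 ≤ max x 0 := le_max_of_le_left hx.le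
      nlinarith
  have hi : Integrable ((Set.Iic (1/4:ℝ)).indicator (fun _ => (1:ℝ))) (gaussianReal 0 1) :=
    (integrable_const (1:ℝ)).indicator measurableSet_Iic
  calc _ ≤ ∫ x, ((Set.Iic (1/4:ℝ)).indicator (fun _ => (1:ℝ)) x + Real.exp (-4)) ∂(gaussianReal 0 1) := by
        apply integral_mono_of_nonneg (ae_of_all _ fun x => (Real.exp_pos _).le)
          (hi.add (integrable_const _)) (ae_of_all _ hb)
    _ = (gaussianReal 0 1).real (Set.Iic (1/4)) + Real.exp (-4) := by
        rw [integral_add hi (integrable_const _), integral_indicator_const _ measurableSet_Iic]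
        simp
    _ ≤ 5/8 + 1/40 := by
        gcongr
        · exact ENNReal.toReal_le_of_le_ofReal (by norm_num) gauss_Iic_le
        · have h1 : (2.7182818283:ℝ) < Real.exp 1 := Real.exp_one_gt_d9
          have h4 : Real.exp 4 = (Real.exp 1)^4 := by rw [← Real.exp_nat_mul]; norm_num
          rw [Real.exp_neg, h4, one_div]
          apply inv_anti₀ (by norm_num)
          calc (40:ℝ) ≤ 2.7182818283^4 := by norm_num
            _ ≤ _ := by gcongr
    _ = 65/100 := by norm_num

lemma gauss_small_mgf (τ lam : ℝ) (hτ : 0 ≤ τ) (hl : 0 ≤ lam) :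
    Integrable (fun x : ℝ => Real.exp (if |x| ≤ τ then lam else 0)) (gaussianReal 0 1) ∧
    ∫ x, Real.exp (if |x| ≤ τ then lam else 0) ∂(gaussianReal 0 1) ≤ Real.exp (τ * Real.exp lam) := by
  have heq : (fun x : ℝ => Real.exp (if |x| ≤ τ then lam else 0)) =
      fun x => 1 + (Set.Icc (-τ) τ).indicator (fun _ => Real.exp lam - 1) x := by
    ext x
    by_cases h : |x| ≤ τ
    · rw [Set.indicator_of_mem (by simpa [abs_le] using h)]; simp [h]
    · rw [Set.indicator_of_notMem (by simpa [abs_le] using h)]; simp [h]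
  have hi : Integrable ((Set.Icc (-τ) τ).indicator (fun _ => Real.exp lam - 1)) (gaussianReal 0 1) :=
    (integrable_const _).indicator measurableSet_Icc
  rw [heq]
  refine ⟨(integrable_const _).add hi, ?_⟩
  rw [integral_add (integrable_const _) hi, integral_indicator_const _ measurableSet_Icc]
  simp only [integral_const, probReal_univ, smul_eq_mul, one_mul]
  have h1 : (gaussianReal 0 1).real (Set.Icc (-τ) τ) ≤ τ := by
    have := ENNReal.toReal_le_of_le_ofReal (by linarith) (gauss_Icc_le (-τ) τ (by linarith))
    simpa [Measure.real] using this.trans (by linarith)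
  have h2 : 0 ≤ Real.exp lam - 1 := by linarith [Real.one_le_exp hl]
  calc _ ≤ 1 + τ * (Real.exp lam - 1) := by gcongr
    _ ≤ τ * Real.exp lam + 1 := by nlinarith
    _ ≤ _ := Real.add_one_le_exp _

/-! #### tails for matrices -/

/-- chi-square tail. -/
lemma mat_chi (a b : ℕ) (hb : 1 ≤ b) (u : Fin b → ℝ) (hu : nsq u ≤ 1) (S : Finset (Fin a)) (θ : ℝ) :
    gaussMat a b (1 / (b : NNReal)) {w | (2 * S.card + 4 * θ) / b ≤
        ∑ i ∈ S, (∑ k, w i k * u k)^2} ≤ ENNReal.ofReal (Real.exp (-θ)) := by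
  have hs : MeasurableSet {x : Fin a → ℝ | (2 * S.card + 4 * θ) / b ≤ ∑ i ∈ S, (x i)^2} := by
    apply measurableSet_le <;> fun_prop
  have h0 := gaussMat_transfer a b (1 / (b : NNReal)) u _ hs
  simp only [Set.mem_ofPred_eq] at h0
  rw [h0]
  have hb' : (0:ℝ) < b := by exact_mod_cast hb
  have hσ : Real.sqrt (((1 / (b : NNReal) : NNReal) : ℝ) * nsq u) ^ 2 ≤ 1 / b := by
    rw [Real.sq_sqrt (mul_nonneg (NNReal.coe_nonneg _) (nsq_nonneg u))]
    push_cast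
    calc 1/(b:ℝ) * nsq u ≤ 1/b * 1 := by gcongr
      _ = _ := by ring
  obtain ⟨hi, hB⟩ := gauss_exp_sq
  have hc := chernoff a (gaussianReal 0 1) (fun x => x^2/4) hi (3/2) hB S (S.card/2 + θ)
  refine le_trans (le_trans (measure_mono ?_) hc) ?_
  · intro g hg
    simp only [Set.mem_ofPred_eq, mul_pow] at hg ⊢
    rw [← Finset.mul_sum] at hg
    have hg2 : (2 * S.card + 4 * θ) / b ≤ 1/b * ∑ i ∈ S, g i ^ 2 :=
      hg.trans (mul_le_mul_of_nonneg_right hσ (Finset.sum_nonneg fun _ _ => sq_nonneg _))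
    rw [← Finset.sum_div]
    rw [div_eq_mul_one_div, mul_comm] at hg2
    have := le_of_mul_le_mul_left hg2 (by positivity)
    linarith
  · apply ENNReal.ofReal_le_ofReal
    have h32 : (3/2:ℝ) ≤ Real.exp (1/2) := by linarith [Real.add_one_le_exp (1/2:ℝ)]
    calc (3/2:ℝ)^S.card * Real.exp (-(S.card/2+θ)) ≤ (Real.exp (1/2))^S.card * Real.exp (-(S.card/2+θ)) := by
          gcongr
      _ = _ := by
        rw [← Real.exp_nat_mul, ← Real.exp_add]; congr 1; ring

/-- lower bound for the norm after ReLU. -/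
lemma mat_relu_lower (a b : ℕ) (hb : 1 ≤ b) (u : Fin b → ℝ) :
    gaussMat a b (1 / (b : NNReal)) {w | ∑ i, (max (∑ k, w i k * u k) 0)^2 <
       1/640 * nsq u * a / b} ≤ ENNReal.ofReal ((3/4)^a) := by
  have hs : MeasurableSet {x : Fin a → ℝ | ∑ i, (max (x i) 0)^2 < 1/640 * nsq u * a / b} := by
    apply measurableSet_lt <;> fun_prop
  have h0 := gaussMat_transfer a b (1 / (b : NNReal)) u _ hs
  simp only [Set.mem_ofPred_eq] at h0
  rw [h0]
  have hb' : (0:ℝ) < b := by exact_mod_cast hb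
  set σ := Real.sqrt (((1 / (b : NNReal) : NNReal) : ℝ) * nsq u) with hσd
  have hσ : σ ^ 2 = nsq u / b := by
    rw [hσd, Real.sq_sqrt (mul_nonneg (NNReal.coe_nonneg _) (nsq_nonneg u))]
    push_cast; ring
  have hσ0 : 0 ≤ σ := Real.sqrt_nonneg _
  have hi : Integrable (fun x : ℝ => Real.exp (-64 * (max x 0)^2)) (gaussianReal 0 1) := by
    apply Integrable.of_bound (C := 1) (by fun_prop)
    refine ae_of_all _ fun x => ?_
    rw [Real.norm_eq_abs, abs_of_pos (Real.exp_pos _), Real.exp_le_one_iff]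
    nlinarith [sq_nonneg (max x 0)]
  have hc := chernoff a (gaussianReal 0 1) _ hi _ gauss_relu_mgf Finset.univ (-(a/10))
  refine le_trans (le_trans (measure_mono ?_) hc) ?_
  · intro g hg
    simp only [Set.mem_ofPred_eq] at hg ⊢
    have e1 : ∀ i, (max (σ * g i) 0)^2 = σ^2 * (max (g i) 0)^2 := by
      intro i
      rw [← mul_pow, mul_max_of_nonneg _ _ hσ0, mul_zero]
    simp_rw [e1] at hg
    rw [← Finset.mul_sum] at hg
    rw [← Finset.mul_sum]
    have h2 : 1/640 * nsq u * a / b = σ^2 * (a/640) := by rw [hσ]; ring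
    rw [h2] at hg
    have := lt_of_mul_lt_mul_left hg (sq_nonneg σ)
    linarith
  · apply ENNReal.ofReal_le_ofReal
    simp only [Finset.card_univ, Fintype.card_fin, neg_neg]
    have : Real.exp ((a:ℝ)/10) = (Real.exp (1/10))^a := by
      rw [← Real.exp_nat_mul]; congr 1; ring
    rw [this, ← mul_pow]
    gcongr
    have h1 : Real.exp (1/10) ≤ 10/9 := by
      have := Real.add_one_le_exp (-(1/10):ℝ)
      rw [Real.exp_neg] at this
      have h3 := Real.exp_pos (1/10)
      rw [le_inv_comm₀ (by norm_num) h3] at this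
      refine this.trans (by norm_num)
    nlinarith

/-- anti-concentration: few small coordinates. -/
lemma mat_small_count (a b : ℕ) (hb : 1 ≤ b) (u : Fin b → ℝ) (hu : 0 < nsq u) (τ lam K : ℝ)
    (hτ : 0 ≤ τ) (hl : 0 ≤ lam) :
    gaussMat a b (1 / (b : NNReal)) {w | K ≤ ((Finset.univ.filter fun i =>
        (∑ k, w i k * u k)^2 ≤ τ^2 * nsq u / b).card : ℝ)} ≤
      ENNReal.ofReal (Real.exp (a * (τ * Real.exp lam) - lam * K)) := by
  have hs : MeasurableSet {x : Fin a → ℝ | lam * K ≤ ∑ i, (if (x i)^2 ≤ τ^2 * nsq u / b then lam else 0)} := by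
    apply measurableSet_le (by fun_prop)
    apply Finset.measurable_sum
    intro i _
    apply Measurable.ite _ (by fun_prop) (by fun_prop)
    apply measurableSet_le <;> fun_prop
  have h0 := gaussMat_transfer a b (1 / (b : NNReal)) u _ hs
  simp only [Set.mem_ofPred_eq] at h0
  refine le_trans (measure_mono ?_) (h0.le.trans ?_)
  · intro w hw
    simp only [Set.mem_ofPred_eq] at hw ⊢
    rw [Finset.sum_ite, Finset.sum_const, Finset.sum_const_zero, add_zero, nsmul_eq_mul, mul_comm]
    gcongr
  have hb' : (0:ℝ) < b := by exact_mod_cast hb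
  set σ := Real.sqrt (((1 / (b : NNReal) : NNReal) : ℝ) * nsq u) with hσd
  have hσ : σ ^ 2 = nsq u / b := by
    rw [hσd, Real.sq_sqrt (mul_nonneg (NNReal.coe_nonneg _) (nsq_nonneg u))]
    push_cast; ring
  have hσ0 : 0 < σ^2 := by rw [hσ]; positivity
  obtain ⟨hi, hB⟩ := gauss_small_mgf τ lam hτ hl
  have hc := chernoff a (gaussianReal 0 1) _ hi _ hB Finset.univ (lam * K)
  refine le_trans (le_trans (measure_mono ?_) hc) ?_
  · intro g hg
    simp only [Set.mem_ofPred_eq] at hg ⊢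
    have e1 : ∀ i, ((σ * g i)^2 ≤ τ^2 * nsq u / b) ↔ |g i| ≤ τ := by
      intro i
      rw [mul_pow, show τ^2 * nsq u / b = σ^2 * τ^2 by rw [hσ]; ring,
        mul_le_mul_iff_right₀ hσ0, sq_le_sq, abs_of_nonneg hτ]
    simp_rw [e1] at hg
    exact hg
  · apply ENNReal.ofReal_le_ofReal
    simp only [Finset.card_univ, Fintype.card_fin]
    rw [← Real.exp_nat_mul, ← Real.exp_add]
    apply Real.exp_le_exp.mpr
    linarith

lemma row_null (b : ℕ) (v : NNReal) (hv : v ≠ 0) (u : Fin b → ℝ) (hu : u ≠ 0) :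
    (Measure.pi fun _ : Fin b => gaussianReal 0 v) {r | ∑ k, r k * u k = 0} = 0 := by
  have hm : Measurable (fun r : Fin b → ℝ => ∑ k, r k * u k) := by fun_prop
  have hpos : 0 < nsq u := by
    obtain ⟨k, hk⟩ : ∃ k, u k ≠ 0 := by
      by_contra h; push Not at h; exact hu (funext h)
    exact Finset.sum_pos' (fun _ _ => sq_nonneg _) ⟨k, Finset.mem_univ _, by positivity⟩
  have h : ∀ μ ν : Measure ℝ, μ = ν → μ {0} = ν {0} := fun μ ν h => by rw [h]
  have h := h _ _ (law_row b v u)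
  rw [Measure.map_apply hm (measurableSet_singleton _),
    Measure.map_apply (by fun_prop) (measurableSet_singleton _)] at h
  refine (Eq.trans ?_ h).trans ?_
  · rfl
  · have : (fun g : ℝ => Real.sqrt (v * nsq u) * g) ⁻¹' {0} = {0} := by
      ext g
      have hv' : (0:ℝ) < v := by positivity
      have : Real.sqrt (v * nsq u) ≠ 0 := (Real.sqrt_pos.mpr (by positivity)).ne'
      simp only [Set.mem_preimage, Set.mem_singleton_iff, mul_eq_zero, this, false_or]
    rw [this]
    have := nullSingletonClass_gaussianReal (μ := 0) (v := 1) (by norm_num)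
    exact measure_singleton _

lemma mat_no_ties (a b : ℕ) (v : NNReal) (hv : v ≠ 0) (u : Fin b → ℝ) (hu : u ≠ 0) :
    gaussMat a b v {w | ∃ i, ∑ k, w i k * u k = 0} = 0 := by
  have : {w : Fin a → Fin b → ℝ | ∃ i, ∑ k, w i k * u k = 0} =
      ⋃ i, (fun w => w i) ⁻¹' {r | ∑ k, r k * u k = 0} := by
    ext w; simp
  rw [this]
  refine measure_iUnion_null fun i => ?_
  have hq : Measure.QuasiMeasurePreserving (Function.eval i)
      (Measure.pi fun _ : Fin a => Measure.pi fun _ : Fin b => gaussianReal 0 v)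
      (Measure.pi fun _ : Fin b => gaussianReal 0 v) :=
    Measure.quasiMeasurePreserving_eval _ i
  exact hq.preimage_null (row_null b v hv u hu)

end

open MeasureTheory ProbabilityTheory
noncomputable section

/-! ### Operator bounds on subspaces -/

lemma exists_onb {b : ℕ} (H : Submodule ℝ (Fin b → ℝ)) :
    ∃ (p : ℕ) (e : Fin p → Fin b → ℝ), p = Module.finrank ℝ H ∧
      (∀ c : Fin p → ℝ, nsq (fun k => ∑ j, c j * e j k) = nsq c) ∧
      ∀ h ∈ H, ∃ c : Fin p → ℝ, h = fun k => ∑ j, c j * e j k := by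
  let φ := (WithLp.linearEquiv 2 ℝ (Fin b → ℝ)).symm
  let H' : Submodule ℝ (EuclideanSpace ℝ (Fin b)) := H.map φ.toLinearMap
  let B := stdOrthonormalBasis ℝ H'
  have key : ∀ c : Fin (Module.finrank ℝ H') → ℝ, ∀ k,
      ((B.repr.symm (WithLp.toLp 2 c) : H') : EuclideanSpace ℝ (Fin b)) k =
        ∑ j, c j * ((B j : H') : EuclideanSpace ℝ (Fin b)) k := by
    intro c k
    rw [← OrthonormalBasis.sum_repr_symm]
    simp
  refine ⟨Module.finrank ℝ H', fun j k => ((B j : H') : EuclideanSpace ℝ (Fin b)) k, ?_, ?_, ?_⟩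
  · exact LinearEquiv.finrank_map_eq φ H
  · intro c
    have h1 : ‖B.repr.symm (WithLp.toLp 2 c)‖ ^ 2 = nsq c := by
      rw [LinearIsometryEquiv.norm_map, EuclideanSpace.norm_sq_eq]
      simp [nsq]
    rw [← h1]
    rw [← Submodule.norm_coe, EuclideanSpace.norm_sq_eq]
    unfold nsq
    refine Finset.sum_congr rfl fun k _ => ?_
    rw [key]; simp
  · intro h hh
    have hm : φ h ∈ H' := Submodule.mem_map_of_mem hh
    refine ⟨fun j => B.repr ⟨φ h, hm⟩ j, ?_⟩
    ext k
    rw [← key]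
    have : (WithLp.toLp 2 fun j => B.repr ⟨φ h, hm⟩ j) = B.repr ⟨φ h, hm⟩ := by ext; rfl
    rw [this, LinearIsometryEquiv.symm_apply_apply]
    rfl

lemma trunc_exists (x : ℝ) : ∃ k : ℤ, |x - k| ≤ 1 ∧ |(k:ℝ)| ≤ |x| := by
  rcases le_total 0 x with h | h
  · refine ⟨⌊x⌋, ?_, ?_⟩
    · rw [abs_le]; constructor <;> linarith [Int.floor_le x, Int.lt_floor_add_one x]
    · have : (0:ℝ) ≤ ⌊x⌋ := by exact_mod_cast Int.floor_nonneg.mpr h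
      rw [abs_of_nonneg h, abs_of_nonneg this]; exact Int.floor_le x
  · refine ⟨⌈x⌉, ?_, ?_⟩
    · rw [abs_le]; constructor <;> linarith [Int.le_ceil x, Int.ceil_lt_add_one x]
    · have : (⌈x⌉:ℝ) ≤ 0 := by exact_mod_cast Int.ceil_nonpos.mpr h
      rw [abs_of_nonpos h, abs_of_nonpos this]; linarith [Int.le_ceil x]

lemma net_op {p : ℕ} {E : Type*} [NormedAddCommGroup E] [NormedSpace ℝ E]
    (T : EuclideanSpace ℝ (Fin p) →L[ℝ] E) (N : ℝ) (hN0 : 0 ≤ N)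
    (hN : ∀ c : Fin p → ℤ, (∀ j, |c j| ≤ 2 * (p:ℤ)) → nsq (fun j => (c j : ℝ) / (2 * p)) ≤ 1 →
      ‖T (WithLp.toLp 2 fun j => (c j : ℝ) / (2 * p))‖ ≤ N) : ‖T‖ ≤ 2 * N := by
  have h1 : ‖T‖ ≤ N + ‖T‖ * (1/2) := by
    refine ContinuousLinearMap.opNorm_le_of_unit_norm (by positivity) ?_
    intro h hh
    rcases Nat.eq_zero_or_pos p with hp | hp
    · subst hp
      have : h = 0 := Subsingleton.elim _ _
      rw [this, norm_zero] at hh; norm_num at hh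
    have hp' : (1:ℝ) ≤ p := by exact_mod_cast hp
    choose c hc1 hc2 using fun j => trunc_exists (h j * (2 * p))
    have hcle : ∀ j, |(c j : ℝ) / (2 * p)| ≤ |h j| := by
      intro j
      rw [abs_div, abs_of_pos (by positivity : (0:ℝ) < 2 * p), div_le_iff₀ (by positivity)]
      refine (hc2 j).trans ?_
      rw [abs_mul, abs_of_pos (by positivity : (0:ℝ) < 2 * p)]
    have hnorm : ∑ j, (h j)^2 = 1 := by
      have := EuclideanSpace.norm_sq_eq h
      rw [hh] at this
      simpa using this.symm
    have hhj : ∀ j, |h j| ≤ 1 := by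
      intro j
      rw [← sq_le_one_iff_abs_le_one, ← hnorm]
      exact Finset.single_le_sum (f := fun j => (h j)^2) (fun _ _ => sq_nonneg _) (Finset.mem_univ j)
    have hcb : ∀ j, |c j| ≤ 2 * (p:ℤ) := by
      intro j
      have h2 := hc2 j
      rw [abs_mul, abs_of_pos (by positivity : (0:ℝ) < 2 * p)] at h2
      have h3 : |(c j:ℝ)| ≤ 2 * p := by
        refine h2.trans ?_
        nlinarith [hhj j]
      exact_mod_cast h3
    have hns : nsq (fun j => (c j : ℝ) / (2 * p)) ≤ 1 := by
      rw [← hnorm]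
      exact Finset.sum_le_sum fun j _ => sq_le_sq.mpr (hcle j)
    set u : EuclideanSpace ℝ (Fin p) := WithLp.toLp 2 fun j => (c j : ℝ) / (2 * p) with hu
    have hd : ‖h - u‖ ≤ 1/2 := by
      rw [EuclideanSpace.norm_eq]
      apply Real.sqrt_le_iff.mpr
      refine ⟨by norm_num, ?_⟩
      have : ∀ j, ‖(h - u) j‖^2 ≤ 1/(4 * (p:ℝ)) := by
        intro j
        have e1 : (h - u) j = (h j * (2 * p) - c j) / (2 * p) := by
          simp [hu]; field_simp
        rw [e1, Real.norm_eq_abs, sq_abs, div_pow]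
        have := sq_le_one_iff_abs_le_one (h j * (2*p) - c j) |>.mpr (hc1 j)
        rw [div_le_div_iff₀ (by positivity) (by positivity)]
        nlinarith
      calc ∑ j, ‖(h - u) j‖^2 ≤ ∑ _j : Fin p, 1/(4 * (p:ℝ)) := Finset.sum_le_sum fun j _ => this j
        _ = (1/2)^2 := by simp; field_simp; norm_num
    calc ‖T h‖ = ‖T u + T (h - u)‖ := by rw [← map_add]; congr 2; abel
      _ ≤ ‖T u‖ + ‖T (h - u)‖ := norm_add_le _ _
      _ ≤ N + ‖T‖ * (1/2) := by
        gcongr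
        · exact hN c hcb hns
        · exact (T.le_opNorm _).trans (by gcongr)
  linarith

/-- Good behaviour of the matrix `w` on the subspace `H`. -/
def OpGood {a b : ℕ} (w : Fin a → Fin b → ℝ) (A2 : ℝ) (n : ℕ) (H : Submodule ℝ (Fin b → ℝ)) : Prop :=
  ∀ h ∈ H, ∀ S : Finset (Fin a),
    ∑ i ∈ S, (∑ k, w i k * h k)^2 ≤ A2 * nsq h * (max S.card n : ℕ) / b

lemma op_det {a b p : ℕ} (w : Fin a → Fin b → ℝ) (e : Fin p → Fin b → ℝ) (S : Finset (Fin a))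
    (N2 : ℝ) (hN0 : 0 ≤ N2)
    (hN : ∀ c : Fin p → ℤ, (∀ j, |c j| ≤ 2 * (p:ℤ)) → nsq (fun j => (c j : ℝ) / (2 * p)) ≤ 1 →
      ∑ i ∈ S, (∑ k, w i k * (∑ j, (c j : ℝ) / (2 * p) * e j k))^2 ≤ N2) (c : Fin p → ℝ) :
    ∑ i ∈ S, (∑ k, w i k * (∑ j, c j * e j k))^2 ≤ 4 * N2 * nsq c := by
  let T0 : EuclideanSpace ℝ (Fin p) →ₗ[ℝ] EuclideanSpace ℝ S :=
    { toFun := fun c => WithLp.toLp 2 fun i => ∑ k, w i k * (∑ j, c j * e j k)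
      map_add' := by
        intro x y
        ext i
        simp only [PiLp.add_apply, add_mul, Finset.sum_add_distrib, mul_add]
      map_smul' := by
        intro r x
        ext i
        simp only [PiLp.smul_apply, smul_eq_mul, RingHom.id_apply, Finset.mul_sum]
        refine Finset.sum_congr rfl fun k _ => Finset.sum_congr rfl fun j _ => ?_
        ring }
  let T := LinearMap.toContinuousLinearMap T0
  have hT : ∀ c : Fin p → ℝ, ‖T (WithLp.toLp 2 c)‖^2 = ∑ i ∈ S, (∑ k, w i k * (∑ j, c j * e j k))^2 := by
    intro c
    rw [EuclideanSpace.norm_sq_eq, ← Finset.sum_coe_sort S]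
    refine Finset.sum_congr rfl fun i _ => ?_
    rw [Real.norm_eq_abs, sq_abs]; rfl
  have h1 : ‖T‖ ≤ 2 * Real.sqrt N2 := by
    refine net_op T _ (Real.sqrt_nonneg _) ?_
    intro c h1 h2
    apply Real.le_sqrt_of_sq_le
    rw [hT]; exact hN c h1 h2
  rw [← hT]
  have h2 := T.le_opNorm (WithLp.toLp 2 c)
  have h3 : ‖(WithLp.toLp 2 c : EuclideanSpace ℝ (Fin p))‖^2 = nsq c := by
    rw [EuclideanSpace.norm_sq_eq]; simp [nsq]
  calc _ ≤ (‖T‖ * ‖(WithLp.toLp 2 c : EuclideanSpace ℝ (Fin p))‖)^2 := by gcongr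
    _ ≤ (2 * Real.sqrt N2 * ‖(WithLp.toLp 2 c : EuclideanSpace ℝ (Fin p))‖)^2 := by gcongr
    _ = _ := by rw [mul_pow, mul_pow, Real.sq_sqrt hN0, h3]; norm_num

lemma op_single (a b n : ℕ) (hb : 1 ≤ b) (hn : 1 ≤ n) (H : Submodule ℝ (Fin b → ℝ))
    (hH : Module.finrank ℝ H ≤ n + 1) (Y : ℝ) (hY : 1 ≤ Y) (ha : (a:ℝ) ≤ Real.exp Y)
    (hbY : (5 * b : ℝ) ≤ Real.exp Y) :
    gaussMat a b (1 / (b : NNReal)) {w | ¬ OpGood w (1000 * Y) n H} ≤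
      ENNReal.ofReal (Real.exp (-15 * n * Y)) := by
  obtain ⟨p, e, hp, he, hspan⟩ := exists_onb H
  have hpb : p ≤ b := by
    rw [hp]; simpa using Submodule.finrank_le H
  have hpn : p ≤ 2 * n := by omega
  have hb' : (0:ℝ) < b := by exact_mod_cast hb
  have hn' : (1:ℝ) ≤ n := by exact_mod_cast hn
  let I := Fin p → Finset.Icc (-(2 * (p:ℤ))) (2 * p)
  let u : I → Fin b → ℝ := fun c k => ∑ j, ((c j : ℤ) : ℝ) / (2 * p) * e j k
  let θ : Finset (Fin a) → ℝ := fun S => 20 * (n + S.card) * Y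
  let Bad : Finset (Fin a) → I → Set (Fin a → Fin b → ℝ) := fun S c =>
    {w | nsq (u c) ≤ 1 ∧ (2 * S.card + 4 * θ S) / b ≤ ∑ i ∈ S, (∑ k, w i k * u c k)^2}
  have hBad : ∀ S c, gaussMat a b (1 / (b : NNReal)) (Bad S c) ≤ ENNReal.ofReal (Real.exp (-θ S)) := by
    intro S c
    by_cases h : nsq (u c) ≤ 1
    · refine le_trans (measure_mono ?_) (mat_chi a b hb (u c) h S (θ S))
      intro w hw; exact hw.2
    · have : Bad S c = ∅ := by
        ext w; simp [Bad, h]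
      rw [this]; simp
  have hsub : {w | ¬ OpGood w (1000 * Y) n H} ⊆ ⋃ S, ⋃ c, Bad S c := by
    intro w hw
    by_contra hcon
    apply hw
    simp only [Set.mem_iUnion, not_exists] at hcon
    intro h hh S
    obtain ⟨c, rfl⟩ := hspan h hh
    rw [he]
    have hmx : ((max S.card n : ℕ) : ℝ) = max (S.card : ℝ) n := by push_cast; rfl
    have h4 := op_det w e S ((2 * S.card + 4 * θ S) / b) (by positivity) (by
      intro c hc hcn
      let c' : I := fun j => ⟨c j, by
        rw [Finset.mem_Icc]; exact abs_le.mp (hc j)⟩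
      have hnot := hcon S c'
      have hu1 : nsq (u c') ≤ 1 := by
        have := he (fun j => (c j : ℝ) / (2 * p))
        exact this.le.trans hcn
      by_contra hlt
      exact hnot ⟨hu1, (not_le.mp hlt).le⟩) c
    refine h4.trans ?_
    have hS : (S.card : ℝ) ≤ (max S.card n : ℕ) := by exact_mod_cast le_max_left _ _
    have hnm : (n : ℝ) ≤ (max S.card n : ℕ) := by exact_mod_cast le_max_right _ _
    set m : ℝ := ((max S.card n : ℕ) : ℝ)
    have hm0 : 1 ≤ m := hn'.trans hnm
    have hbound : 4 * (2 * S.card + 4 * θ S) ≤ 1000 * Y * m := by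
      simp only [θ]
      have t1 : (S.card : ℝ) ≤ Y * m := hS.trans (by nlinarith)
      have t2 : (n + S.card : ℝ) * Y ≤ 2 * m * Y := by gcongr; linarith
      nlinarith
    calc 4 * ((2 * S.card + 4 * θ S) / b) * nsq c = (4 * (2 * S.card + 4 * θ S)) * (nsq c / b) := by ring
      _ ≤ (1000 * Y * m) * (nsq c / b) := by
          apply mul_le_mul_of_nonneg_right hbound
          exact div_nonneg (nsq_nonneg c) hb'.le
      _ = _ := by ring
  have hcard : (Fintype.card I : ℝ) ≤ Real.exp (2 * n * Y) := by
    have h1 : Fintype.card I = (4 * p + 1)^p := by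
      simp only [I, Fintype.card_fun, Fintype.card_fin, Fintype.card_coe, Int.card_Icc]
      congr 1; omega
    rw [h1]; push_cast
    rcases Nat.eq_zero_or_pos p with h0 | h0
    · subst h0; simp; positivity
    have hp1 : (1:ℝ) ≤ p := by exact_mod_cast h0
    have hpb' : (p:ℝ) ≤ b := by exact_mod_cast hpb
    have hpn' : (p:ℝ) ≤ 2 * n := by exact_mod_cast hpn
    calc (4 * (p:ℝ) + 1)^p ≤ (Real.exp Y)^p := by gcongr; linarith
      _ = Real.exp (p * Y) := by rw [← Real.exp_nat_mul]
      _ ≤ _ := by gcongr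
  have hsumS : ∑ S : Finset (Fin a), Real.exp (-θ S) ≤ Real.exp (-20 * n * Y) * Real.exp 1 := by
    have h1 : ∀ S : Finset (Fin a), Real.exp (-θ S) =
        Real.exp (-20 * n * Y) * ((Real.exp (-20 * Y))^S.card * 1^(Fintype.card (Fin a) - S.card)) := by
      intro S
      rw [one_pow, mul_one, ← Real.exp_nat_mul, ← Real.exp_add]
      congr 1; simp only [θ]; ring
    simp_rw [h1]
    rw [← Finset.mul_sum, Fintype.sum_pow_mul_eq_add_pow]
    gcongr
    simp only [Fintype.card_fin]
    calc (Real.exp (-20 * Y) + 1)^a ≤ (Real.exp (Real.exp (-20 * Y)))^a := by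
          gcongr; exact Real.add_one_le_exp _
      _ = Real.exp (a * Real.exp (-20 * Y)) := by rw [← Real.exp_nat_mul]
      _ ≤ Real.exp 1 := by
        apply Real.exp_le_exp.mpr
        calc (a:ℝ) * Real.exp (-20 * Y) ≤ Real.exp Y * Real.exp (-20 * Y) := by gcongr
          _ = Real.exp (-19 * Y) := by rw [← Real.exp_add]; congr 1; ring
          _ ≤ 1 := by rw [Real.exp_le_one_iff]; linarith
  calc _ ≤ gaussMat a b (1 / (b : NNReal)) (⋃ S, ⋃ c, Bad S c) := measure_mono hsub
    _ ≤ ∑ S, ∑ c, gaussMat a b (1 / (b : NNReal)) (Bad S c) :=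
        (measure_iUnion_fintype_le _ _).trans (Finset.sum_le_sum fun S _ => measure_iUnion_fintype_le _ _)
    _ ≤ ∑ S, ∑ c : I, ENNReal.ofReal (Real.exp (-θ S)) :=
        Finset.sum_le_sum fun S _ => Finset.sum_le_sum fun c _ => hBad S c
    _ = ENNReal.ofReal (∑ S, (Fintype.card I) * Real.exp (-θ S)) := by
        rw [ENNReal.ofReal_sum_of_nonneg (fun _ _ => by positivity)]
        refine Finset.sum_congr rfl fun S _ => ?_
        rw [Finset.sum_const, Finset.card_univ, ENNReal.ofReal_mul (by positivity), nsmul_eq_mul,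
          ENNReal.ofReal_natCast]
    _ ≤ _ := by
      apply ENNReal.ofReal_le_ofReal
      rw [← Finset.mul_sum]
      calc _ ≤ Real.exp (2 * n * Y) * (Real.exp (-20 * n * Y) * Real.exp 1) := by gcongr
        _ = Real.exp (2 * n * Y + (-20 * n * Y + 1)) := by rw [Real.exp_add, Real.exp_add]
        _ ≤ _ := by
          apply Real.exp_le_exp.mpr
          nlinarith

end

open MeasureTheory ProbabilityTheory
noncomputable section

/-! ### Genericity and counting of sign patterns -/

/-- any `finrank V` rows of `w` separate the points of `V` -/
def Generic {a b : ℕ} (w : Fin a → Fin b → ℝ) (V : Submodule ℝ (Fin b → ℝ)) : Prop :=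
  ∀ J : Finset (Fin a), Module.finrank ℝ V ≤ J.card → ∀ h ∈ V,
    (∀ i ∈ J, ∑ k, w i k * h k = 0) → h = 0

/-- the part of `V` killed by the rows in `J` -/
def killed {a b : ℕ} (w : Fin a → Fin b → ℝ) (V : Submodule ℝ (Fin b → ℝ)) (J : Finset (Fin a)) :
    Submodule ℝ (Fin b → ℝ) where
  carrier := {h | h ∈ V ∧ ∀ i ∈ J, ∑ k, w i k * h k = 0}
  add_mem' := by
    rintro x y ⟨hx, hx'⟩ ⟨hy, hy'⟩
    refine ⟨V.add_mem hx hy, fun i hi => ?_⟩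
    simp only [Pi.add_apply, mul_add, Finset.sum_add_distrib, hx' i hi, hy' i hi, add_zero]
  zero_mem' := ⟨V.zero_mem, fun i _ => by simp⟩
  smul_mem' := by
    rintro c x ⟨hx, hx'⟩
    refine ⟨V.smul_mem c hx, fun i hi => ?_⟩
    have : ∑ k, w i k * (c • x) k = c * ∑ k, w i k * x k := by
      rw [Finset.mul_sum]; refine Finset.sum_congr rfl fun k _ => ?_
      simp; ring
    rw [this, hx' i hi, mul_zero]

lemma generic_outer (a b : ℕ) (v : NNReal) (hv : v ≠ 0) (𝓥 : Finset (Submodule ℝ (Fin b → ℝ))) :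
    1 ≤ gaussMat a b v {w | ∀ V ∈ 𝓥, Generic w V} := by
  let P : Fin a → (Fin a → Fin b → ℝ) → Prop := fun i w =>
    ∀ V ∈ 𝓥, ∀ J : Finset (Fin a), (∀ j ∈ J, j < i) →
      killed w V J = ⊥ ∨ ∃ h ∈ killed w V J, ∑ k, w i k * h k ≠ 0
  have hkill : ∀ (i : Fin a) (w w' : Fin a → Fin b → ℝ), (∀ j, j < i → w j = w' j) →
      ∀ V (J : Finset (Fin a)), (∀ j ∈ J, j < i) → killed w V J = killed w' V J := by
    intro i w w' h V J hJ
    ext x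
    constructor
    · rintro ⟨h1, h2⟩
      exact ⟨h1, fun j hj => by rw [← h j (hJ j hj)]; exact h2 j hj⟩
    · rintro ⟨h1, h2⟩
      exact ⟨h1, fun j hj => by rw [h j (hJ j hj)]; exact h2 j hj⟩
  have hmain := outer_pi_chain a (fun _ => Fin b → ℝ)
    (fun _ => Measure.pi fun _ : Fin b => gaussianReal 0 v) P ?_ 1 ?_
  · rw [one_pow] at hmain
    refine hmain.trans (measure_mono ?_)
    intro w hw V hV
    have hcl : ∀ J : Finset (Fin a), killed w V J = ⊥ ∨
        Module.finrank ℝ (killed w V J) + J.card ≤ Module.finrank ℝ V := by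
      intro J
      induction J using Finset.induction_on_max with
      | empty =>
        right
        have : killed w V ∅ ≤ V := fun x hx => hx.1
        simpa using Submodule.finrank_mono this
      | insert i J hlt ih =>
        have hle : killed w V (insert i J) ≤ killed w V J :=
          fun x hx => ⟨hx.1, fun j hj => hx.2 j (Finset.mem_insert_of_mem hj)⟩
        rcases hw i V hV J hlt with h0 | ⟨h, hh, hne⟩
        · left; rw [h0] at hle; exact le_bot_iff.mp hle
        · have hlt' : killed w V (insert i J) < killed w V J := by
            refine lt_of_le_of_ne hle ?_
            intro heq
            rw [← heq] at hh
            exact hne (hh.2 i (Finset.mem_insert_self _ _))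
          rcases ih with h0 | h1
          · left; rw [h0] at hle; exact le_bot_iff.mp hle
          · right
            have := Submodule.finrank_lt_finrank_of_lt hlt'
            rw [Finset.card_insert_of_notMem (fun hmem => lt_irrefl _ (hlt i hmem))]
            omega
    intro J hJ h hhV hker
    have hmem : h ∈ killed w V J := ⟨hhV, hker⟩
    rcases hcl J with h0 | h1
    · rw [h0] at hmem; exact hmem
    · have : Module.finrank ℝ (killed w V J) = 0 := by omega
      rw [Submodule.finrank_eq_zero] at this
      rw [this] at hmem; exact hmem
  · intro i w w' h hP V hV J hJ
    have e := hkill i w w' (fun j hj => h j hj.le) V J hJ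
    have := hP V hV J hJ
    rw [e, h i le_rfl] at this
    exact this
  · intro i w _
    have hae : ∀ᵐ r ∂(Measure.pi fun _ : Fin b => gaussianReal 0 v), P i (Function.update w i r) := by
      have h1 : ∀ V ∈ 𝓥, ∀ J : Finset (Fin a), ∀ᵐ r ∂(Measure.pi fun _ : Fin b => gaussianReal 0 v),
          killed w V J = ⊥ ∨ ∃ h ∈ killed w V J, ∑ k, r k * h k ≠ 0 := by
        intro V _ J
        by_cases h0 : killed w V J = ⊥
        · exact ae_of_all _ fun r => Or.inl h0
        · obtain ⟨h, hh, hne⟩ := (Submodule.ne_bot_iff _).mp h0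
          have : ∀ᵐ r ∂(Measure.pi fun _ : Fin b => gaussianReal 0 v), ∑ k, r k * h k ≠ 0 := by
            rw [ae_iff]; simpa using row_null b v hv h hne
          filter_upwards [this] with r hr
          exact Or.inr ⟨h, hh, hr⟩
      have h2 : ∀ᵐ r ∂(Measure.pi fun _ : Fin b => gaussianReal 0 v), ∀ V ∈ 𝓥, ∀ J : Finset (Fin a),
          killed w V J = ⊥ ∨ ∃ h ∈ killed w V J, ∑ k, r k * h k ≠ 0 := by
        rw [Filter.eventually_all_finset]
        intro V hV
        rw [Filter.eventually_all]
        exact h1 V hV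
      filter_upwards [h2] with r hr V hV J hJ
      rw [hkill i (Function.update w i r) w
        (fun j hj => by rw [Function.update_of_ne hj.ne]) V J hJ]
      simpa using hr V hV J
    have : {r | P i (Function.update w i r)} =ᵐ[Measure.pi fun _ : Fin b => gaussianReal 0 v] Set.univ :=
      Filter.eventuallyEq_univ.mpr hae
    rw [measure_congr this]; simp

open Classical in
/-- sign patterns realised by nonzero vectors of `V` -/
def signFam {a b : ℕ} (w : Fin a → Fin b → ℝ) (V : Submodule ℝ (Fin b → ℝ)) : Finset (Finset (Fin a)) :=
  Finset.univ.filter fun A => ∃ h ∈ V, h ≠ 0 ∧ (∀ i ∈ A, 0 ≤ ∑ k, w i k * h k) ∧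
    (∀ i ∉ A, ∑ k, w i k * h k ≤ 0)

lemma signFam_shatter {a b : ℕ} (w : Fin a → Fin b → ℝ) (V : Submodule ℝ (Fin b → ℝ))
    (hg : Generic w V) (S : Finset (Fin a)) (hS : (signFam w V).Shatters S) :
    S.card ≤ Module.finrank ℝ V := by
  classical
  by_contra hlt
  push Not at hlt
  let φ : (J : Finset (Fin a)) → V →ₗ[ℝ] (J → ℝ) := fun J =>
    { toFun := fun h i => ∑ k, w i k * (h : Fin b → ℝ) k
      map_add' := by
        intro x y; ext i
        simp [mul_add, Finset.sum_add_distrib]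
      map_smul' := by
        intro c x; ext i
        simp only [Submodule.coe_smul, Pi.smul_apply, smul_eq_mul, RingHom.id_apply, Finset.mul_sum]
        refine Finset.sum_congr rfl fun k _ => ?_
        ring }
  have hrange : LinearMap.range (φ S) < ⊤ := by
    rw [lt_top_iff_ne_top]
    intro htop
    have h1 := LinearMap.finrank_range_le (φ S)
    rw [htop, finrank_top] at h1
    simp at h1
    omega
  obtain ⟨f, hf0, hf⟩ := Submodule.exists_le_ker_of_lt_top _ hrange
  let c : S → ℝ := fun i => f (Pi.single i 1)
  have hfsum : ∀ x : S → ℝ, f x = ∑ i, x i * c i := by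
    intro x
    rw [LinearMap.pi_apply_eq_sum_univ f x]
    refine Finset.sum_congr rfl fun i _ => ?_
    rw [smul_eq_mul]
    congr 2
    ext j; simp [Pi.single_apply, eq_comm]
  have hc0 : ∃ i, c i ≠ 0 := by
    by_contra h; push Not at h
    apply hf0
    refine LinearMap.ext fun x => ?_
    rw [hfsum]
    simp [h]
  have hdep : ∀ h ∈ V, ∑ i : S, (∑ k, w i k * h k) * c i = 0 := by
    intro h hh
    have : φ S ⟨h, hh⟩ ∈ LinearMap.ker f := hf ⟨_, rfl⟩
    rw [LinearMap.mem_ker, hfsum] at this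
    exact this
  let d : Fin a → ℝ := fun i => if hi : i ∈ S then c ⟨i, hi⟩ else 0
  have hdep' : ∀ h ∈ V, ∑ i ∈ S, (∑ k, w i k * h k) * d i = 0 := by
    intro h hh
    rw [← hdep h hh, ← Finset.sum_coe_sort S]
    refine Finset.sum_congr rfl fun i _ => ?_
    simp [d]
  let J0 := S.filter fun i => d i ≠ 0
  have hJ0 : Module.finrank ℝ V ≤ J0.card := by
    by_contra hcon
    push Not at hcon
    obtain ⟨J, hJ1, hJ2, hJ3⟩ := Finset.exists_subsuperset_card_eq (Finset.filter_subset _ S)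
      hcon.le hlt.le
    have hinj : Function.Injective (φ J) := by
      rw [← LinearMap.ker_eq_bot, LinearMap.ker_eq_bot']
      intro x hx
      have := hg J hJ3.ge x x.2 (fun i hi => congrFun hx ⟨i, hi⟩)
      exact Subtype.ext this
    have hsurj : Function.Surjective (φ J) :=
      (LinearMap.injective_iff_surjective_of_finrank_eq_finrank (by simp [hJ3])).mp hinj
    obtain ⟨h, hh⟩ := hsurj fun i => d i
    have h1 := hdep' h h.2
    have h2 : ∑ i ∈ S, (∑ k, w i k * (h : Fin b → ℝ) k) * d i = ∑ i ∈ J0, d i * d i := by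
      rw [Finset.sum_filter]
      refine Finset.sum_congr rfl fun i hi => ?_
      by_cases hd : d i = 0
      · simp [hd]
      · have : i ∈ J := hJ1 (Finset.mem_filter.mpr ⟨hi, hd⟩)
        have h3 := congrFun hh ⟨i, this⟩
        simp only [hd, ne_eq, not_false_eq_true, if_true]
        congr 1
    rw [h2] at h1
    obtain ⟨i, hi⟩ := hc0
    have hdi : d i ≠ 0 := by simpa [d] using hi
    have hpos : 0 < ∑ i ∈ J0, d i * d i :=
      Finset.sum_pos' (fun j _ => mul_self_nonneg _)
        ⟨i, Finset.mem_filter.mpr ⟨i.2, hdi⟩, mul_self_pos.mpr hdi⟩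
    linarith
  obtain ⟨A, hA, hAS⟩ := hS (Finset.filter_subset (fun i => 0 < d i) S)
  simp only [signFam, Finset.mem_filter, Finset.mem_univ, true_and] at hA
  obtain ⟨h, hhV, hne, hp, hn⟩ := hA
  apply hne
  refine hg J0 hJ0 h hhV ?_
  have hmemA : ∀ i ∈ S, (i ∈ A ↔ 0 < d i) := by
    intro i hi
    have : i ∈ S ∩ A ↔ i ∈ S.filter (fun i => 0 < d i) := by rw [hAS]
    simp only [Finset.mem_inter, hi, true_and, Finset.mem_filter] at this
    exact this
  have hterm : ∀ i ∈ S, 0 ≤ (∑ k, w i k * h k) * d i := by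
    intro i hi
    by_cases hd : 0 < d i
    · exact mul_nonneg (hp i ((hmemA i hi).mpr hd)) hd.le
    · exact mul_nonneg_of_nonpos_of_nonpos (hn i (fun h => hd ((hmemA i hi).mp h))) (not_lt.mp hd)
  have hz := (Finset.sum_eq_zero_iff_of_nonneg hterm).mp (hdep' h hhV)
  intro i hi
  obtain ⟨hiS, hid⟩ := Finset.mem_filter.mp hi
  exact (mul_eq_zero.mp (hz i hiS)).resolve_right hid

lemma sum_choose_le (a r : ℕ) : ∑ k ∈ Finset.Iic r, a.choose k ≤ (a+1)^r := by
  rw [add_pow]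
  have : Finset.Iic r = Finset.range (r+1) := by ext; simp [Nat.lt_succ_iff]
  rw [this]
  refine Finset.sum_le_sum fun k hk => ?_
  rw [one_pow, mul_one]
  have h1 : 1 ≤ r.choose k := Nat.choose_pos (by simpa [Nat.lt_succ_iff] using hk)
  calc a.choose k ≤ a^k := Nat.choose_le_pow a k
    _ ≤ a^k * r.choose k := Nat.le_mul_of_pos_right _ h1

lemma signFam_card {a b : ℕ} (w : Fin a → Fin b → ℝ) (V : Submodule ℝ (Fin b → ℝ))
    (hg : Generic w V) (n : ℕ) (hn : Module.finrank ℝ V ≤ n) : (signFam w V).card ≤ (a+1)^n := by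
  classical
  have hvc : (signFam w V).vcDim ≤ Module.finrank ℝ V := by
    unfold Finset.vcDim
    apply Finset.sup_le
    intro S hS
    exact signFam_shatter w V hg S (Finset.mem_shatterer.mp hS)
  calc (signFam w V).card ≤ (signFam w V).shatterer.card := Finset.card_le_card_shatterer _
    _ ≤ ∑ k ∈ Finset.Iic (signFam w V).vcDim, (Fintype.card (Fin a)).choose k :=
        Finset.card_shatterer_le_sum_vcDim
    _ ≤ (a+1)^(signFam w V).vcDim := by simpa using sum_choose_le a _
    _ ≤ (a+1)^n := Nat.pow_le_pow_right (by omega) (hvc.trans hn)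

end

open MeasureTheory ProbabilityTheory
noncomputable section

/-! ### Linear propagation through the network -/

/-- weights, multipliers, patterns, sequences of layer vectors -/
abbrev WT (D : ℕ → ℕ) := ∀ i : ℕ, Fin (D (i+1)) → Fin (D i) → ℝ
abbrev MT (D : ℕ → ℕ) := ∀ t : ℕ, Fin (D (t+1)) → ℝ
abbrev PT (D : ℕ → ℕ) := ∀ t : ℕ, Fin (D (t+1)) → Bool
abbrev ZT (D : ℕ → ℕ) := ∀ t : ℕ, Fin (D t) → ℝ

/-- `z` follows the linear recursion with multipliers `lam` between layers `k` and `j`. -/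
def IsProp (D : ℕ → ℕ) (w : WT D) (lam : MT D) (k j : ℕ) (z : ZT D) : Prop :=
  ∀ t, k ≤ t → t < j → ∀ a, z (t+1) a = lam t a * ∑ c, w t a c * z t c

def bR {D : ℕ → ℕ} (π : PT D) : MT D := fun t a => if π t a = true then 1 else 0

lemma IsProp.mono {D : ℕ → ℕ} {w : WT D} {lam : MT D} {k j k' j' : ℕ} {z : ZT D}
    (h : IsProp D w lam k j z) (hk : k ≤ k') (hj : j' ≤ j) : IsProp D w lam k' j' z :=
  fun t ht ht' => h t (hk.trans ht) (ht'.trans_le hj)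

lemma IsProp.congr {D : ℕ → ℕ} {w w' : WT D} {lam lam' : MT D} {k j : ℕ} {z : ZT D}
    (h : IsProp D w lam k j z) (hw : ∀ t, k ≤ t → t < j → w t = w' t)
    (hl : ∀ t, k ≤ t → t < j → lam t = lam' t) : IsProp D w' lam' k j z := by
  intro t ht ht' a
  rw [← hw t ht ht', ← hl t ht ht']
  exact h t ht ht' a

/-- a solution of the recursion started at layer `k` -/
def seqFrom (D : ℕ → ℕ) (w : WT D) (lam : MT D) (k : ℕ) (z0 : Fin (D k) → ℝ) : ZT D
  | 0 => if h : k = 0 then h ▸ z0 else 0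
  | (t+1) => if h : k = t+1 then h ▸ z0 else
      fun a => lam t a * ∑ c, w t a c * seqFrom D w lam k z0 t c

lemma seqFrom_self (D : ℕ → ℕ) (w : WT D) (lam : MT D) (k : ℕ) (z0 : Fin (D k) → ℝ) :
    seqFrom D w lam k z0 k = z0 := by
  cases k <;> simp [seqFrom]

lemma seqFrom_isProp (D : ℕ → ℕ) (w : WT D) (lam : MT D) (k j : ℕ) (z0 : Fin (D k) → ℝ) :
    IsProp D w lam k j (seqFrom D w lam k z0) := by
  intro t ht _ a
  have : k ≠ t+1 := by omega
  conv_lhs => unfold seqFrom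
  simp [this]

/-- image at layer `j` of the vectors of layer `k` supported in `T` -/
def propSub (D : ℕ → ℕ) (w : WT D) (lam : MT D) (k : ℕ) (T : Finset (Fin (D k))) (j : ℕ) :
    Submodule ℝ (Fin (D j) → ℝ) where
  carrier := {h | ∃ z : ZT D, IsProp D w lam k j z ∧ (∀ a ∉ T, z k a = 0) ∧ z j = h}
  add_mem' := by
    rintro x y ⟨z, hz, hT, rfl⟩ ⟨z', hz', hT', rfl⟩
    refine ⟨fun t => z t + z' t, ?_, ?_, rfl⟩
    · intro t ht ht' a
      simp only [Pi.add_apply, hz t ht ht' a, hz' t ht ht' a, mul_add, Finset.sum_add_distrib]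
    · intro a ha
      simp [hT a ha, hT' a ha]
  zero_mem' := ⟨fun _ => 0, fun t _ _ a => by simp, fun a _ => rfl, rfl⟩
  smul_mem' := by
    rintro c x ⟨z, hz, hT, rfl⟩
    refine ⟨fun t => c • z t, ?_, ?_, rfl⟩
    · intro t ht ht' a
      simp only [Pi.smul_apply, smul_eq_mul, hz t ht ht' a, Finset.mul_sum]
      refine Finset.sum_congr rfl fun k _ => ?_
      ring
    · intro a ha
      simp [hT a ha]

lemma propSub_congr {D : ℕ → ℕ} {w w' : WT D} {lam lam' : MT D} {k j : ℕ} (T : Finset (Fin (D k)))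
    (hw : ∀ t, k ≤ t → t < j → w t = w' t)
    (hl : ∀ t, k ≤ t → t < j → lam t = lam' t) : propSub D w lam k T j = propSub D w' lam' k T j := by
  ext h
  constructor
  · rintro ⟨z, hz, hT, e⟩
    exact ⟨z, hz.congr hw hl, hT, e⟩
  · rintro ⟨z, hz, hT, e⟩
    exact ⟨z, hz.congr (fun t a b => (hw t a b).symm) (fun t a b => (hl t a b).symm), hT, e⟩

lemma prop_linear (D : ℕ → ℕ) (w : WT D) (lam : MT D) (k j : ℕ) (hkj : k ≤ j) :
    ∃ U : (Fin (D k) → ℝ) →ₗ[ℝ] (Fin (D j) → ℝ), ∀ z, IsProp D w lam k j z → z j = U (z k) := by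
  induction j, hkj using Nat.le_induction with
  | base => exact ⟨LinearMap.id, fun z _ => rfl⟩
  | succ j hkj ih =>
    obtain ⟨U, hU⟩ := ih
    refine ⟨{ toFun := fun h a => lam j a * ∑ c, w j a c * U h c
              map_add' := ?_
              map_smul' := ?_ }, ?_⟩
    · intro x y; ext a
      simp only [map_add, Pi.add_apply, mul_add, Finset.sum_add_distrib]
    · intro r x; ext a
      simp only [map_smul, Pi.smul_apply, smul_eq_mul, RingHom.id_apply, Finset.mul_sum]
      refine Finset.sum_congr rfl fun k _ => ?_
      ring
    · intro z hz
      ext a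
      rw [hz j hkj (Nat.lt_succ_self j) a, hU z (hz.mono le_rfl (Nat.le_succ j))]
      rfl

lemma propSub_finrank (D : ℕ → ℕ) (w : WT D) (lam : MT D) (k j : ℕ) (T : Finset (Fin (D k)))
    (hkj : k ≤ j) : Module.finrank ℝ (propSub D w lam k T j) ≤ T.card := by
  classical
  obtain ⟨U, hU⟩ := prop_linear D w lam k j hkj
  let E : (T → ℝ) →ₗ[ℝ] (Fin (D k) → ℝ) :=
    { toFun := fun f a => if h : a ∈ T then f ⟨a, h⟩ else 0
      map_add' := by
        intro x y; ext a; by_cases h : a ∈ T <;> simp [h]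
      map_smul' := by
        intro x y; ext a; by_cases h : a ∈ T <;> simp [h] }
  have hle : propSub D w lam k T j ≤ LinearMap.range (U ∘ₗ E) := by
    rintro h ⟨z, hz, hT, rfl⟩
    refine ⟨fun a => z k a, ?_⟩
    rw [hU z hz, LinearMap.comp_apply]
    congr 1
    ext a
    by_cases h : a ∈ T
    · simp [E, h]
    · simp [E, h, hT a h]
  calc _ ≤ _ := Submodule.finrank_mono hle
    _ ≤ _ := LinearMap.finrank_range_le _
    _ = T.card := by simp

/-- `π` is the activation pattern of a signal that stays alive between layers `k` and `j`. -/
def IsReal (D : ℕ → ℕ) (w : WT D) (π : PT D) (k j : ℕ) : Prop :=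
  ∃ g : ZT D, IsProp D w (bR π) k j g ∧ ∀ t, k ≤ t → t < j → g t ≠ 0 ∧
    ∀ a, (π t a = true → 0 ≤ ∑ c, w t a c * g t c) ∧ (π t a = false → ∑ c, w t a c * g t c ≤ 0)

lemma IsReal.mono {D : ℕ → ℕ} {w : WT D} {π : PT D} {k j k' j' : ℕ}
    (h : IsReal D w π k j) (hk : k ≤ k') (hj : j' ≤ j) : IsReal D w π k' j' := by
  obtain ⟨g, h1, h2⟩ := h
  exact ⟨g, h1.mono hk hj, fun t ht ht' => h2 t (hk.trans ht) (ht'.trans_le hj)⟩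

lemma IsReal.congr {D : ℕ → ℕ} {w w' : WT D} {π π' : PT D} {k j : ℕ}
    (h : IsReal D w π k j) (hw : ∀ t, k ≤ t → t < j → w t = w' t)
    (hp : ∀ t, k ≤ t → t < j → π t = π' t) : IsReal D w' π' k j := by
  obtain ⟨g, h1, h2⟩ := h
  refine ⟨g, h1.congr hw (fun t ht ht' => by unfold bR; rw [hp t ht ht']), fun t ht ht' => ?_⟩
  have := h2 t ht ht'
  rw [hw t ht ht', hp t ht ht'] at this
  exact this

/-- genericity of the layer matrix with respect to realizable subspaces -/
def GenGood (D : ℕ → ℕ) (w : WT D) (j : ℕ) {a : ℕ} (Mat : Fin a → Fin (D j) → ℝ) : Prop :=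
  ∀ k, k ≤ j → ∀ π : PT D, IsReal D w π k j → Generic Mat (propSub D w (bR π) k Finset.univ j)

lemma cover (D : ℕ → ℕ) (w : WT D) (M k j : ℕ) (hkj : k ≤ j) (hM : ∀ t, t < j → D (t+1) ≤ M)
    (hG : ∀ t, t < j → GenGood D w t (w t)) :
    ∃ P : Finset (PT D), P.card ≤ (M+1)^(D k * (j - k)) ∧
      ∀ π, IsReal D w π k j → ∃ π' ∈ P, ∀ t, k ≤ t → t < j → π t = π' t := by
  classical
  induction j, hkj using Nat.le_induction with
  | base =>
    refine ⟨{fun _ _ => true}, by simp, ?_⟩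
    intro π _
    exact ⟨_, Finset.mem_singleton_self _, fun t h h' => by omega⟩
  | succ j hkj ih =>
    obtain ⟨P, hP, hPc⟩ := ih (fun t ht => hM t (by omega)) (fun t ht => hG t (by omega))
    let V : PT D → Submodule ℝ (Fin (D j) → ℝ) := fun π => propSub D w (bR π) k Finset.univ j
    let upd : PT D → Finset (Fin (D (j+1))) → PT D := fun π A => Function.update π j (fun a => decide (a ∈ A))
    let P' := (P.filter fun π => Generic (w j) (V π)).biUnion fun π =>
      (signFam (w j) (V π)).image (upd π)
    refine ⟨P', ?_, ?_⟩
    · have h1 : P'.card ≤ (P.filter fun π => Generic (w j) (V π)).card * (M+1)^(D k) := by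
        apply Finset.card_biUnion_le_card_mul
        intro π hπ
        refine Finset.card_image_le.trans ?_
        refine (signFam_card (w j) (V π) (Finset.mem_filter.mp hπ).2 (D k) ?_).trans ?_
        · simpa using propSub_finrank D w (bR π) k j Finset.univ hkj
        · exact Nat.pow_le_pow_left (by have := hM j (Nat.lt_succ_self j); omega) _
      calc P'.card ≤ _ := h1
        _ ≤ (M+1)^(D k * (j - k)) * (M+1)^(D k) := by
            gcongr
            exact (Finset.card_filter_le _ _).trans hP
        _ = _ := by
          rw [← pow_add]; congr 1
          rw [Nat.succ_sub hkj, Nat.succ_eq_add_one]; ring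
    · intro π hπ
      have hπj := hπ.mono (k' := k) (j' := j) le_rfl (Nat.le_succ j)
      obtain ⟨π', hmem, hag⟩ := hPc π hπj
      have hV : V π = V π' := propSub_congr _ (fun _ _ _ => rfl)
        (fun t h h' => by unfold bR; rw [hag t h h'])
      have hgen : Generic (w j) (V π') := by
        rw [← hV]; exact hG j (Nat.lt_succ_self j) k hkj π hπj
      obtain ⟨g, hg1, hg2⟩ := hπ
      obtain ⟨hgne, hgs⟩ := hg2 j hkj (Nat.lt_succ_self j)
      let A : Finset (Fin (D (j+1))) := Finset.univ.filter fun a => π j a = true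
      refine ⟨upd π' A, ?_, ?_⟩
      · refine Finset.mem_biUnion.mpr ⟨π', Finset.mem_filter.mpr ⟨hmem, hgen⟩, ?_⟩
        refine Finset.mem_image_of_mem _ ?_
        unfold signFam
        refine Finset.mem_filter.mpr ⟨Finset.mem_univ _, g j, ?_, hgne, ?_, ?_⟩
        · rw [← hV]
          exact ⟨g, hg1.mono le_rfl (Nat.le_succ j), fun a ha => absurd (Finset.mem_univ a) ha, rfl⟩
        · intro a ha
          exact (hgs a).1 (Finset.mem_filter.mp ha).2
        · intro a ha
          refine (hgs a).2 ?_
          simpa [A] using ha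
      · intro t ht ht'
        rcases Nat.lt_succ_iff_lt_or_eq.mp ht' with h | h
        · simp only [upd, Function.update_of_ne h.ne]
          exact hag t ht h
        · subst h
          ext a
          simp [upd, A]

/-- mixed multipliers: `π` before layer `i`, difference at `i`, `ρ` afterwards -/
def mix {D : ℕ → ℕ} (ρ π : PT D) (i : ℕ) : MT D := fun t a =>
  if t < i then bR π t a else if t = i then bR ρ t a - bR π t a else bR ρ t a

/-- activation pattern of `x` -/
def patX (D : ℕ → ℕ) (w : WT D) (x : Fin (D 0) → ℝ) : PT D := fun t a => decide (0 < preact D w t x a)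

/-- The operator events for a matrix acting on layer `j`. -/
def FamGood (D : ℕ → ℕ) (w : WT D) (x : Fin (D 0) → ℝ) (A2 : ℝ) (N : ℕ → ℕ) (j : ℕ) {a : ℕ}
    (Mat : Fin a → Fin (D j) → ℝ) : Prop :=
  (∀ k, k ≤ j → ∀ π : PT D, IsReal D w π k j →
    OpGood Mat A2 (D k) (propSub D w (bR π) k Finset.univ j ⊔ Submodule.span ℝ {forward D w j x})) ∧
  (∀ k, k ≤ j → ∀ T : Finset (Fin (D k)), T.card = N k → 1 ≤ N k →
    OpGood Mat A2 (N k) (propSub D w (bR (patX D w x)) k T j)) ∧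
  (∀ k i, k ≤ i → i < j → ∀ π : PT D, IsReal D w π k (i+1) →
    OpGood Mat A2 (D k) (propSub D w (mix (patX D w x) π i) k Finset.univ j))

lemma gen_prob (D : ℕ → ℕ) (w : WT D) (a j : ℕ)
    (hG : ∀ t, t < j → GenGood D w t (w t)) (v : NNReal) (hv : v ≠ 0) :
    1 ≤ gaussMat a (D j) v {Mat | GenGood D w j Mat} := by
  classical
  have hM : ∃ M, ∀ t, t < j → D (t+1) ≤ M := by
    refine ⟨∑ t ∈ Finset.range j, D (t+1), fun t ht => ?_⟩
    exact Finset.single_le_sum (f := fun t => D (t+1)) (fun _ _ => Nat.zero_le _) (Finset.mem_range.mpr ht)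
  obtain ⟨M, hM⟩ := hM
  have hcov : ∀ k, ∃ P : Finset (PT D), k ≤ j → ∀ π, IsReal D w π k j → ∃ π' ∈ P, ∀ t, k ≤ t → t < j → π t = π' t := by
    intro k
    by_cases hk : k ≤ j
    · obtain ⟨P, _, hP⟩ := cover D w M k j hk hM hG
      exact ⟨P, fun _ => hP⟩
    · exact ⟨∅, fun h => absurd h hk⟩
  choose P hP using hcov
  let 𝓥 := (Finset.range (j+1)).biUnion fun k => (P k).image fun π => propSub D w (bR π) k Finset.univ j
  refine (generic_outer a (D j) v hv 𝓥).trans (measure_mono ?_)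
  intro Mat hMat k hk π hπ
  obtain ⟨π', hmem, hag⟩ := hP k hk π hπ
  rw [propSub_congr (lam' := bR π') _ (fun _ _ _ => rfl) (fun t h h' => by unfold bR; rw [hag t h h'])]
  apply hMat
  refine Finset.mem_biUnion.mpr ⟨k, Finset.mem_range.mpr (by omega), ?_⟩
  exact Finset.mem_image_of_mem (fun π => propSub D w (bR π) k Finset.univ j) hmem

end

open MeasureTheory ProbabilityTheory
noncomputable section

lemma fam_union (a b n : ℕ) (hb : 1 ≤ b) (hn : 1 ≤ n) (Y : ℝ) (hY : 1 ≤ Y)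
    (ha : (a:ℝ) ≤ Real.exp Y) (hbY : (5 * b : ℝ) ≤ Real.exp Y)
    (Hs : Finset (Submodule ℝ (Fin b → ℝ))) (hH : ∀ H ∈ Hs, Module.finrank ℝ H ≤ n + 1) :
    gaussMat a b (1 / (b : NNReal)) {w | ¬ ∀ H ∈ Hs, OpGood w (1000 * Y) n H} ≤
      ENNReal.ofReal (Hs.card * Real.exp (-15 * n * Y)) := by
  have : {w : Fin a → Fin b → ℝ | ¬ ∀ H ∈ Hs, OpGood w (1000 * Y) n H} =
      ⋃ H ∈ Hs, {w | ¬ OpGood w (1000 * Y) n H} := by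
    ext w; simp
  rw [this]
  refine (measure_biUnion_finset_le _ _).trans ?_
  calc _ ≤ ∑ H ∈ Hs, ENNReal.ofReal (Real.exp (-15 * n * Y)) :=
        Finset.sum_le_sum fun H hmem => op_single a b n hb hn H (hH H hmem) Y hY ha hbY
    _ = _ := by
      rw [Finset.sum_const, ENNReal.ofReal_mul (by positivity), nsmul_eq_mul, ENNReal.ofReal_natCast]

lemma fam_prob (D : ℕ → ℕ) (w : WT D) (x : Fin (D 0) → ℝ) (N : ℕ → ℕ) (ℓ j M a : ℕ) (X β : ℝ)
    (hℓ : 1 ≤ ℓ) (hj : j ≤ ℓ) (hM : 2 ≤ M) (hD1 : ∀ t, t ≤ ℓ → 1 ≤ D t) (hDM : ∀ t, t ≤ ℓ → D t ≤ M)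
    (ha : a ≤ M) (hX : X = ℓ * Real.log M) (hX2 : 2 ≤ X)
    (hG : ∀ t, t < j → GenGood D w t (w t))
    (hβ1 : 1 ≤ β) (hβ : ∀ k, k ≤ ℓ → β ≤ D k) (hβN : ∀ k, k ≤ ℓ → 1 ≤ N k → β ≤ N k) :
    gaussMat a (D j) (1 / (D j : NNReal)) {Mat | ¬ FamGood D w x (2000 * X) N j Mat} ≤
      ENNReal.ofReal (Real.exp (-20 * β * X)) := by
  classical
  have hℓ' : (1:ℝ) ≤ ℓ := by exact_mod_cast hℓ
  have hM' : (2:ℝ) ≤ M := by exact_mod_cast hM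
  have hlog : 1/2 ≤ Real.log M := by
    have := Real.log_two_gt_d9
    have := Real.log_le_log (by norm_num) hM'
    linarith
  have hXℓ : (ℓ:ℝ)/2 ≤ X := by rw [hX]; nlinarith
  have hML : (M:ℝ) ≤ Real.exp X := by
    rw [← Real.exp_log (by linarith : (0:ℝ) < M)]
    apply Real.exp_le_exp.mpr; rw [hX]; nlinarith
  have hMpow : ((M:ℝ)+1)^ℓ ≤ Real.exp (2 * X) := by
    have h1 : (M:ℝ) + 1 ≤ M^2 := by nlinarith
    calc ((M:ℝ)+1)^ℓ ≤ (M^2)^ℓ := by gcongr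
      _ = Real.exp (2 * X) := by
        rw [hX, ← pow_mul, ← Real.exp_log (by linarith : (0:ℝ) < M), ← Real.exp_nat_mul, Real.log_exp]
        congr 1; push_cast; ring
  have hA2 : 2000 * X = 1000 * (2 * X) := by ring
  have hY : (1:ℝ) ≤ 2 * X := by linarith
  have hE : Real.exp (2 * X) = Real.exp X * Real.exp X := by rw [← Real.exp_add]; congr 1; ring
  have hE5 : (5:ℝ) ≤ Real.exp X := by
    have h1 : (2.7182818283:ℝ) < Real.exp 1 := Real.exp_one_gt_d9
    have h2 : Real.exp 2 = Real.exp 1 * Real.exp 1 := by rw [← Real.exp_add]; norm_num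
    have h3 := Real.exp_le_exp.mpr hX2
    nlinarith
  have haY : (a:ℝ) ≤ Real.exp (2 * X) := by
    have : (a:ℝ) ≤ M := by exact_mod_cast ha
    rw [hE]; nlinarith
  have hbY : (5 * (D j) : ℝ) ≤ Real.exp (2 * X) := by
    have : (D j:ℝ) ≤ M := by exact_mod_cast hDM j hj
    rw [hE]; nlinarith
  set μ := gaussMat a (D j) (1 / (D j : NNReal)) with hμ
  -- covers
  have hMt : ∀ j', j' ≤ j → ∀ t, t < j' → D (t+1) ≤ M := fun j' hj' t ht => hDM _ (by omega)
  have hcardP : ∀ k j', k ≤ ℓ → j' ≤ ℓ → ∀ P : Finset (PT D), P.card ≤ (M+1)^(D k * (j' - k)) →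
      (P.card : ℝ) ≤ Real.exp (2 * (D k) * X) := by
    intro k j' hk hj' P hP
    have h1 : (P.card : ℝ) ≤ ((M:ℝ)+1)^(D k * (j' - k)) := by exact_mod_cast hP
    refine h1.trans ?_
    calc ((M:ℝ)+1)^(D k * (j' - k)) ≤ ((M:ℝ)+1)^(ℓ * D k) := by
          apply pow_le_pow_right₀ (by linarith)
          rw [mul_comm]; apply Nat.mul_le_mul_right; omega
      _ = (((M:ℝ)+1)^ℓ)^(D k) := by rw [pow_mul]
      _ ≤ (Real.exp (2 * X))^(D k) := by gcongr
      _ = _ := by rw [← Real.exp_nat_mul]; congr 1; ring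
  have hfin : ∀ (n : ℕ) (c : ℝ), β ≤ n → c ≤ Real.exp (2 * n * X) →
      c * Real.exp (-15 * n * (2 * X)) ≤ Real.exp (-28 * β * X) := by
    intro n c hn hc
    calc _ ≤ Real.exp (2 * n * X) * Real.exp (-15 * n * (2 * X)) := by gcongr
      _ = Real.exp (-28 * (n * X)) := by rw [← Real.exp_add]; congr 1; ring
      _ ≤ _ := by
        apply Real.exp_le_exp.mpr
        have : β * X ≤ n * X := by gcongr
        linarith
  set p := ENNReal.ofReal (Real.exp (-28 * β * X)) with hp
  have hB1 : ∀ k, k ≤ j → μ {Mat | ¬ ∀ π : PT D, IsReal D w π k j →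
      OpGood Mat (2000 * X) (D k) (propSub D w (bR π) k Finset.univ j ⊔
        Submodule.span ℝ {forward D w j x})} ≤ p := by
    intro k hk
    obtain ⟨P, hPc, hP⟩ := cover D w M k j hk (hMt j le_rfl) hG
    let F : PT D → Submodule ℝ (Fin (D j) → ℝ) := fun π => propSub D w (bR π) k Finset.univ j ⊔
        Submodule.span ℝ {forward D w j x}
    have hu := fam_union a (D j) (D k) (hD1 j hj) (hD1 k (by omega)) (2 * X) hY haY hbY (P.image F) (by
      intro H hH
      obtain ⟨π, _, rfl⟩ := Finset.mem_image.mp hH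
      refine (Submodule.finrank_add_le_finrank_add_finrank _ _).trans ?_
      apply Nat.add_le_add
      · simpa using propSub_finrank D w (bR π) k j Finset.univ hk
      · exact (finrank_span_le_card _).trans (by simp))
    refine le_trans (le_trans (measure_mono ?_) hu) ?_
    · intro Mat hMat hall
      apply hMat
      intro π hπ
      obtain ⟨π', hmem, hag⟩ := hP π hπ
      rw [propSub_congr (lam' := bR π') _ (fun _ _ _ => rfl)
        (fun t h h' => by unfold bR; rw [hag t h h']), hA2]
      exact hall _ (Finset.mem_image_of_mem F hmem)
    · apply ENNReal.ofReal_le_ofReal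
      apply hfin _ _ (hβ k (by omega))
      refine le_trans ?_ (hcardP k j (by omega) hj P hPc)
      exact_mod_cast Finset.card_image_le
  have hB3 : ∀ k, k ≤ j → μ {Mat | ¬ ∀ T : Finset (Fin (D k)), T.card = N k → 1 ≤ N k →
      OpGood Mat (2000 * X) (N k) (propSub D w (bR (patX D w x)) k T j)} ≤ p := by
    intro k hk
    by_cases hN : 1 ≤ N k
    · let F : Finset (Fin (D k)) → Submodule ℝ (Fin (D j) → ℝ) := fun T =>
        propSub D w (bR (patX D w x)) k T j
      have hu := fam_union a (D j) (N k) (hD1 j hj) hN (2 * X) hY haY hbY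
        ((Finset.univ.powersetCard (N k)).image F) (by
        intro H hH
        obtain ⟨T, hT, rfl⟩ := Finset.mem_image.mp hH
        have := propSub_finrank D w (bR (patX D w x)) k j T hk
        rw [(Finset.mem_powersetCard.mp hT).2] at this
        exact this.trans (by omega))
      refine le_trans (le_trans (measure_mono ?_) hu) ?_
      · intro Mat hMat hall
        apply hMat
        intro T hT _
        rw [hA2]
        exact hall _ (Finset.mem_image_of_mem F (Finset.mem_powersetCard.mpr ⟨Finset.subset_univ _, hT⟩))
      · apply ENNReal.ofReal_le_ofReal
        apply hfin _ _ (hβN k (by omega) hN)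
        have h1 : (((Finset.univ.powersetCard (N k)).image F).card : ℝ) ≤ (M:ℝ)^(N k) := by
          have h2 : ((Finset.univ.powersetCard (N k)).image F).card ≤ M^(N k) := by
            refine Finset.card_image_le.trans ?_
            rw [Finset.card_powersetCard, Finset.card_univ, Fintype.card_fin]
            exact (Nat.choose_le_pow _ _).trans (Nat.pow_le_pow_left (hDM k (by omega)) _)
          exact_mod_cast h2
        refine h1.trans ?_
        calc (M:ℝ)^(N k) ≤ (Real.exp X)^(N k) := by gcongr
          _ = Real.exp (N k * X) := by rw [← Real.exp_nat_mul]
          _ ≤ _ := by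
            apply Real.exp_le_exp.mpr
            have : (0:ℝ) ≤ N k * X := by positivity
            linarith
    · have : {Mat : Fin a → Fin (D j) → ℝ | ¬ ∀ T : Finset (Fin (D k)), T.card = N k → 1 ≤ N k →
        OpGood Mat (2000 * X) (N k) (propSub D w (bR (patX D w x)) k T j)} = ∅ := by
        ext Mat
        simp only [Set.mem_ofPred_eq, Set.mem_empty_iff_false, iff_false, not_not]
        intro T _ h
        exact absurd h hN
      rw [this]; simp
  have hB4 : ∀ k i, k ≤ i → i < j → μ {Mat | ¬ ∀ π : PT D, IsReal D w π k (i+1) →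
      OpGood Mat (2000 * X) (D k) (propSub D w (mix (patX D w x) π i) k Finset.univ j)} ≤ p := by
    intro k i hk hi
    obtain ⟨P, hPc, hP⟩ := cover D w M k (i+1) (by omega) (hMt (i+1) (by omega)) (fun t ht => hG t (by omega))
    let F : PT D → Submodule ℝ (Fin (D j) → ℝ) := fun π =>
      propSub D w (mix (patX D w x) π i) k Finset.univ j
    have hu := fam_union a (D j) (D k) (hD1 j hj) (hD1 k (by omega)) (2 * X) hY haY hbY (P.image F) (by
      intro H hH
      obtain ⟨π, _, rfl⟩ := Finset.mem_image.mp hH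
      have := propSub_finrank D w (mix (patX D w x) π i) k j Finset.univ (by omega)
      rw [Finset.card_univ, Fintype.card_fin] at this
      exact this.trans (by omega))
    refine le_trans (le_trans (measure_mono ?_) hu) ?_
    · intro Mat hMat hall
      apply hMat
      intro π hπ
      obtain ⟨π', hmem, hag⟩ := hP π hπ
      rw [propSub_congr (lam' := mix (patX D w x) π' i) _ (fun _ _ _ => rfl)
        (fun t h h' => by
          ext b
          unfold mix bR
          by_cases h1 : t < i
          · simp only [h1, if_true, hag t h (by omega)]
          · by_cases h2 : t = i
            · simp only [h1, h2, if_true, if_false]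
              subst h2
              rw [hag t h (by omega)]
            · simp only [h1, h2, if_false]), hA2]
      exact hall _ (Finset.mem_image_of_mem F hmem)
    · apply ENNReal.ofReal_le_ofReal
      apply hfin _ _ (hβ k (by omega))
      refine le_trans ?_ (hcardP k (i+1) (by omega) (by omega) P hPc)
      exact_mod_cast Finset.card_image_le
  -- union
  have hsub : {Mat : Fin a → Fin (D j) → ℝ | ¬ FamGood D w x (2000 * X) N j Mat} ⊆
      ((⋃ k ∈ Finset.range (j+1), {Mat | ¬ ∀ π : PT D, IsReal D w π k j →
        OpGood Mat (2000 * X) (D k) (propSub D w (bR π) k Finset.univ j ⊔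
        Submodule.span ℝ {forward D w j x})}) ∪
      (⋃ k ∈ Finset.range (j+1), {Mat | ¬ ∀ T : Finset (Fin (D k)), T.card = N k → 1 ≤ N k →
        OpGood Mat (2000 * X) (N k) (propSub D w (bR (patX D w x)) k T j)})) ∪
      (⋃ i ∈ Finset.range j, ⋃ k ∈ Finset.range (i+1), {Mat | ¬ ∀ π : PT D, IsReal D w π k (i+1) →
        OpGood Mat (2000 * X) (D k) (propSub D w (mix (patX D w x) π i) k Finset.univ j)}) := by
    intro Mat hMat
    by_contra hcon
    apply hMat
    simp only [Set.mem_union, Set.mem_iUnion, Set.mem_ofPred_eq, not_or, not_exists, not_not,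
      Finset.mem_range] at hcon
    obtain ⟨⟨h1, h2⟩, h3⟩ := hcon
    exact ⟨fun k hk => h1 k (by omega), fun k hk => h2 k (by omega),
      fun k i hk hi => h3 i hi k (by omega)⟩
  have hcnt : μ {Mat : Fin a → Fin (D j) → ℝ | ¬ FamGood D w x (2000 * X) N j Mat} ≤
      ((j+1 : ℕ) * p + (j+1 : ℕ) * p) + (j * (ℓ * p)) := by
    refine (measure_mono hsub).trans ((measure_union_le _ _).trans (add_le_add
      ((measure_union_le _ _).trans (add_le_add ?_ ?_)) ?_))
    · refine (measure_biUnion_finset_le _ _).trans ?_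
      refine (Finset.sum_le_card_nsmul _ _ p fun k hk => hB1 k ?_).trans ?_
      · have := Finset.mem_range.mp hk; omega
      · simp
    · refine (measure_biUnion_finset_le _ _).trans ?_
      refine (Finset.sum_le_card_nsmul _ _ p fun k hk => hB3 k ?_).trans ?_
      · have := Finset.mem_range.mp hk; omega
      · simp
    · refine (measure_biUnion_finset_le _ _).trans ?_
      refine (Finset.sum_le_card_nsmul _ _ (ℓ * p) fun i hi => ?_).trans ?_
      · have hi' := Finset.mem_range.mp hi
        refine (measure_biUnion_finset_le _ _).trans ?_
        refine (Finset.sum_le_card_nsmul _ _ p fun k hk => hB4 k i ?_ hi').trans ?_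
        · have := Finset.mem_range.mp hk; omega
        · rw [Finset.card_range, nsmul_eq_mul]
          gcongr
          omega
      · simp
  refine hcnt.trans ?_
  have hpe : ((j+1 : ℕ) * p + (j+1 : ℕ) * p) + (j * (ℓ * p)) =
      ENNReal.ofReal (((j+1) + (j+1) + j * ℓ) * Real.exp (-28 * β * X)) := by
    rw [ENNReal.ofReal_mul (by positivity), ← hp]
    have : ((j:ℝ)+1 + (j+1) + j * ℓ) = (((j+1) + (j+1) + j * ℓ : ℕ) : ℝ) := by push_cast; ring
    rw [this, ENNReal.ofReal_natCast]
    push_cast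
    ring
  rw [hpe]
  apply ENNReal.ofReal_le_ofReal
  have hjl : (j:ℝ) ≤ ℓ := by exact_mod_cast hj
  have he2 : 2 * (ℓ:ℝ) + 1 ≤ Real.exp (2 * ℓ) := Real.add_one_le_exp _
  have h8 : ((j:ℝ)+1 + (j+1) + j * ℓ) ≤ Real.exp (8 * β * X) := by
    calc ((j:ℝ)+1 + (j+1) + j * ℓ) ≤ (2 * ℓ + 1) * (2 * ℓ + 1) := by nlinarith
      _ ≤ Real.exp (2 * ℓ) * Real.exp (2 * ℓ) := by gcongr
      _ = Real.exp (4 * ℓ) := by rw [← Real.exp_add]; congr 1; ring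
      _ ≤ _ := by
        apply Real.exp_le_exp.mpr
        have : X ≤ β * X := by nlinarith
        linarith
  calc _ ≤ Real.exp (8 * β * X) * Real.exp (-28 * β * X) := by gcongr
    _ = _ := by rw [← Real.exp_add]; congr 1; ring

end

open MeasureTheory ProbabilityTheory
noncomputable section

/-! ### Deterministic part -/

/-- the matrix `Mat` acts on the vector `h` with level `n` bound -/
def Bd {a b : ℕ} (Mat : Fin a → Fin b → ℝ) (A2 : ℝ) (n : ℕ) (h : Fin b → ℝ) : Prop :=
  ∀ S : Finset (Fin a), ∑ i ∈ S, (∑ k, Mat i k * h k)^2 ≤ A2 * nsq h * (max S.card n : ℕ) / b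

/-- running minimum of the widths, started at layer `i` with value `n` -/
def rho (D : ℕ → ℕ) (n i : ℕ) : ℕ → ℕ
  | 0 => n
  | (t+1) => if t + 1 ≤ i then n else min (rho D n i t) (D (t+1))

lemma rho_start (D : ℕ → ℕ) (n i : ℕ) : rho D n i i = n := by
  cases i <;> simp [rho]

lemma rho_succ (D : ℕ → ℕ) (n i t : ℕ) (h : i ≤ t) : rho D n i (t+1) = min (rho D n i t) (D (t+1)) := by
  have : ¬ (t + 1 ≤ i) := by omega
  rw [rho]; simp [this]

lemma rho_cases (D : ℕ → ℕ) (n i t : ℕ) (h : i ≤ t) :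
    rho D n i t = n ∨ ∃ k, i ≤ k ∧ k ≤ t ∧ rho D n i t = D k := by
  induction t, h using Nat.le_induction with
  | base => exact Or.inl (rho_start D n i)
  | succ t h ih =>
    rw [rho_succ D n i t h]
    rcases le_total (rho D n i t) (D (t+1)) with h1 | h1
    · rw [min_eq_left h1]
      rcases ih with h2 | ⟨k, h3, h4, h5⟩
      · exact Or.inl h2
      · exact Or.inr ⟨k, h3, by omega, h5⟩
    · rw [min_eq_right h1]
      exact Or.inr ⟨t+1, by omega, le_rfl, rfl⟩

lemma rho_argmin (D : ℕ → ℕ) (t : ℕ) : ∃ k, k ≤ t ∧ rho D (D 0) 0 t = D k := by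
  rcases rho_cases D (D 0) 0 t (Nat.zero_le _) with h | ⟨k, _, h, h'⟩
  · exact ⟨0, Nat.zero_le _, h⟩
  · exact ⟨k, h, h'⟩

lemma rho_pos (D : ℕ → ℕ) (n i t : ℕ) (h : i ≤ t) (hn : 1 ≤ n) (hD : ∀ k, k ≤ t → 1 ≤ D k) :
    1 ≤ rho D n i t := by
  rcases rho_cases D n i t h with h | ⟨k, _, h, h'⟩
  · omega
  · rw [h']; exact hD k h

lemma grow_step (d d' r : ℕ) (P h A2 : ℝ) (hd : 1 ≤ d)
    (hb : P ≤ A2 * h * (max d' r : ℕ) / d) :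
    P * (min r d' : ℕ) * d ≤ A2 * (h * r) * d' := by
  have hd0 : (0:ℝ) < d := by exact_mod_cast hd
  rw [le_div_iff₀ hd0] at hb
  have h2 : ((max d' r : ℕ) : ℝ) * ((min r d' : ℕ) : ℝ) = r * d' := by
    have : max d' r * min r d' = r * d' := by
      rcases le_total r d' with h | h
      · rw [max_eq_left h, min_eq_left h, mul_comm]
      · rw [max_eq_right h, min_eq_right h]
    exact_mod_cast this
  calc P * (min r d' : ℕ) * d = (P * d) * (min r d' : ℕ) := by ring
    _ ≤ (A2 * h * (max d' r : ℕ)) * (min r d' : ℕ) := by gcongr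
    _ = A2 * h * (((max d' r : ℕ) : ℝ) * ((min r d' : ℕ) : ℝ)) := by ring
    _ = _ := by rw [h2]; ring

lemma grow (D : ℕ → ℕ) (w : WT D) (A2 : ℝ) (hA : 0 ≤ A2) (h : ZT D) (n i j : ℕ)
    (hD : ∀ t, t ≤ j → 1 ≤ D t)
    (hle : ∀ t, i ≤ t → t < j → ∀ a, (h (t+1) a)^2 ≤ (∑ c, w t a c * h t c)^2)
    (hB : ∀ t, i ≤ t → t < j → Bd (w t) A2 (rho D n i t) (h t)) :
    ∀ t, i ≤ t → t ≤ j → nsq (h t) * rho D n i t * D i ≤ A2^(t-i) * (nsq (h i) * n) * D t := by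
  intro t hit
  induction t, hit using Nat.le_induction with
  | base => intro _; rw [rho_start]; simp
  | succ t hit ih =>
    intro htj
    have ih := ih (by omega)
    have hb := hB t hit (by omega) Finset.univ
    have h1 : nsq (h (t+1)) ≤ ∑ a, (∑ c, w t a c * h t c)^2 :=
      Finset.sum_le_sum fun a _ => hle t hit (by omega) a
    have h1 := h1.trans hb
    rw [Finset.card_univ, Fintype.card_fin] at h1
    have h2 := grow_step _ _ _ _ _ _ (hD t (by omega)) h1
    rw [rho_succ D n i t hit]
    have hdt : (0:ℝ) < D t := by exact_mod_cast hD t (by omega)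
    have e : t + 1 - i = (t - i) + 1 := by omega
    rw [e, pow_succ]
    refine le_of_mul_le_mul_right ?_ hdt
    calc nsq (h (t+1)) * ((min (rho D n i t) (D (t+1)) : ℕ):ℝ) * D i * D t
        = (nsq (h (t+1)) * ((min (rho D n i t) (D (t+1)) : ℕ):ℝ) * D t) * D i := by ring
      _ ≤ (A2 * (nsq (h t) * rho D n i t) * D (t+1)) * D i := by gcongr
      _ = A2 * (nsq (h t) * rho D n i t * D i) * D (t+1) := by ring
      _ ≤ A2 * (A2^(t-i) * (nsq (h i) * n) * D t) * D (t+1) := by gcongr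
      _ = _ := by ring

/-- Final functional applied after a propagation. -/
lemma grow_final (D : ℕ → ℕ) (w : WT D) (A2 : ℝ) (hA : 0 ≤ A2) (h : ZT D) (n i j : ℕ) (hij : i ≤ j)
    (hn : 1 ≤ n) (hD : ∀ t, t ≤ j → 1 ≤ D t) (v : Fin (D j) → ℝ)
    (hle : ∀ t, i ≤ t → t < j → ∀ a, (h (t+1) a)^2 ≤ (∑ c, w t a c * h t c)^2)
    (hB : ∀ t, i ≤ t → t < j → Bd (w t) A2 (rho D n i t) (h t))
    (hv : Bd (fun _ : Fin 1 => v) A2 (rho D n i j) (h j)) :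
    (∑ c, v c * h j c)^2 * D i ≤ A2^(j - i + 1) * (nsq (h i) * n) := by
  have h1 := grow D w A2 hA h n i j hD hle hB j hij le_rfl
  have h2 := hv Finset.univ
  simp only [Finset.univ_unique, Finset.sum_singleton, Finset.card_singleton] at h2
  have hr := rho_pos D n i j hij hn hD
  rw [max_eq_right hr] at h2
  have hdj : (0:ℝ) < D j := by exact_mod_cast hD j le_rfl
  rw [le_div_iff₀ hdj] at h2
  refine le_of_mul_le_mul_right ?_ hdj
  calc (∑ c, v c * h j c)^2 * D i * D j = ((∑ c, v c * h j c)^2 * D j) * D i := by ring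
    _ ≤ (A2 * nsq (h j) * rho D n i j) * D i := by gcongr
    _ = A2 * (nsq (h j) * rho D n i j * D i) := by ring
    _ ≤ A2 * (A2^(j-i) * (nsq (h i) * n) * D j) := by gcongr
    _ = _ := by rw [pow_succ]; ring

/-- the pattern of `y` with tie-breaking bits -/
def patB (D : ℕ → ℕ) (w : WT D) (b : PT D) (y : Fin (D 0) → ℝ) : PT D := fun t a =>
  decide (0 < preact D w t y a ∨ (preact D w t y a = 0 ∧ b t a = true))

lemma bR_patB (D : ℕ → ℕ) (w : WT D) (b : PT D) (y : Fin (D 0) → ℝ) (t : ℕ) (a : Fin (D (t+1))) :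
    bR (patB D w b y) t a = act01 (preact D w t y a) (b t a) := by
  unfold bR patB act01
  by_cases h : 0 < preact D w t y a
  · simp [h]
  · by_cases h' : preact D w t y a = 0 <;> by_cases h'' : b t a = true <;> simp [h, h', h'']

lemma patB_eq_patX (D : ℕ → ℕ) (w : WT D) (b : PT D) (x : Fin (D 0) → ℝ) (t : ℕ)
    (h : ∀ a, preact D w t x a ≠ 0) : patB D w b x t = patX D w x t := by
  ext a; unfold patB patX; simp [h a]

lemma patB_sign (D : ℕ → ℕ) (w : WT D) (b : PT D) (y : Fin (D 0) → ℝ) (t : ℕ) (a : Fin (D (t+1))) :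
    (patB D w b y t a = true → 0 ≤ preact D w t y a) ∧ (patB D w b y t a = false → preact D w t y a ≤ 0) := by
  unfold patB
  simp only [decide_eq_true_eq, decide_eq_false_iff_not]
  refine ⟨fun h => h.elim le_of_lt (fun h => h.1.ge), fun h => ?_⟩
  push Not at h
  exact h.1

lemma forward_isProp (D : ℕ → ℕ) (w : WT D) (b : PT D) (y : Fin (D 0) → ℝ) (j : ℕ) :
    IsProp D w (bR (patB D w b y)) 0 j (fun t => forward D w t y) := by
  intro t _ _ a
  have h := patB_sign D w b y t a
  change max (preact D w t y a) 0 = _ * preact D w t y a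
  unfold bR
  cases hp : patB D w b y t a
  · simp [h.2 hp]
  · simp [h.1 hp]

lemma isReal_patB (D : ℕ → ℕ) (w : WT D) (b : PT D) (y : Fin (D 0) → ℝ) (j : ℕ)
    (halive : ∀ t, t < j → forward D w t y ≠ 0) : IsReal D w (patB D w b y) 0 j :=
  ⟨fun t => forward D w t y, forward_isProp D w b y j, fun t _ ht => ⟨halive t ht, patB_sign D w b y t⟩⟩

lemma seq_mem_propSub {D : ℕ → ℕ} {w : WT D} {lam : MT D} {k j : ℕ} {z : ZT D}
    (h : IsProp D w lam k j z) : z j ∈ propSub D w lam k Finset.univ j :=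
  ⟨z, h, fun a ha => absurd (Finset.mem_univ a) ha, rfl⟩

/-- Hypotheses on the weights, sufficient for gradient stability. -/
structure DetGood (ℓ : ℕ) (D : ℕ → ℕ) (w : WT D) (v : Fin (D ℓ) → ℝ) (x : Fin (D 0) → ℝ)
    (A2 s ε ε' τ : ℝ) (N : ℕ → ℕ) : Prop where
  fam : ∀ t, t < ℓ → FamGood D w x A2 N t (w t)
  famv : FamGood D w x A2 N ℓ (fun _ : Fin 1 => v)
  sig : ∀ t, t ≤ ℓ → s * D t ≤ nsq (forward D w t x)
  noties : ∀ t, t < ℓ → ∀ a, preact D w t x a ≠ 0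
  cnt : ∀ t, t < ℓ → ((Finset.univ.filter fun a => (preact D w t x a)^2 ≤
      τ^2 * nsq (forward D w t x) / D t).card : ℝ) ≤ ε' * D (t+1)

lemma nsq_sub_lt {n : ℕ} (u v : Fin n → ℝ) (h : nsq (fun a => u a - v a) < nsq v) : u ≠ 0 := by
  rintro rfl
  refine h.ne ?_
  simp [nsq]

lemma Bd_of_OpGood {a b : ℕ} {Mat : Fin a → Fin b → ℝ} {A2 : ℝ} {n : ℕ} {H : Submodule ℝ (Fin b → ℝ)}
    (h : OpGood Mat A2 n H) {u : Fin b → ℝ} (hu : u ∈ H) : Bd Mat A2 n u := h u hu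

lemma relu_lip (p q : ℝ) : (max p 0 - max q 0)^2 ≤ (p - q)^2 := by
  rw [sq_le_sq]
  exact abs_max_sub_max_le_abs p q 0

lemma pre_sub (D : ℕ → ℕ) (w : WT D) (x y : Fin (D 0) → ℝ) (t : ℕ) (a : Fin (D (t+1))) :
    ∑ c, w t a c * (forward D w t y c - forward D w t x c) = preact D w t y a - preact D w t x a := by
  unfold preact
  simp only [mul_sub, Finset.sum_sub_distrib]

lemma fam_Bd_diff (D : ℕ → ℕ) (w : WT D) (b : PT D) (x y : Fin (D 0) → ℝ) (A2 : ℝ) (N : ℕ → ℕ) (t : ℕ)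
    {a : ℕ} (Mat : Fin a → Fin (D t) → ℝ) (hF : FamGood D w x A2 N t Mat)
    (hal : ∀ t', t' < t → forward D w t' y ≠ 0) :
    Bd Mat A2 (rho D (D 0) 0 t) (fun c => forward D w t y c - forward D w t x c) := by
  obtain ⟨k, hk, e⟩ := rho_argmin D t
  rw [e]
  refine Bd_of_OpGood (hF.1 k hk (patB D w b y) ((isReal_patB D w b y t hal).mono (Nat.zero_le _) le_rfl)) ?_
  have h1 := seq_mem_propSub ((forward_isProp D w b y t).mono (Nat.zero_le k) le_rfl)
  exact Submodule.sub_mem _ (Submodule.mem_sup_left h1)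
    (Submodule.mem_sup_right (Submodule.mem_span_singleton_self _))

variable {ℓ : ℕ} {D : ℕ → ℕ} {w : WT D} {v : Fin (D ℓ) → ℝ} {x : Fin (D 0) → ℝ}
    {A2 s ε ε' τ B : ℝ} {N : ℕ → ℕ}

lemma alive_y (hg : DetGood ℓ D w v x A2 s ε ε' τ N) (hD : ∀ t, t ≤ ℓ → 1 ≤ D t) (hA : 1 ≤ A2)
    (hs : A2^ℓ * B < s) (b : PT D) (y : Fin (D 0) → ℝ)
    (hy : ∀ t, t ≤ ℓ → nsq (fun c => y c - x c) ≤ B * D t) :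
    ∀ t, t ≤ ℓ → forward D w t y ≠ 0 := by
  have hA0 : 0 ≤ A2 := by linarith
  have hB0 : 0 ≤ B := by
    have h1 := (nsq_nonneg _).trans (hy 0 (Nat.zero_le _))
    have h2 : (0:ℝ) < D 0 := by exact_mod_cast hD 0 (Nat.zero_le _)
    exact nonneg_of_mul_nonneg_left h1 h2
  intro t
  induction t using Nat.strong_induction_on with
  | _ t ih =>
    intro ht
    have h1 := grow D w A2 hA0 (fun t c => forward D w t y c - forward D w t x c) (D 0) 0 t
      (fun k hk => hD k (by omega))
      (fun t' _ _ a => by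
        have : ∑ c, w t' a c * (forward D w t' y c - forward D w t' x c) = _ := pre_sub D w x y t' a
        rw [this]
        exact relu_lip _ _)
      (fun t' _ h' => fam_Bd_diff D w b x y A2 N t' (w t') (hg.fam t' (by omega))
        (fun t'' h'' => ih t'' (by omega) (by omega))) t (Nat.zero_le _) le_rfl
    obtain ⟨k, hk, e⟩ := rho_argmin D t
    rw [e] at h1
    have hd0 : (0:ℝ) < D 0 := by exact_mod_cast hD 0 (Nat.zero_le _)
    have hdk : (0:ℝ) < D k := by exact_mod_cast hD k (by omega)
    have hdt : (0:ℝ) < D t := by exact_mod_cast hD t (by omega)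
    refine nsq_sub_lt _ (forward D w t x) (lt_of_lt_of_le ?_ (hg.sig t ht))
    have hyk : nsq (fun c => y c - x c) ≤ B * D k := hy k (by omega)
    have h2 : nsq (fun c => forward D w t y c - forward D w t x c) * D k * D 0 ≤
        A2^ℓ * (B * D k * D 0) * D t := by
      refine h1.trans ?_
      have : A2^(t-0) ≤ A2^ℓ := pow_le_pow_right₀ hA (by omega)
      have h3 : nsq (fun c => forward D w 0 y c - forward D w 0 x c) ≤ B * D k := hyk
      have := nsq_nonneg (fun c => forward D w 0 y c - forward D w 0 x c)
      gcongr
    have h3 : nsq (fun c => forward D w t y c - forward D w t x c) ≤ A2^ℓ * B * D t := by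
      refine le_of_mul_le_mul_right ?_ (mul_pos hdk hd0)
      calc _ = nsq (fun c => forward D w t y c - forward D w t x c) * D k * D 0 := by ring
        _ ≤ _ := h2
        _ = _ := by ring
    exact h3.trans_lt (by gcongr)

lemma pre_diff (hg : DetGood ℓ D w v x A2 s ε ε' τ N) (hD : ∀ t, t ≤ ℓ → 1 ≤ D t) (hA : 1 ≤ A2)
    (hs : A2^ℓ * B < s) (b : PT D) (y : Fin (D 0) → ℝ)
    (hy : ∀ t, t ≤ ℓ → nsq (fun c => y c - x c) ≤ B * D t) (t : ℕ) (ht : t < ℓ) :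
    ∑ a, (preact D w t y a - preact D w t x a)^2 ≤ A2^ℓ * B * D (t+1) := by
  have hal := alive_y hg hD hA hs b y hy
  have hA0 : 0 ≤ A2 := by linarith
  have hBd : ∀ t', t' < ℓ → Bd (w t') A2 (rho D (D 0) 0 t') (fun c => forward D w t' y c - forward D w t' x c) :=
    fun t' h' => fam_Bd_diff D w b x y A2 N t' (w t') (hg.fam t' (by omega))
        (fun t'' h'' => hal t'' (by omega))
  have h1 := grow D w A2 hA0 (fun t c => forward D w t y c - forward D w t x c) (D 0) 0 t
      (fun k hk => hD k (by omega))
      (fun t' _ _ a => by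
        have : ∑ c, w t' a c * (forward D w t' y c - forward D w t' x c) = _ := pre_sub D w x y t' a
        rw [this]
        exact relu_lip _ _)
      (fun t' _ h' => hBd t' (by omega)) t (Nat.zero_le _) le_rfl
  have h2 := hBd t ht Finset.univ
  simp only [pre_sub] at h2
  rw [Finset.card_univ, Fintype.card_fin] at h2
  have h3 := grow_step _ _ _ _ _ _ (hD t (by omega)) h2
  rw [← rho_succ D (D 0) 0 t (Nat.zero_le _)] at h3
  obtain ⟨k, hk, e⟩ := rho_argmin D (t+1)
  rw [e] at h3
  have hd0 : (0:ℝ) < D 0 := by exact_mod_cast hD 0 (Nat.zero_le _)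
  have hdk : (0:ℝ) < D k := by exact_mod_cast hD k (by omega)
  have hdt : (0:ℝ) < D t := by exact_mod_cast hD t (by omega)
  have hyk : nsq (fun c => forward D w 0 y c - forward D w 0 x c) ≤ B * D k := hy k (by omega)
  have hny := nsq_nonneg (fun c => forward D w 0 y c - forward D w 0 x c)
  set P := ∑ a, (preact D w t y a - preact D w t x a)^2
  refine le_of_mul_le_mul_right ?_ (mul_pos (mul_pos hdk hd0) hdt)
  calc P * (D k * D 0 * D t) = (P * D k * D t) * D 0 := by ring
    _ ≤ (A2 * (nsq (fun c => forward D w t y c - forward D w t x c) * rho D (D 0) 0 t) * D (t+1)) * D 0 := by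
      gcongr
    _ = A2 * (nsq (fun c => forward D w t y c - forward D w t x c) * rho D (D 0) 0 t * D 0) * D (t+1) := by ring
    _ ≤ A2 * (A2^(t-0) * (nsq (fun c => forward D w 0 y c - forward D w 0 x c) * D 0) * D t) * D (t+1) := by
      gcongr
    _ = A2^(t+1) * (nsq (fun c => forward D w 0 y c - forward D w 0 x c) * D 0) * D t * D (t+1) := by
      rw [Nat.sub_zero]; ring
    _ ≤ A2^ℓ * (B * D k * D 0) * D t * D (t+1) := by
      have : A2^(t+1) ≤ A2^ℓ := pow_le_pow_right₀ hA (by omega)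
      gcongr
    _ = _ := by ring

/-- number of flipped activations -/
lemma flips (hg : DetGood ℓ D w v x A2 s ε ε' τ N) (hD : ∀ t, t ≤ ℓ → 1 ≤ D t) (hA : 1 ≤ A2)
    (hs : A2^ℓ * B < s) (hs0 : 0 < s) (hτ : 0 < τ) (hε : ε' + A2^ℓ * B / (τ^2 * s) ≤ ε) (b : PT D) (y : Fin (D 0) → ℝ)
    (hy : ∀ t, t ≤ ℓ → nsq (fun c => y c - x c) ≤ B * D t) (t : ℕ) (ht : t < ℓ) :
    ((Finset.univ.filter fun a => patX D w x t a ≠ patB D w b y t a).card : ℝ) ≤ ε * D (t+1) := by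
  classical
  have hpd := pre_diff hg hD hA hs b y hy t ht
  have hdt : (0:ℝ) < D t := by exact_mod_cast hD t (by omega)
  set J := Finset.univ.filter fun a => patX D w x t a ≠ patB D w b y t a
  set K := Finset.univ.filter fun a => (preact D w t x a)^2 ≤ τ^2 * nsq (forward D w t x) / D t
  have hc : (J.card : ℝ) ≤ K.card + (J \ K).card := by
    have : J.card ≤ K.card + (J \ K).card := by
      rw [add_comm K.card, Finset.card_sdiff_add_card]
      exact Finset.card_le_card Finset.subset_union_left
    exact_mod_cast this
  have h1 : τ^2 * s * (J \ K).card ≤ A2^ℓ * B * D (t+1) := by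
    calc τ^2 * s * (J \ K).card = ∑ a ∈ J \ K, τ^2 * s := by
          rw [Finset.sum_const, nsmul_eq_mul, mul_comm]
      _ ≤ ∑ a ∈ J \ K, (preact D w t y a - preact D w t x a)^2 := by
        refine Finset.sum_le_sum fun a ha => ?_
        rw [Finset.mem_sdiff, Finset.mem_filter, Finset.mem_filter] at ha
        obtain ⟨⟨_, hJ⟩, hK⟩ := ha
        simp only [Finset.mem_univ, true_and, not_le] at hK
        have h2 : τ^2 * s ≤ τ^2 * nsq (forward D w t x) / D t := by
          rw [le_div_iff₀ hdt, mul_assoc]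
          have := hg.sig t ht.le
          gcongr
        refine h2.trans (hK.le.trans ?_)
        have hsg := patB_sign D w b y t a
        by_cases hx : 0 < preact D w t x a
        · have : patX D w x t a = true := by simp [patX, hx]
          rw [this] at hJ
          have := hsg.2 (by simpa using hJ.symm)
          nlinarith
        · have : patX D w x t a = false := by simp [patX, hx]
          rw [this] at hJ
          have := hsg.1 (by simpa using hJ.symm)
          nlinarith
      _ ≤ ∑ a, (preact D w t y a - preact D w t x a)^2 :=
        Finset.sum_le_sum_of_subset_of_nonneg (Finset.subset_univ _) (fun _ _ _ => sq_nonneg _)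
      _ ≤ _ := hpd
  have hts : 0 < τ^2 * s := by positivity
  have h2 : ((J \ K).card : ℝ) ≤ A2^ℓ * B / (τ^2 * s) * D (t+1) := by
    rw [div_mul_eq_mul_div, le_div_iff₀ hts]; linarith
  have h3 := hg.cnt t ht
  calc (J.card : ℝ) ≤ K.card + (J \ K).card := hc
    _ ≤ ε' * D (t+1) + A2^ℓ * B / (τ^2 * s) * D (t+1) := add_le_add h3 h2
    _ = (ε' + A2^ℓ * B / (τ^2 * s)) * D (t+1) := by ring
    _ ≤ _ := by gcongr

end

open MeasureTheory ProbabilityTheory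
noncomputable section

/-- telescoping -/
lemma telescope (D : ℕ → ℕ) (w : WT D) (ρ π : PT D) (u : Fin (D 0) → ℝ) (j : ℕ) (a : Fin (D j)) :
    seqFrom D w (bR ρ) 0 u j a - seqFrom D w (bR π) 0 u j a =
      ∑ i ∈ Finset.range j, seqFrom D w (mix ρ π i) 0 u j a := by
  have hpre : ∀ i t, t ≤ i → seqFrom D w (mix ρ π i) 0 u t = seqFrom D w (bR π) 0 u t := by
    intro i t
    induction t with
    | zero => intro _; rw [seqFrom_self, seqFrom_self]
    | succ t ih =>
      intro ht
      ext a
      rw [seqFrom_isProp D w _ 0 (t+1) u t (Nat.zero_le _) (Nat.lt_succ_self _) a,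
        seqFrom_isProp D w _ 0 (t+1) u t (Nat.zero_le _) (Nat.lt_succ_self _) a, ih (by omega)]
      congr 1
      unfold mix
      rw [if_pos (by omega)]
  induction j with
  | zero => simp [seqFrom_self]
  | succ j ih =>
    rw [Finset.sum_range_succ]
    have e : ∀ lam : MT D, seqFrom D w lam 0 u (j+1) a = lam j a * ∑ c, w j a c * seqFrom D w lam 0 u j c :=
      fun lam => seqFrom_isProp D w _ 0 (j+1) u j (Nat.zero_le _) (Nat.lt_succ_self _) a
    have h1 : ∀ i ∈ Finset.range j, seqFrom D w (mix ρ π i) 0 u (j+1) a =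
        bR ρ j a * ∑ c, w j a c * seqFrom D w (mix ρ π i) 0 u j c := by
      intro i hi
      rw [Finset.mem_range] at hi
      rw [e]
      congr 1
      unfold mix
      rw [if_neg (by omega), if_neg (by omega)]
    rw [Finset.sum_congr rfl h1, ← Finset.mul_sum, Finset.sum_comm]
    simp_rw [← Finset.mul_sum, ← ih]
    rw [e, e, e, hpre j j le_rfl]
    have : mix ρ π j j a = bR ρ j a - bR π j a := by unfold mix; simp
    rw [this]
    simp only [mul_sub, Finset.sum_sub_distrib]
    ring

lemma mix_pre (D : ℕ → ℕ) (w : WT D) (ρ π : PT D) (u : Fin (D 0) → ℝ) (i : ℕ) :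
    IsProp D w (bR π) 0 i (seqFrom D w (mix ρ π i) 0 u) := by
  refine (seqFrom_isProp D w (mix ρ π i) 0 i u).congr (fun _ _ _ => rfl) (fun t _ h => ?_)
  ext a; unfold mix; rw [if_pos h]

lemma mix_post (D : ℕ → ℕ) (w : WT D) (ρ π : PT D) (u : Fin (D 0) → ℝ) (i j : ℕ) :
    IsProp D w (bR ρ) (i+1) j (seqFrom D w (mix ρ π i) 0 u) := by
  refine ((seqFrom_isProp D w (mix ρ π i) 0 j u).mono (Nat.zero_le (i+1)) le_rfl).congr (fun _ _ _ => rfl) (fun t h _ => ?_)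
  ext a; unfold mix; rw [if_neg (by omega), if_neg (by omega)]

lemma bR_sq_le {D : ℕ → ℕ} (π : PT D) (t : ℕ) (a : Fin (D (t+1))) (p : ℝ) : (bR π t a * p)^2 ≤ p^2 := by
  unfold bR
  split_ifs
  · simp
  · simp [sq_nonneg]

variable {ℓ : ℕ} {D : ℕ → ℕ} {w : WT D} {v : Fin (D ℓ) → ℝ} {x : Fin (D 0) → ℝ}
    {A2 s ε ε' τ B : ℝ} {N : ℕ → ℕ}

/-- bound on a single telescoping term -/
lemma term_bound (hg : DetGood ℓ D w v x A2 s ε ε' τ N) (hD : ∀ t, t ≤ ℓ → 1 ≤ D t) (hA : 1 ≤ A2)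
    (hs0 : 0 < s) (hε0 : 0 ≤ ε) (hε1 : ε ≤ 1) (hN : ∀ k, N k = ⌊ε * D k⌋₊)
    (π : PT D) (hπ : IsReal D w π 0 ℓ) (i : ℕ) (hi : i < ℓ)
    (hJ : ((Finset.univ.filter fun a => patX D w x i a ≠ π i a).card : ℝ) ≤ ε * D (i+1))
    (u : Fin (D 0) → ℝ) :
    (∑ c, v c * seqFrom D w (mix (patX D w x) π i) 0 u ℓ c)^2 ≤ A2^(ℓ+1) * ε * nsq u := by
  classical
  have hA0 : 0 ≤ A2 := by linarith
  set H := seqFrom D w (mix (patX D w x) π i) 0 u with hH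
  set J := Finset.univ.filter fun a => patX D w x i a ≠ π i a with hJd
  have hd : ∀ t, t ≤ ℓ → (0:ℝ) < D t := fun t ht => by exact_mod_cast hD t ht
  have hd0 := hd 0 (Nat.zero_le _)
  have hdi := hd i hi.le
  have hdi1 := hd (i+1) hi
  set r := rho D (D 0) 0 i with hr
  have hr1 : 1 ≤ r := rho_pos D _ 0 i (Nat.zero_le _) (hD 0 (Nat.zero_le _)) (fun k hk => hD k (by omega))
  have hr0 : (0:ℝ) < r := by exact_mod_cast hr1
  -- x is alive, so its pattern is realizable
  have hxal : ∀ t, t ≤ ℓ → forward D w t x ≠ 0 := by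
    intro t ht h0
    have h1 := hg.sig t ht
    rw [h0] at h1
    have : nsq (0 : Fin (D t) → ℝ) = 0 := by simp [nsq]
    have := mul_pos hs0 (hd t ht)
    linarith
  have hxreal : IsReal D w (patX D w x) 0 ℓ :=
    (isReal_patB D w (fun _ _ => false) x ℓ (fun t ht => hxal t ht.le)).congr (fun _ _ _ => rfl)
      (fun t _ ht => patB_eq_patX D w _ x t (hg.noties t ht))
  have hpreH : IsProp D w (bR π) 0 i H := mix_pre D w (patX D w x) π u i
  -- step one: before layer i
  have hBpre : ∀ t, t ≤ i → Bd (w t) A2 (rho D (D 0) 0 t) (H t) := by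
    intro t ht
    obtain ⟨k, hk, e⟩ := rho_argmin D t
    rw [e]
    refine Bd_of_OpGood ((hg.fam t (by omega)).1 k hk π (hπ.mono (Nat.zero_le _) (by omega))) ?_
    exact Submodule.mem_sup_left (seq_mem_propSub ((mix_pre D w (patX D w x) π u i).mono (Nat.zero_le k) ht))
  have h1 := grow D w A2 hA0 H (D 0) 0 i (fun k hk => hD k (by omega))
    (fun t _ ht a => by
      rw [hpreH t (Nat.zero_le _) ht a]; exact bR_sq_le _ _ _ _)
    (fun t _ ht => hBpre t (by omega)) i (Nat.zero_le _) le_rfl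
  have hH0 : H 0 = u := seqFrom_self _ _ _ _ _
  rw [hH0, ← hr, Nat.sub_zero] at h1
  have h1' : nsq (H i) * r ≤ A2^i * nsq u * D i := by
    refine le_of_mul_le_mul_right ?_ hd0
    calc _ ≤ _ := h1
      _ = _ := by ring
  -- step two: the flip
  have hq0 : ∀ a, H (i+1) a = (bR (patX D w x) i a - bR π i a) * ∑ c, w i a c * H i c := by
    intro a
    rw [hH, seqFrom_isProp D w _ 0 (i+1) u i (Nat.zero_le _) (Nat.lt_succ_self _) a]
    congr 1
    unfold mix; simp
  have hqJ : ∀ a ∉ J, H (i+1) a = 0 := by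
    intro a ha
    have : patX D w x i a = π i a := by
      by_contra h
      exact ha (by simp [hJd, h])
    rw [hq0]; unfold bR; rw [this]; simp
  have hq1 : nsq (H (i+1)) ≤ A2 * nsq (H i) * (max J.card r : ℕ) / D i := by
    refine le_trans ?_ (hBpre i le_rfl J)
    unfold nsq
    rw [← Finset.sum_subset (Finset.subset_univ J) (fun a _ ha => by rw [hqJ a ha]; simp)]
    refine Finset.sum_le_sum fun a _ => ?_
    rw [hq0, mul_pow]
    have : (bR (patX D w x) i a - bR π i a)^2 ≤ 1 := by
      unfold bR; split_ifs <;> norm_num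
    nlinarith [sq_nonneg (∑ c, w i a c * H i c)]
  have hq : nsq (H (i+1)) * r ≤ A2^(i+1) * nsq u * (max J.card r : ℕ) := by
    rw [le_div_iff₀ hdi] at hq1
    refine le_of_mul_le_mul_right ?_ hdi
    calc nsq (H (i+1)) * r * D i = (nsq (H (i+1)) * D i) * r := by ring
      _ ≤ (A2 * nsq (H i) * (max J.card r : ℕ)) * r := by gcongr
      _ = A2 * (nsq (H i) * r) * (max J.card r : ℕ) := by ring
      _ ≤ A2 * (A2^i * nsq u * D i) * (max J.card r : ℕ) := by gcongr
      _ = _ := by ring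
  -- step three: after the flip
  have hpost : ∀ j, IsProp D w (bR (patX D w x)) (i+1) j H := mix_post D w (patX D w x) π u i
  have hle : ∀ t, i+1 ≤ t → t < ℓ → ∀ a, (H (t+1) a)^2 ≤ (∑ c, w t a c * H t c)^2 := by
    intro t h h' a
    rw [hpost ℓ t h h' a]; exact bR_sq_le _ _ _ _
  have hmid : ∀ {a' : ℕ} (t : ℕ) (Mat : Fin a' → Fin (D t) → ℝ), t ≤ ℓ → FamGood D w x A2 N t Mat →
      ∀ k, i+1 ≤ k → k ≤ t → Bd Mat A2 (D k) (H t) := by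
    intro a' t Mat ht hF k hk hkt
    refine Bd_of_OpGood (hF.1 k hkt (patX D w x) (hxreal.mono (Nat.zero_le _) ht)) ?_
    exact Submodule.mem_sup_left (seq_mem_propSub ((hpost t).mono hk le_rfl))
  have hfin : ∀ n, 1 ≤ n → (∀ {a' : ℕ} (t : ℕ) (Mat : Fin a' → Fin (D t) → ℝ), i+1 ≤ t → t ≤ ℓ →
      FamGood D w x A2 N t Mat → Bd Mat A2 n (H t)) →
      (∑ c, v c * H ℓ c)^2 * D (i+1) ≤ A2^(ℓ - (i+1) + 1) * (nsq (H (i+1)) * n) := by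
    intro n hn hnB
    have hall : ∀ {a' : ℕ} (t : ℕ) (Mat : Fin a' → Fin (D t) → ℝ), i+1 ≤ t → t ≤ ℓ →
        FamGood D w x A2 N t Mat → Bd Mat A2 (rho D n (i+1) t) (H t) := by
      intro a' t Mat h h' hF
      rcases rho_cases D n (i+1) t h with e | ⟨k, hk, hk', e⟩
      · rw [e]; exact hnB t Mat h h' hF
      · rw [e]; exact hmid t Mat h' hF k hk hk'
    exact grow_final D w A2 hA0 H n (i+1) ℓ hi hn hD v hle
      (fun t h h' => hall t (w t) h h'.le (hg.fam t h')) (hall ℓ _ hi le_rfl hg.famv)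
  have hpw : A2^(ℓ - (i+1) + 1) * A2^(i+1) = A2^(ℓ+1) := by
    rw [← pow_add]; congr 1; omega
  have hnu := nsq_nonneg u
  have hAp : 0 ≤ A2^(ℓ - (i+1) + 1) := by positivity
  by_cases hcase : (r:ℝ) ≤ ε * D (i+1)
  · -- case A
    obtain ⟨k, hk, e⟩ := rho_argmin D i
    have h2 := hfin r hr1 (by
      intro a' t Mat h h' hF
      rw [hr, e]
      refine Bd_of_OpGood (hF.2.2 k i hk (by omega) π (hπ.mono (Nat.zero_le _) (by omega))) ?_
      exact seq_mem_propSub ((seqFrom_isProp D w _ 0 t u).mono (Nat.zero_le _) le_rfl))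
    refine le_of_mul_le_mul_right (h2.trans ?_) hdi1
    calc A2^(ℓ - (i+1) + 1) * (nsq (H (i+1)) * r) ≤ A2^(ℓ - (i+1) + 1) * (A2^(i+1) * nsq u * (max J.card r : ℕ)) := by
          gcongr
      _ = A2^(ℓ+1) * nsq u * (max J.card r : ℕ) := by rw [← hpw]; ring
      _ ≤ A2^(ℓ+1) * nsq u * (ε * D (i+1)) := by
          have : ((max J.card r : ℕ) : ℝ) ≤ ε * D (i+1) := by
            push_cast; exact max_le hJ hcase
          gcongr
      _ = _ := by ring
  · -- case B
    push Not at hcase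
    by_cases hJ0 : J.card = 0
    · -- nothing flips
      have hz : H (i+1) = 0 := by
        ext a; exact hqJ a (by rw [Finset.card_eq_zero.mp hJ0]; simp)
      have h2 := hfin 1 le_rfl (by
        intro a' t Mat h h' hF
        have : H t = 0 := by
          clear hF h' Mat
          induction t, h using Nat.le_induction with
          | base => exact hz
          | succ t h ih =>
            ext a
            rw [hpost (t+1) t h (Nat.lt_succ_self _) a, ih]; simp
        intro S
        rw [this]; simp [nsq])
      rw [hz] at h2
      have : nsq (0 : Fin (D (i+1)) → ℝ) = 0 := by simp [nsq]
      rw [this] at h2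
      have h3 : (∑ c, v c * H ℓ c)^2 ≤ 0 := by
        refine le_of_mul_le_mul_right (h2.trans ?_) hdi1
        simp
      refine h3.trans ?_
      positivity
    · have hJN : J.card ≤ N (i+1) := by rw [hN]; exact Nat.le_floor hJ
      have hN1 : 1 ≤ N (i+1) := by omega
      have hNε : (N (i+1) : ℝ) ≤ ε * D (i+1) := by rw [hN]; exact Nat.floor_le (by positivity)
      have hND : N (i+1) ≤ D (i+1) := by
        have : (N (i+1) : ℝ) ≤ D (i+1) := hNε.trans (by nlinarith)
        exact_mod_cast this
      obtain ⟨T, hJT, hTc⟩ := Finset.exists_superset_card_eq hJN (by simpa using hND)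
      have h2 := hfin (N (i+1)) hN1 (by
        intro a' t Mat h h' hF
        refine Bd_of_OpGood (hF.2.1 (i+1) h T hTc hN1) ?_
        exact ⟨H, hpost t, fun a ha => hqJ a (fun h => ha (hJT h)), rfl⟩)
      have hmax : max J.card r = r := by
        apply max_eq_right
        have : (J.card : ℝ) ≤ r := hJ.trans hcase.le
        exact_mod_cast this
      rw [hmax] at hq
      have hq' : nsq (H (i+1)) ≤ A2^(i+1) * nsq u := le_of_mul_le_mul_right hq hr0
      refine le_of_mul_le_mul_right (h2.trans ?_) hdi1
      calc A2^(ℓ - (i+1) + 1) * (nsq (H (i+1)) * N (i+1)) ≤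
            A2^(ℓ - (i+1) + 1) * ((A2^(i+1) * nsq u) * (ε * D (i+1))) := by gcongr
        _ = A2^(ℓ+1) * ε * nsq u * D (i+1) := by rw [← hpw]; ring

/-- the gradient paired with a vector -/
lemma mprod_pair (D : ℕ → ℕ) (w : WT D) (b : PT D) (z : Fin (D 0) → ℝ) (u : Fin (D 0) → ℝ) (t : ℕ)
    (a : Fin (D t)) :
    ∑ c, Mprod D w b z 0 t a c * u c = seqFrom D w (bR (patB D w b z)) 0 u t a := by
  induction t with
  | zero =>
    rw [seqFrom_self]
    simp [Mprod, ← Fin.ext_iff]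
  | succ t ih =>
    rw [seqFrom_isProp D w _ 0 (t+1) u t (Nat.zero_le _) (Nat.lt_succ_self _) a]
    simp_rw [← ih]
    rw [bR_patB]
    simp only [Mprod, Nat.succ_ne_zero, if_false, Finset.mul_sum, Finset.sum_mul]
    rw [Finset.sum_comm]
    refine Finset.sum_congr rfl fun k _ => Finset.sum_congr rfl fun c _ => ?_
    ring

lemma grad_pair (ℓ : ℕ) (D : ℕ → ℕ) (w : WT D) (b : PT D) (v : Fin (D ℓ) → ℝ) (z : Fin (D 0) → ℝ)
    (u : Fin (D 0) → ℝ) :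
    ∑ c, gradVec ℓ D w b v z c * u c = ∑ a, v a * seqFrom D w (bR (patB D w b z)) 0 u ℓ a := by
  simp_rw [← mprod_pair, gradVec, Finset.sum_mul, Finset.mul_sum]
  rw [Finset.sum_comm]
  refine Finset.sum_congr rfl fun k _ => Finset.sum_congr rfl fun c _ => ?_
  ring

/-- The deterministic conclusion. -/
theorem det_main (hg : DetGood ℓ D w v x A2 s ε ε' τ N) (hD : ∀ t, t ≤ ℓ → 1 ≤ D t) (hA : 1 ≤ A2)
    (hs : A2^ℓ * B < s) (hs0 : 0 < s) (hτ : 0 < τ) (hε : ε' + A2^ℓ * B / (τ^2 * s) ≤ ε)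
    (hε0 : 0 ≤ ε) (hε1 : ε ≤ 1) (hN : ∀ k, N k = ⌊ε * D k⌋₊) (b : PT D) (y : Fin (D 0) → ℝ)
    (hy : ∀ t, t ≤ ℓ → nsq (fun c => y c - x c) ≤ B * D t) :
    nsq (fun c => gradVec ℓ D w b v x c - gradVec ℓ D w b v y c) ≤ (ℓ:ℝ)^2 * (A2^(ℓ+1) * ε) := by
  have hal := alive_y hg hD hA hs b y hy
  have hπ := isReal_patB D w b y ℓ (fun t ht => hal t ht.le)
  set u := fun c => gradVec ℓ D w b v x c - gradVec ℓ D w b v y c with hu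
  have hpx : ∀ a, seqFrom D w (bR (patB D w b x)) 0 u ℓ a = seqFrom D w (bR (patX D w x)) 0 u ℓ a := by
    have : ∀ t, t ≤ ℓ → seqFrom D w (bR (patB D w b x)) 0 u t = seqFrom D w (bR (patX D w x)) 0 u t := by
      intro t
      induction t with
      | zero => intro _; rw [seqFrom_self, seqFrom_self]
      | succ t ih =>
        intro ht
        ext a
        rw [seqFrom_isProp D w _ 0 (t+1) u t (Nat.zero_le _) (Nat.lt_succ_self _) a,
          seqFrom_isProp D w _ 0 (t+1) u t (Nat.zero_le _) (Nat.lt_succ_self _) a, ih (by omega)]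
        congr 1
        unfold bR
        rw [patB_eq_patX D w b x t (hg.noties t (by omega))]
    intro a; rw [this ℓ le_rfl]
  have e1 : nsq u = ∑ i ∈ Finset.range ℓ, ∑ c, v c * seqFrom D w (mix (patX D w x) (patB D w b y) i) 0 u ℓ c := by
    have : nsq u = ∑ c, gradVec ℓ D w b v x c * u c - ∑ c, gradVec ℓ D w b v y c * u c := by
      rw [← Finset.sum_sub_distrib]
      refine Finset.sum_congr rfl fun c _ => ?_
      simp only [hu]; ring
    rw [this, grad_pair, grad_pair, ← Finset.sum_sub_distrib, Finset.sum_comm]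
    refine Finset.sum_congr rfl fun c _ => ?_
    rw [hpx, ← mul_sub, telescope, Finset.mul_sum]
  have h1 : ∀ i ∈ Finset.range ℓ,
      (∑ c, v c * seqFrom D w (mix (patX D w x) (patB D w b y) i) 0 u ℓ c)^2 ≤ A2^(ℓ+1) * ε * nsq u := by
    intro i hi
    rw [Finset.mem_range] at hi
    exact term_bound hg hD hA hs0 hε0 hε1 hN (patB D w b y) hπ i hi
      (flips hg hD hA hs hs0 hτ hε b y hy i hi) u
  have h2 : (nsq u)^2 ≤ (ℓ:ℝ)^2 * (A2^(ℓ+1) * ε) * nsq u := by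
    calc (nsq u)^2 = (∑ i ∈ Finset.range ℓ, ∑ c, v c * seqFrom D w (mix (patX D w x) (patB D w b y) i) 0 u ℓ c)^2 := by
          rw [← e1]
      _ ≤ (Finset.range ℓ).card * ∑ i ∈ Finset.range ℓ, (∑ c, v c * seqFrom D w (mix (patX D w x) (patB D w b y) i) 0 u ℓ c)^2 :=
          sq_sum_le_card_mul_sum_sq
      _ ≤ (Finset.range ℓ).card * ∑ i ∈ Finset.range ℓ, A2^(ℓ+1) * ε * nsq u := by
          gcongr with i hi
          exact h1 i hi
      _ = _ := by
          rw [Finset.sum_const, Finset.card_range, nsmul_eq_mul]; ring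
  rcases (nsq_nonneg u).eq_or_lt with h0 | h0
  · rw [← h0]; positivity
  · rw [sq] at h2; exact le_of_mul_le_mul_right h2 h0

end

open MeasureTheory ProbabilityTheory
noncomputable section

/-! ### Probability that the weights are good -/

lemma forward_congr {D : ℕ → ℕ} {w w' : WT D} (x : Fin (D 0) → ℝ) (j : ℕ)
    (h : ∀ t, t < j → w t = w' t) : forward D w j x = forward D w' j x := by
  induction j with
  | zero => rfl
  | succ j ih =>
    ext a
    simp only [forward]
    rw [ih (fun t ht => h t (by omega)), h j (Nat.lt_succ_self _)]

lemma patX_congr {D : ℕ → ℕ} {w w' : WT D} (x : Fin (D 0) → ℝ) (j : ℕ)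
    (h : ∀ t, t < j → w t = w' t) (t : ℕ) (ht : t < j) : patX D w x t = patX D w' x t := by
  ext a
  unfold patX preact
  rw [forward_congr x t (fun t' h' => h t' (by omega)), h t ht]

lemma GenGood.congr {D : ℕ → ℕ} {w w' : WT D} {j a : ℕ} {Mat : Fin a → Fin (D j) → ℝ}
    (hg : GenGood D w j Mat) (h : ∀ t, t < j → w t = w' t) : GenGood D w' j Mat := by
  intro k hk π hπ
  rw [← propSub_congr (w := w) (lam := bR π) _ (fun t _ ht => h t ht) (fun _ _ _ => rfl)]
  exact hg k hk π (hπ.congr (fun t _ ht => (h t ht).symm) (fun _ _ _ => rfl))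

lemma FamGood.congr {D : ℕ → ℕ} {w w' : WT D} {x : Fin (D 0) → ℝ} {A2 : ℝ} {N : ℕ → ℕ} {j a : ℕ}
    {Mat : Fin a → Fin (D j) → ℝ}
    (hg : FamGood D w x A2 N j Mat) (h : ∀ t, t < j → w t = w' t) : FamGood D w' x A2 N j Mat := by
  have hp := patX_congr x j h
  refine ⟨fun k hk π hπ => ?_, fun k hk T hT hN => ?_, fun k i hki hij π hπ => ?_⟩
  · rw [← propSub_congr (w := w) (lam := bR π) _ (fun t _ ht => h t ht) (fun _ _ _ => rfl),
      ← forward_congr x j h]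
    exact hg.1 k hk π (hπ.congr (fun t _ ht => (h t ht).symm) (fun _ _ _ => rfl))
  · rw [← propSub_congr (w := w) (lam := bR (patX D w x)) _ (fun t _ ht => h t ht)
      (fun t _ ht => by unfold bR; rw [hp t ht])]
    exact hg.2.1 k hk T hT hN
  · rw [← propSub_congr (w := w) (lam := mix (patX D w x) π i) _ (fun t _ ht => h t ht)
      (fun t _ ht => by ext b; unfold mix bR; rw [hp t ht])]
    exact hg.2.2 k i hki hij π (hπ.congr (fun t _ ht => (h t (by omega)).symm) (fun _ _ _ => rfl))

/-- the good event for the matrix acting on layer `i` -/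
def LayerOK (D : ℕ → ℕ) (w : WT D) (x : Fin (D 0) → ℝ) (A2 : ℝ) (N : ℕ → ℕ) (τ ε' : ℝ) (i : ℕ) {a : ℕ}
    (Mat : Fin a → Fin (D i) → ℝ) : Prop :=
  GenGood D w i Mat ∧ FamGood D w x A2 N i Mat ∧
  (1/640 * nsq (forward D w i x) * a / D i ≤ ∑ j, (max (∑ k, Mat j k * forward D w i x k) 0)^2) ∧
  (∀ j, ∑ k, Mat j k * forward D w i x k ≠ 0) ∧
  ((Finset.univ.filter fun j => (∑ k, Mat j k * forward D w i x k)^2 ≤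
      τ^2 * nsq (forward D w i x) / D i).card : ℝ) ≤ ε' * a

lemma LayerOK.congr {D : ℕ → ℕ} {w w' : WT D} {x : Fin (D 0) → ℝ} {A2 τ ε' : ℝ} {N : ℕ → ℕ} {j a : ℕ}
    {Mat : Fin a → Fin (D j) → ℝ}
    (hg : LayerOK D w x A2 N τ ε' j Mat) (h : ∀ t, t < j → w t = w' t) : LayerOK D w' x A2 N τ ε' j Mat := by
  obtain ⟨h1, h2, h3⟩ := hg
  refine ⟨h1.congr h, h2.congr h, ?_⟩
  rw [← forward_congr x j h]
  exact h3

lemma layer_prob (D : ℕ → ℕ) (w : WT D) (x : Fin (D 0) → ℝ) (N : ℕ → ℕ) (ℓ j M a : ℕ) (X β τ ε' lam f : ℝ)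
    (hℓ : 1 ≤ ℓ) (hj : j ≤ ℓ) (hM : 2 ≤ M) (hD1 : ∀ t, t ≤ ℓ → 1 ≤ D t) (hDM : ∀ t, t ≤ ℓ → D t ≤ M)
    (ha : a ≤ M) (hX : X = ℓ * Real.log M) (hX2 : 2 ≤ X)
    (hG : ∀ t, t < j → GenGood D w t (w t))
    (hβ1 : 1 ≤ β) (hβ : ∀ k, k ≤ ℓ → β ≤ D k) (hβN : ∀ k, k ≤ ℓ → 1 ≤ N k → β ≤ N k)
    (hx : 0 < nsq (forward D w j x)) (hτ0 : 0 ≤ τ) (hlam : 1 ≤ lam) (hτ : τ * Real.exp lam = ε')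
    (hε' : β ≤ max 1 (ε' * a))
    (hf : Real.exp (-20 * β * X) + (3/4)^a + Real.exp (-(lam-1)*β) ≤ f) :
    ENNReal.ofReal (1 - f) ≤ gaussMat a (D j) (1 / (D j : NNReal))
      {Mat | LayerOK D w x (2000 * X) N τ ε' j Mat} := by
  set μ := gaussMat a (D j) (1 / (D j : NNReal)) with hμ
  set u := forward D w j x with hu
  have hu0 : u ≠ 0 := by
    rintro h0; rw [h0] at hx; simp [nsq] at hx
  have hdj : 1 ≤ D j := hD1 j hj
  have hv : (1 / (D j : NNReal)) ≠ 0 := by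
    have : (D j : NNReal) ≠ 0 := by exact_mod_cast (by omega : D j ≠ 0)
    exact one_div_ne_zero this
  have g1 := gen_prob D w a j hG _ hv
  have f1 := fam_prob D w x N ℓ j M a X β hℓ hj hM hD1 hDM ha hX hX2 hG hβ1 hβ hβN
  have f2 := mat_relu_lower a (D j) hdj u
  have f3 := mat_no_ties a (D j) _ hv u hu0
  have f4 := mat_small_count a (D j) hdj u hx τ lam (max 1 (ε' * a)) hτ0 (by linarith)
  have hε0 : 0 ≤ ε' := by rw [← hτ]; positivity
  have f4' : μ {Mat | ¬ ((Finset.univ.filter fun j' => (∑ k, Mat j' k * u k)^2 ≤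
      τ^2 * nsq u / D j).card : ℝ) ≤ ε' * a} ≤ ENNReal.ofReal (Real.exp (-(lam-1)*β)) := by
    refine le_trans (measure_mono ?_) (f4.trans (ENNReal.ofReal_le_ofReal (Real.exp_le_exp.mpr ?_)))
    · intro Mat hMat
      simp only [Set.mem_ofPred_eq, not_le] at hMat ⊢
      refine max_le ?_ hMat.le
      have : (0:ℝ) < _ := lt_of_le_of_lt (by positivity) hMat
      have h1 : 0 < (Finset.univ.filter fun j' => (∑ k, Mat j' k * u k)^2 ≤ τ^2 * nsq u / D j).card := by
        exact_mod_cast this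
      exact_mod_cast h1
    · rw [hτ]
      have h1 : (a:ℝ) * ε' ≤ max 1 (ε' * a) := by rw [mul_comm]; exact le_max_right _ _
      nlinarith
  have hB : μ ({Mat | FamGood D w x (2000 * X) N j Mat ∧
      (1/640 * nsq u * a / D j ≤ ∑ j', (max (∑ k, Mat j' k * u k) 0)^2) ∧
      (∀ j', ∑ k, Mat j' k * u k ≠ 0) ∧
      ((Finset.univ.filter fun j' => (∑ k, Mat j' k * u k)^2 ≤
      τ^2 * nsq u / D j).card : ℝ) ≤ ε' * a}ᶜ) ≤ ENNReal.ofReal f := by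
    refine le_trans (b := μ ((({Mat | ¬ FamGood D w x (2000 * X) N j Mat} ∪
      {Mat | ∑ j', (max (∑ k, Mat j' k * u k) 0)^2 < 1/640 * nsq u * a / D j}) ∪
      {Mat | ∃ j', ∑ k, Mat j' k * u k = 0}) ∪ {Mat | ¬ ((Finset.univ.filter fun j' => (∑ k, Mat j' k * u k)^2 ≤
      τ^2 * nsq u / D j).card : ℝ) ≤ ε' * a})) (measure_mono ?_) ?_
    · intro Mat hMat
      by_contra hcon
      apply hMat
      simp only [Set.mem_union, Set.mem_ofPred_eq, not_or, not_not, not_exists, not_lt] at hcon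
      obtain ⟨⟨⟨h1, h2⟩, h3⟩, h4⟩ := hcon
      exact ⟨h1, h2, h3, h4⟩
    · refine (measure_union_le _ _).trans ((add_le_add (measure_union_le _ _) f4').trans ?_)
      rw [f3, add_zero]
      refine (add_le_add ((measure_union_le _ _).trans (add_le_add f1 f2)) le_rfl).trans ?_
      rw [← ENNReal.ofReal_add (by positivity) (by positivity),
        ← ENNReal.ofReal_add (by positivity) (by positivity)]
      exact ENNReal.ofReal_le_ofReal hf
  have h := outer_inter_ge μ _ _ _ _ g1 hB
  have hf0 : 0 ≤ f := le_trans (by positivity) hf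
  rw [ENNReal.ofReal_sub _ hf0, ENNReal.ofReal_one]
  refine h.trans (measure_mono ?_)
  rintro Mat ⟨h1, h2⟩
  exact ⟨h1, h2⟩

lemma extendW_lt (ℓ : ℕ) (D : ℕ → ℕ) (w : ∀ i : Fin ℓ, Fin (D (i.1+1)) → Fin (D i.1) → ℝ) (t : ℕ) (h : t < ℓ) :
    extendW ℓ D w t = w ⟨t, h⟩ := by simp [extendW, h]

/-- transfer of the row-vector law -/
lemma row_transfer (b : ℕ) (v : NNReal) (E : Set (Fin b → ℝ)) :
    gaussMat 1 b v {Mat | Mat 0 ∈ E} ≤ (Measure.pi fun _ : Fin b => gaussianReal 0 v) E := by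
  have h := (measurePreserving_funUnique (Measure.pi fun _ : Fin b => gaussianReal 0 v) (Fin 1))
  rw [← h.measure_preimage_equiv]
  exact measure_mono fun Mat hM => hM

lemma sig_of_layer (ℓ : ℕ) (D : ℕ → ℕ) (w : WT D) (x : Fin (D 0) → ℝ) (A2 τ ε' : ℝ) (N : ℕ → ℕ)
    (hD1 : ∀ t, t ≤ ℓ → 1 ≤ D t) (hx : nsq x = D 0) (j : ℕ) (hj : j ≤ ℓ)
    (h : ∀ t, t < j → LayerOK D w x A2 N τ ε' t (w t)) :
    (1/640)^j * (D j : ℝ) ≤ nsq (forward D w j x) := by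
  induction j with
  | zero => simp [forward, hx]
  | succ j ih =>
    have ih := ih (by omega) (fun t ht => h t (by omega))
    have h1 := (h j (Nat.lt_succ_self _)).2.2.1
    have hd : (0:ℝ) < D j := by exact_mod_cast hD1 j (by omega)
    refine le_trans ?_ h1
    rw [le_div_iff₀ hd, pow_succ]
    calc (1/640)^j * (1/640) * (D (j+1):ℝ) * D j = 1/640 * ((1/640)^j * D j) * D (j+1) := by ring
      _ ≤ _ := by gcongr

theorem main_prob (ℓ : ℕ) (D : ℕ → ℕ) (x : Fin (D 0) → ℝ) (N : ℕ → ℕ) (M : ℕ) (X β τ ε ε' lam f : ℝ)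
    (hℓ : 1 ≤ ℓ) (hM : 2 ≤ M) (hD1 : ∀ t, t ≤ ℓ → 1 ≤ D t) (hDM : ∀ t, t ≤ ℓ → D t ≤ M)
    (hX : X = ℓ * Real.log M) (hX2 : 2 ≤ X)
    (hβ1 : 1 ≤ β) (hβ : ∀ k, k ≤ ℓ → β ≤ D k) (hβN : ∀ k, k ≤ ℓ → 1 ≤ N k → β ≤ N k)
    (hx : nsq x = D 0) (hτ0 : 0 ≤ τ) (hlam : 1 ≤ lam) (hτ : τ * Real.exp lam = ε')
    (hε' : ∀ k, k ≤ ℓ → β ≤ max 1 (ε' * D k))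
    (hf1 : f ≤ 1)
    (hf : ∀ k, k ≤ ℓ → Real.exp (-20 * β * X) + (3/4)^(D k) + Real.exp (-(lam-1)*β) ≤ f) :
    ENNReal.ofReal ((1 - f)^(ℓ+1)) ≤ weightMeasure ℓ D
      {ω | DetGood ℓ D (extendW ℓ D ω.1) ω.2 x (2000 * X) ((1/640)^ℓ) ε ε' τ N} := by
  classical
  have hchain := outer_pi_chain ℓ (fun i => Fin (D (i.1+1)) → Fin (D i.1) → ℝ)
    (fun i => gaussMat (D (i.1+1)) (D i.1) (1 / (D i.1 : NNReal)))
    (fun i w => LayerOK D (extendW ℓ D w) x (2000 * X) N τ ε' i.1 (w i))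
    (by
      intro i w w' h hP
      have e : w i = w' i := h i le_rfl
      rw [← e]
      refine hP.congr (fun t ht => ?_)
      rw [extendW_lt ℓ D w t (by omega), extendW_lt ℓ D w' t (by omega)]
      exact h _ (by rw [Fin.le_def]; simp; omega))
    (ENNReal.ofReal (1-f))
    (by
      intro i w hP
      have hi := i.2
      have hP' : ∀ t, t < i.1 → LayerOK D (extendW ℓ D w) x (2000 * X) N τ ε' t (extendW ℓ D w t) := by
        intro t ht
        rw [extendW_lt ℓ D w t (by omega)]
        exact hP ⟨t, by omega⟩ (by rw [Fin.lt_def]; exact ht)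
      have hs := sig_of_layer ℓ D (extendW ℓ D w) x _ _ _ _ hD1 hx i.1 (by omega) hP'
      have hdi : (0:ℝ) < D i.1 := by exact_mod_cast hD1 i.1 (by omega)
      have hs0 : 0 < nsq (forward D (extendW ℓ D w) i.1 x) := lt_of_lt_of_le (by positivity) hs
      refine (layer_prob D (extendW ℓ D w) x N ℓ i.1 M (D (i.1+1)) X β τ ε' lam f hℓ (by omega) hM hD1 hDM
        (hDM _ (by omega)) hX hX2 (fun t ht => (hP' t ht).1) hβ1 hβ hβN hs0 hτ0 hlam hτ (hε' _ (by omega))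
        (hf _ (by omega))).trans (measure_mono ?_)
      intro Mat hMat
      simp only [Set.mem_ofPred_eq, Function.update_self] at hMat ⊢
      refine hMat.congr (fun t ht => ?_)
      rw [extendW_lt ℓ D w t (by omega), extendW_lt ℓ D _ t (by omega), Function.update_of_ne]
      intro h; rw [← h] at ht; simp at ht)
  have hprod := outer_prod_ge (hiddenMeasure ℓ D)
    (Measure.pi fun _ : Fin (D ℓ) => gaussianReal 0 (1 / (D ℓ : NNReal)))
    {w | ∀ i : Fin ℓ, LayerOK D (extendW ℓ D w) x (2000 * X) N τ ε' i.1 (w i)}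
    {ω | DetGood ℓ D (extendW ℓ D ω.1) ω.2 x (2000 * X) ((1/640)^ℓ) ε ε' τ N} (ENNReal.ofReal (1-f))
    (by
      intro w hw
      have hP' : ∀ t, t < ℓ → LayerOK D (extendW ℓ D w) x (2000 * X) N τ ε' t (extendW ℓ D w t) := by
        intro t ht
        rw [extendW_lt ℓ D w t ht]
        exact hw ⟨t, ht⟩
      have hfam := fam_prob D (extendW ℓ D w) x N ℓ ℓ M 1 X β hℓ le_rfl hM hD1 hDM (by omega) hX hX2
        (fun t ht => (hP' t ht).1) hβ1 hβ hβN
      have h1 := outer_inter_ge (gaussMat 1 (D ℓ) (1 / (D ℓ : NNReal))) Set.univ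
        {Mat | FamGood D (extendW ℓ D w) x (2000 * X) N ℓ Mat} 1 (ENNReal.ofReal f) (by simp)
        (by
          refine hfam.trans (ENNReal.ofReal_le_ofReal ?_)
          have := hf 0 (Nat.zero_le _)
          have h2 : (0:ℝ) ≤ (3/4)^(D 0) := by positivity
          have h3 := Real.exp_pos (-(lam-1)*β)
          linarith)
      have hf0 : 0 ≤ f := le_trans (by positivity) (hf 0 (Nat.zero_le _))
      rw [ENNReal.ofReal_sub _ hf0, ENNReal.ofReal_one]
      refine h1.trans (le_trans (measure_mono ?_) (row_transfer (D ℓ) _ _))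
      rintro Mat ⟨-, hMat⟩
      have e : Mat = fun _ : Fin 1 => Mat 0 := by
        ext i k; rw [Subsingleton.elim i 0]
      simp only [Set.mem_ofPred_eq] at hMat ⊢
      refine ⟨fun t ht => (hP' t ht).2.1, by rw [← e]; exact hMat, fun t ht => ?_,
        fun t ht => (hP' t ht).2.2.2.1, fun t ht => (hP' t ht).2.2.2.2⟩
      refine le_trans ?_ (sig_of_layer ℓ D (extendW ℓ D w) x _ _ _ _ hD1 hx t ht
        (fun t' h' => hP' t' (by omega)))
      gcongr ?_ * _
      exact pow_le_pow_of_le_one (by norm_num) (by norm_num) ht)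
  refine le_trans ?_ hprod
  rw [ENNReal.ofReal_pow (by linarith), pow_succ, mul_comm]
  gcongr
  exact hchain

end

open MeasureTheory ProbabilityTheory
noncomputable section

/-! ### Constants -/

lemma evNorm_eq {n : ℕ} (v : Fin n → ℝ) : evNorm v = Real.sqrt (nsq v) := rfl

/-- the final probability computation -/
lemma prob_const (ℓ m : ℕ) (X Q δ : ℝ) (hℓ : 1 ≤ ℓ) (hm : 1 ≤ m) (hX : 2000000 ≤ X) (hQ : Q = X^ℓ)
    (hℓX : (ℓ:ℝ) ≤ 2 * X) (hδ : δ ∈ Set.Ioo (0:ℝ) 1) (hlam : Real.log (1/δ) ≤ m / Q^240) :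
    1 - δ ≤ (1 - ((3/4)^m + 2 * Real.exp (-10 * ℓ * max 1 (1/Q^40 * m / 2))))^(ℓ+1) := by
  obtain ⟨hδ0, hδ1⟩ := hδ
  have hX1 : 1 ≤ X := by linarith
  have hX0 : 0 < X := by linarith
  have hQX : X ≤ Q := by rw [hQ]; exact le_self_pow₀ hX1 (by omega)
  have hQ1 : 1 ≤ Q := by linarith
  have hQ0 : 0 < Q := by linarith
  set β := max 1 (1/Q^40 * m / 2) with hβd
  have hβ1 : 1 ≤ β := le_max_left _ _
  set lam := Real.log (1/δ) with hlamd
  have hδe : δ = Real.exp (-lam) := by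
    rw [hlamd, one_div, Real.log_inv, neg_neg, Real.exp_log hδ0]
  have hℓ1 : (1:ℝ) ≤ ℓ := by exact_mod_cast hℓ
  have hm1 : (1:ℝ) ≤ m := by exact_mod_cast hm
  have he10 : Real.exp (-10 * ℓ * β) ≤ 1/16 := by
    have : -10 * (ℓ:ℝ) * β ≤ -10 := by nlinarith
    refine (Real.exp_le_exp.mpr this).trans ?_
    rw [Real.exp_neg, ← one_div]
    apply one_div_le_one_div_of_le (by norm_num)
    have := Real.add_one_le_exp (5:ℝ)
    have h2 : Real.exp 10 = Real.exp 5 * Real.exp 5 := by rw [← Real.exp_add]; norm_num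
    rw [h2]; nlinarith
  have h34 : ((3:ℝ)/4)^m ≤ 3/4 := pow_le_of_le_one (by norm_num) (by norm_num) (by omega)
  by_cases hc : 100 * ℓ ≤ m
  · have hcr : 100 * (ℓ:ℝ) ≤ m := by exact_mod_cast hc
    have hb := one_add_mul_le_pow (a := -((3/4)^m + 2 * Real.exp (-10 * ℓ * β))) (by linarith) (ℓ+1)
    rw [← sub_eq_add_neg] at hb
    refine le_trans ?_ hb
    have hlm : lam ≤ m / 100 := by
      refine hlam.trans ?_
      apply div_le_div_of_nonneg_left (by linarith) (by norm_num)
      have : Q ≤ Q^240 := le_self_pow₀ hQ1 (by norm_num)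
      linarith
    have hlβ : lam ≤ β := by
      refine hlam.trans (le_trans ?_ (le_max_right _ _))
      have h40 : (0:ℝ) < Q^40 := by positivity
      rw [div_le_iff₀ (by positivity)]
      have e : 1 / Q^40 * m / 2 * Q^240 = m * (Q^200 / 2) := by
        field_simp
      rw [e]
      have : Q ≤ Q^200 := le_self_pow₀ hQ1 (by norm_num)
      nlinarith
    have hℓe : (ℓ:ℝ) + 1 ≤ Real.exp ℓ := Real.add_one_le_exp _
    have h4 : (4:ℝ) ≤ Real.exp 2 := by
      have := Real.add_one_le_exp (1:ℝ)
      have h2 : Real.exp 2 = Real.exp 1 * Real.exp 1 := by rw [← Real.exp_add]; norm_num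
      rw [h2]; nlinarith
    have t1 : ((ℓ:ℝ)+1) * (3/4)^m ≤ δ / 2 := by
      have e1 : ((3:ℝ)/4)^m ≤ Real.exp (-(m/4)) := by
        have : (3:ℝ)/4 ≤ Real.exp (-(1/4)) := by
          have := Real.add_one_le_exp (-(1/4):ℝ); linarith
        calc ((3:ℝ)/4)^m ≤ (Real.exp (-(1/4)))^m := by gcongr
          _ = Real.exp (-(m/4)) := by rw [← Real.exp_nat_mul]; congr 1; ring
      have e2 : 2 * (((ℓ:ℝ)+1) * (3/4)^m) ≤ δ := by
        calc 2 * (((ℓ:ℝ)+1) * (3/4)^m) ≤ Real.exp 2 * (Real.exp ℓ * Real.exp (-(m/4))) := by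
              gcongr; linarith
          _ = Real.exp (2 + (ℓ + -(m/4))) := by rw [← Real.exp_add, ← Real.exp_add]
          _ ≤ Real.exp (-lam) := Real.exp_le_exp.mpr (by linarith)
          _ = δ := hδe.symm
      linarith
    have t2 : ((ℓ:ℝ)+1) * (2 * Real.exp (-10 * ℓ * β)) ≤ δ / 2 := by
      have e2 : 4 * (((ℓ:ℝ)+1) * Real.exp (-10 * ℓ * β)) ≤ δ := by
        calc 4 * (((ℓ:ℝ)+1) * Real.exp (-10 * ℓ * β)) ≤ Real.exp 2 * (Real.exp ℓ * Real.exp (-10 * ℓ * β)) := by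
              gcongr
          _ = Real.exp (2 + (ℓ + -10 * ℓ * β)) := by rw [← Real.exp_add, ← Real.exp_add]
          _ ≤ Real.exp (-lam) := Real.exp_le_exp.mpr (by nlinarith)
          _ = δ := hδe.symm
      linarith
    push_cast
    linarith
  · have hcr : (m:ℝ) ≤ 100 * ℓ := by exact_mod_cast (by omega : m ≤ 100 * ℓ)
    have h1 : 1 - δ ≤ lam := by
      have := Real.log_le_sub_one_of_pos hδ0
      rw [hlamd, one_div, Real.log_inv]; linarith
    have h2 : (1/8:ℝ)^(ℓ+1) ≤ (1 - ((3/4)^m + 2 * Real.exp (-10 * ℓ * β)))^(ℓ+1) := by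
      gcongr; linarith
    refine le_trans ?_ h2
    have h3 : (1/Q^2:ℝ) ≤ (1/8:ℝ)^(ℓ+1) := by
      rw [one_div_pow]
      apply one_div_le_one_div_of_le (by positivity)
      calc (8:ℝ)^(ℓ+1) ≤ 8^(ℓ*2) := pow_le_pow_right₀ (by norm_num) (by omega)
        _ ≤ X^(ℓ*2) := by gcongr; linarith
        _ = Q^2 := by rw [hQ, pow_mul]
    refine le_trans ?_ h3
    refine h1.trans (hlam.trans ?_)
    rw [div_le_div_iff₀ (by positivity) (by positivity), one_mul]
    have : (m:ℝ) ≤ 200 * Q := by linarith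
    calc (m:ℝ) * Q^2 ≤ (200 * Q) * Q^2 := by gcongr
      _ ≤ (Q * Q) * Q^2 := by gcongr; linarith
      _ = Q^4 := by ring
      _ ≤ Q^240 := pow_le_pow_right₀ hQ1 (by norm_num)

lemma dmin_le (ℓ : ℕ) (D : ℕ → ℕ) (t : ℕ) (h : t ≤ ℓ) : dminN ℓ D ≤ D t :=
  Nat.sInf_le ⟨t, h, rfl⟩

lemma le_dmax (ℓ : ℕ) (D : ℕ → ℕ) (t : ℕ) (h : t ≤ ℓ) : D t ≤ dmaxN ℓ D :=
  le_csSup ((Set.finite_Iic ℓ).image D).bddAbove ⟨t, h, rfl⟩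

instance (ℓ : ℕ) (D : ℕ → ℕ) : IsProbabilityMeasure (bitsMeasure ℓ D) := by
  unfold bitsMeasure; infer_instance

instance (ℓ : ℕ) (D : ℕ → ℕ) : IsProbabilityMeasure (weightMeasure ℓ D) := by
  unfold weightMeasure hiddenMeasure; infer_instance

lemma bits_univ (ℓ : ℕ) (D : ℕ → ℕ) (P : (∀ i : Fin ℓ, Fin (D (i.1+1)) → Bool) → Prop) (h : ∀ b, P b) :
    bitsMeasure ℓ D {b | P b} = 1 := by
  have : {b | P b} = Set.univ := Set.eq_univ_of_forall h
  rw [this]; exact measure_univ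

lemma rpow_mul_nat (X : ℝ) (n ℓ : ℕ) : X ^ ((n:ℝ) * (ℓ:ℝ)) = (X^ℓ)^n := by
  rw [← Nat.cast_mul, Real.rpow_natCast, ← pow_mul, mul_comm]

set_option maxHeartbeats 2000000 in
/-- Main regime. -/
theorem main_regime (ℓ : ℕ) (hℓ : 1 ≤ ℓ) (D : ℕ → ℕ) (δ C C' : ℝ) (hC : 1 ≤ C) (hC' : 1 ≤ C')
    (hδ : δ ∈ Set.Ioo (0:ℝ) 1) (hM2 : 2 ≤ dmaxN ℓ D) (hm1 : 1 ≤ dminN ℓ D)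
    (hX : 2000000 ≤ (ℓ:ℝ) * Real.log (dmaxN ℓ D))
    (hd : (dminN ℓ D : ℝ) ≥ (C * ℓ * Real.log (dmaxN ℓ D)) ^ (240 * (ℓ:ℝ)) * Real.log (1/δ))
    (x : Fin (D 0) → ℝ) (hx : evNorm x = Real.sqrt (D 0)) :
        weightMeasure ℓ D {ω | ∀ y : Fin (D 0) → ℝ,
            evNorm (fun m => y m - x m) ≤ Rball ℓ D →
            bitsMeasure ℓ D {b |
              evNorm (fun c =>
                  gradVec ℓ D (extendW ℓ D ω.1) (extendB ℓ D b) ω.2 x c -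
                    gradVec ℓ D (extendW ℓ D ω.1) (extendB ℓ D b) ω.2 y c) ≤
                C' ^ ℓ / Real.log (dmaxN ℓ D) ^ ℓ} = 1} ≥
          ENNReal.ofReal (1 - δ) := by
  set M := dmaxN ℓ D with hMd
  set m := dminN ℓ D with hmd
  set L := Real.log M with hLd
  set X := (ℓ:ℝ) * L with hXd
  have hℓ1 : (1:ℝ) ≤ ℓ := by exact_mod_cast hℓ
  have hL : 1/2 ≤ L := by
    have := Real.log_two_gt_d9
    have h2 : Real.log 2 ≤ L := Real.log_le_log (by norm_num) (by exact_mod_cast hM2)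
    linarith
  have hX1 : 1 ≤ X := by linarith
  have hX0 : 0 < X := by linarith
  have hℓX : (ℓ:ℝ) ≤ 2 * X := by rw [hXd]; nlinarith
  have hLX : L ≤ X := by rw [hXd]; nlinarith
  set Q := X^ℓ with hQ
  have hQX : X ≤ Q := le_self_pow₀ hX1 (by omega)
  have hQ1 : 1 ≤ Q := by linarith
  have hQ0 : 0 < Q := by linarith
  have hQ2 : 2 ≤ Q := by linarith
  have hlp : 0 < Real.log (1/δ) := Real.log_pos (by rw [lt_div_iff₀ hδ.1]; linarith [hδ.2])
  have hlam : Real.log (1/δ) ≤ m / Q^240 := by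
    rw [le_div_iff₀ (by positivity)]
    have e : (240:ℝ) * ℓ = ((240:ℕ):ℝ) * ℓ := by norm_num
    rw [e, rpow_mul_nat] at hd
    have h1 : Q ≤ (C * ℓ * L)^ℓ := by
      rw [hQ]
      apply pow_le_pow_left₀ hX0.le
      rw [mul_assoc]; nlinarith
    have h2 : Q^240 ≤ ((C * ℓ * L)^ℓ)^240 := pow_le_pow_left₀ hQ0.le h1 _
    nlinarith
  have hD1 : ∀ t, t ≤ ℓ → 1 ≤ D t := fun t ht => hm1.trans (dmin_le ℓ D t ht)
  have hDM : ∀ t, t ≤ ℓ → D t ≤ M := fun t ht => le_dmax ℓ D t ht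
  have hDm : ∀ t, t ≤ ℓ → (m:ℝ) ≤ D t := fun t ht => by exact_mod_cast dmin_le ℓ D t ht
  have hm1' : (1:ℝ) ≤ m := by exact_mod_cast hm1
  set ε : ℝ := 1/Q^40 with hε
  have hε0 : 0 < ε := by positivity
  have hQ40 : Q ≤ Q^40 := le_self_pow₀ hQ1 (by norm_num)
  have hε1 : ε ≤ 1 := by rw [hε, div_le_one (by positivity)]; linarith
  set β := max 1 (ε * m / 2) with hβ
  have hβ1 : 1 ≤ β := le_max_left _ _
  set lam : ℝ := 20 * ℓ + 1 with hlamd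
  set τ : ℝ := ε/2 * Real.exp (-lam) with hτ
  set N : ℕ → ℕ := fun k => ⌊ε * D k⌋₊ with hN
  set f := (3/4:ℝ)^m + 2 * Real.exp (-10 * ℓ * β) with hf
  have hprob := prob_const ℓ m X Q δ hℓ hm1 hX hQ hℓX hδ hlam
  have hnx : nsq x = D 0 := by
    rw [evNorm_eq] at hx
    exact (Real.sqrt_inj (nsq_nonneg x) (by positivity)).mp hx
  have hmain := main_prob ℓ D x N M X β τ ε (ε/2) lam f hℓ hM2 hD1 hDM rfl (by linarith) hβ1
    (by
      intro k hk
      have := hDm k hk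
      refine max_le (by linarith) ?_
      nlinarith)
    (by
      intro k hk hNk
      have hNk' : (1:ℝ) ≤ N k := by exact_mod_cast hNk
      refine max_le hNk' ?_
      have h1 : ε * D k < N k + 1 := Nat.lt_floor_add_one _
      have h2 : ε * m ≤ ε * D k := by have := hDm k hk; gcongr
      linarith)
    hnx (by positivity) (by rw [hlamd]; linarith)
    (by rw [hτ, mul_assoc, ← Real.exp_add]; simp)
    (by
      intro k hk
      apply max_le_max le_rfl
      have := hDm k hk
      rw [mul_div_right_comm]; gcongr)
    (by
      have he : Real.exp (-10 * ℓ * β) ≤ 1/8 := by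
        have : -10 * (ℓ:ℝ) * β ≤ -10 := by nlinarith
        refine (Real.exp_le_exp.mpr this).trans ?_
        rw [Real.exp_neg, ← one_div]
        apply one_div_le_one_div_of_le (by norm_num)
        have := Real.add_one_le_exp (10:ℝ)
        linarith
      have h34 : ((3:ℝ)/4)^m ≤ 3/4 := pow_le_of_le_one (by norm_num) (by norm_num) (by omega)
      rw [hf]; linarith)
    (by
      intro k hk
      have h1 : ((3:ℝ)/4)^(D k) ≤ (3/4)^m :=
        pow_le_pow_of_le_one (by norm_num) (by norm_num) (dmin_le ℓ D k hk)
      have h2 : Real.exp (-20 * β * X) ≤ Real.exp (-10 * ℓ * β) := Real.exp_le_exp.mpr (by nlinarith)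
      have h3 : Real.exp (-(lam - 1) * β) ≤ Real.exp (-10 * ℓ * β) := Real.exp_le_exp.mpr (by
        rw [hlamd]; nlinarith)
      rw [hf]; linarith)
  refine le_trans (ENNReal.ofReal_le_ofReal hprob) (hmain.trans (measure_mono ?_))
  intro ω hω y hy
  apply bits_univ
  intro b
  have hAX : 2000 * X ≤ X^2 := by nlinarith
  have hAℓ : (2000 * X)^ℓ ≤ Q^2 := by
    calc (2000 * X)^ℓ ≤ (X^2)^ℓ := by gcongr
      _ = Q^2 := by rw [hQ, ← pow_mul, ← pow_mul, mul_comm]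
  have hs : 1 / Q ≤ (1/640:ℝ)^ℓ := by
    rw [one_div_pow, hQ]
    apply one_div_le_one_div_of_le (by positivity)
    gcongr; linarith
  have he : Real.exp lam ≤ Q^2 := by
    have e21 : Real.exp 21 ≤ X^2 := by
      have h3 : Real.exp 1 ≤ 3 := Real.exp_one_lt_three.le
      calc Real.exp 21 = (Real.exp 1)^21 := by rw [← Real.exp_nat_mul]; norm_num
        _ ≤ 3^21 := by gcongr
        _ ≤ 2000000^2 := by norm_num
        _ ≤ X^2 := by gcongr
    calc Real.exp lam ≤ Real.exp (ℓ * 21) := Real.exp_le_exp.mpr (by rw [hlamd]; linarith)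
      _ = (Real.exp 21)^ℓ := by rw [Real.exp_nat_mul]
      _ ≤ (X^2)^ℓ := by gcongr
      _ = Q^2 := by rw [hQ, ← pow_mul, ← pow_mul, mul_comm]
  have hτl : 1/Q^43 ≤ τ := by
    rw [hτ, hε, Real.exp_neg, ← one_div, div_div, div_mul_div_comm, one_mul]
    apply one_div_le_one_div_of_le (by positivity)
    calc Q^40 * 2 * Real.exp lam ≤ Q^40 * Q * Q^2 := by gcongr
      _ = Q^43 := by ring
  have hτs : 1/Q^87 ≤ τ^2 * (1/640:ℝ)^ℓ := by
    calc 1/Q^87 = (1/Q^43)^2 * (1/Q) := by field_simp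
      _ ≤ _ := by gcongr
  have hdet := det_main (B := 1/Q^160) hω hD1 (by linarith)
    (by
      refine lt_of_lt_of_le ?_ hs
      calc (2000 * X)^ℓ * (1/Q^160) ≤ Q^2 * (1/Q^160) := by gcongr
        _ = 1/Q^158 := by field_simp
        _ < 1/Q := by
          apply one_div_lt_one_div_of_lt hQ0
          exact lt_self_pow₀ (by linarith) (by norm_num))
    (by positivity) (by positivity)
    (by
      have h1 : (2000 * X)^ℓ * (1/Q^160) / (τ^2 * (1/640:ℝ)^ℓ) ≤ ε/2 := by
        rw [div_le_iff₀ (by positivity)]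
        calc (2000 * X)^ℓ * (1/Q^160) ≤ Q^2 * (1/Q^160) := by gcongr
          _ = 1/Q^30 * (1/Q) * (1/Q^40 * (1/Q^87)) := by field_simp
          _ ≤ 1 * (1/2) * (1/Q^40 * (1/Q^87)) := by
            gcongr
            rw [div_le_one (by positivity)]; exact one_le_pow₀ hQ1
          _ = ε/2 * (1/Q^87) := by rw [hε]; ring
          _ ≤ _ := by gcongr
      linarith)
    hε0.le hε1 (fun k => rfl) (extendB ℓ D b) y
    (by
      intro t ht
      have hR : evNorm (fun c => y c - x c) ≤ Real.sqrt m / Q^80 := by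
        refine hy.trans (le_of_eq ?_)
        unfold Rball
        have e : (80:ℝ) * ℓ = ((80:ℕ):ℝ) * ℓ := by norm_num
        rw [e, rpow_mul_nat]
      rw [evNorm_eq] at hR
      have h2 := Real.sqrt_le_left (by positivity) |>.mp hR
      refine h2.trans ?_
      rw [div_pow, Real.sq_sqrt (by positivity), ← pow_mul]
      have := hDm t ht
      rw [one_div, inv_mul_eq_div]
      gcongr)
  rw [evNorm_eq]
  have hL0 : 0 < L := by linarith
  apply Real.sqrt_le_iff.mpr
  refine ⟨by positivity, hdet.trans ?_⟩
  have hA1 : (2000 * X)^(ℓ+1) ≤ Q^4 := by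
    calc (2000 * X)^(ℓ+1) ≤ (X^2)^(ℓ+1) := by gcongr
      _ ≤ (X^2)^(ℓ*2) := pow_le_pow_right₀ (one_le_pow₀ hX1) (by omega)
      _ = Q^4 := by rw [hQ, ← pow_mul, ← pow_mul]; congr 1; ring
  have hLℓ : L^ℓ ≤ Q := by rw [hQ]; gcongr
  have hC1 : 1 ≤ C'^ℓ := one_le_pow₀ hC'
  calc (ℓ:ℝ)^2 * ((2000 * X)^(ℓ+1) * ε) ≤ (Q*Q)^2 * (Q^4 * (1/Q^40)) := by
        have : (ℓ:ℝ) ≤ Q * Q := by nlinarith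
        gcongr
    _ = (1/Q^30) * (1/Q)^2 := by field_simp
    _ ≤ 1 * (C'^ℓ / L^ℓ)^2 := by
      gcongr
      rw [div_le_one (by positivity)]; exact one_le_pow₀ hQ1
    _ = _ := one_mul _

end

open MeasureTheory ProbabilityTheory
noncomputable section

/-! ### Small regime -/

lemma op_top_prob (a b M : ℕ) (Y : ℝ) (hb : 1 ≤ b) (hM : 1 ≤ M) (hbM : b ≤ M) (hY : 1 ≤ Y)
    (ha : (a:ℝ) ≤ Real.exp Y) (hbY : 5 * (b:ℝ) ≤ Real.exp Y) :
    ENNReal.ofReal (1/2) ≤ gaussMat a b (1 / (b : NNReal))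
      {Mat | ∀ h : Fin b → ℝ, ∑ i, (∑ k, Mat i k * h k)^2 ≤ (1000 * Y * Real.exp Y) * nsq h} := by
  have hs := op_single a b b hb hb ⊤ (by simp) Y hY ha hbY
  have hb1 : (1:ℝ) ≤ b := by exact_mod_cast hb
  have he : Real.exp (-15 * b * Y) ≤ 1/2 := by
    have h1 : (1:ℝ) ≤ b * Y := by nlinarith
    have h2 : Real.exp (-15 * b * Y) ≤ Real.exp (-1) := Real.exp_le_exp.mpr (by nlinarith)
    have h3 := Real.exp_neg_one_lt_d9
    linarith
  have hq := hs.trans (ENNReal.ofReal_le_ofReal he)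
  have h := outer_inter_ge (gaussMat a b (1 / (b : NNReal))) Set.univ
    {w | OpGood w (1000 * Y) b ⊤} 1 (ENNReal.ofReal (1/2)) (by rw [measure_univ]) hq
  have h1 : ENNReal.ofReal (1/2) = 1 - ENNReal.ofReal (1/2) := by
    rw [← ENNReal.ofReal_one, ← ENNReal.ofReal_sub _ (by norm_num)]
    norm_num
  rw [h1]
  refine h.trans (measure_mono ?_)
  rintro Mat ⟨-, hg⟩ v
  have hg1 := hg v trivial Finset.univ
  refine hg1.trans ?_
  have hn := nsq_nonneg v
  have hmx : ((max (Finset.univ : Finset (Fin a)).card b : ℕ) : ℝ) ≤ Real.exp Y := by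
    rw [Finset.card_univ, Fintype.card_fin]
    push_cast
    exact max_le ha (by linarith)
  have hA : 0 ≤ 1000 * Y * nsq v := by positivity
  calc _ ≤ 1000 * Y * nsq v * ((max (Finset.univ : Finset (Fin a)).card b : ℕ) : ℝ) :=
        div_le_self (mul_nonneg hA (Nat.cast_nonneg _)) hb1
    _ ≤ 1000 * Y * nsq v * Real.exp Y := mul_le_mul_of_nonneg_left hmx hA
    _ = _ := by ring

lemma grad_bound (ℓ : ℕ) (hℓ : 1 ≤ ℓ) (D : ℕ → ℕ) (w : WT D) (v : Fin (D ℓ) → ℝ) (b : PT D) (G : ℝ) (hG : 0 ≤ G)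
    (hw : ∀ t, t < ℓ → ∀ h : Fin (D t) → ℝ, ∑ i, (∑ k, w t i k * h k)^2 ≤ G * nsq h)
    (hv : ∀ h : Fin (D ℓ) → ℝ, (∑ k, v k * h k)^2 ≤ G * nsq h) (z : Fin (D 0) → ℝ) :
    nsq (gradVec ℓ D w b v z) ≤ G^(ℓ+1) := by
  set u := gradVec ℓ D w b v z with hu
  have h1 : ∀ t, t ≤ ℓ → nsq (seqFrom D w (bR (patB D w b z)) 0 u t) ≤ G^t * nsq u := by
    intro t
    induction t with
    | zero => intro _; rw [seqFrom_self]; simp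
    | succ t ih =>
      intro ht
      calc nsq (seqFrom D w (bR (patB D w b z)) 0 u (t+1))
          ≤ ∑ a, (∑ c, w t a c * seqFrom D w (bR (patB D w b z)) 0 u t c)^2 := by
            refine Finset.sum_le_sum fun a _ => ?_
            rw [seqFrom_isProp D w _ 0 (t+1) u t (Nat.zero_le _) (Nat.lt_succ_self _) a]
            exact bR_sq_le _ _ _ _
        _ ≤ G * nsq (seqFrom D w (bR (patB D w b z)) 0 u t) := hw t (by omega) _
        _ ≤ G * (G^t * nsq u) := by gcongr; exact ih (by omega)
        _ = _ := by ring
  have h2 : nsq u = ∑ a, v a * seqFrom D w (bR (patB D w b z)) 0 u ℓ a := by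
    rw [← grad_pair, ← hu]
    exact Finset.sum_congr rfl fun c _ => sq _
  have h3 : (nsq u)^2 ≤ G^(ℓ+1) * nsq u := by
    calc (nsq u)^2 = (∑ a, v a * seqFrom D w (bR (patB D w b z)) 0 u ℓ a)^2 := by rw [← h2]
      _ ≤ G * nsq (seqFrom D w (bR (patB D w b z)) 0 u ℓ) := hv _
      _ ≤ G * (G^ℓ * nsq u) := by gcongr; exact h1 ℓ le_rfl
      _ = _ := by ring
  rcases (nsq_nonneg u).eq_or_lt with h0 | h0
  · rw [← h0]; positivity
  · rw [sq] at h3; exact le_of_mul_le_mul_right h3 h0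

lemma nsq_sub_le {n : ℕ} (u v : Fin n → ℝ) : nsq (fun c => u c - v c) ≤ 2 * nsq u + 2 * nsq v := by
  unfold nsq
  rw [Finset.mul_sum, Finset.mul_sum, ← Finset.sum_add_distrib]
  exact Finset.sum_le_sum fun c _ => by nlinarith [sq_nonneg (u c + v c)]

theorem small_regime (K : ℕ) (hK : 1 ≤ K) : ∃ C0 C0' : ℝ, ∀ C C' : ℝ, C0 ≤ C → C0' ≤ C' →
    ∀ (ℓ : ℕ), 1 ≤ ℓ → ∀ (D : ℕ → ℕ) (δ : ℝ), δ ∈ Set.Ioo (0:ℝ) 1 → 2 ≤ dmaxN ℓ D → 1 ≤ dminN ℓ D →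
    (ℓ:ℝ) * Real.log (dmaxN ℓ D) < K →
    ((dminN ℓ D : ℝ) ≥ (C * ℓ * Real.log (dmaxN ℓ D)) ^ (240 * (ℓ:ℝ)) * Real.log (1/δ)) →
    ∀ (x : Fin (D 0) → ℝ),
        weightMeasure ℓ D {ω | ∀ y : Fin (D 0) → ℝ,
            evNorm (fun m => y m - x m) ≤ Rball ℓ D →
            bitsMeasure ℓ D {b |
              evNorm (fun c =>
                  gradVec ℓ D (extendW ℓ D ω.1) (extendB ℓ D b) ω.2 x c -
                    gradVec ℓ D (extendW ℓ D ω.1) (extendB ℓ D b) ω.2 y c) ≤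
                C' ^ ℓ / Real.log (dmaxN ℓ D) ^ ℓ} = 1} ≥
          ENNReal.ofReal (1 - δ) := by
  set Y : ℝ := K + 2 with hY
  set G : ℝ := 1000 * Y * Real.exp Y with hG
  refine ⟨2 * (Real.exp K * 2^(2*K+1)), 2 * G * K, ?_⟩
  intro C C' hC hC' ℓ hℓ D δ hδ hM2 hm1 hX hd x
  set M := dmaxN ℓ D with hMd
  set m := dminN ℓ D with hmd
  set L := Real.log M with hLd
  have hK1 : (1:ℝ) ≤ K := by exact_mod_cast hK
  have hℓ1 : (1:ℝ) ≤ ℓ := by exact_mod_cast hℓ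
  have hY1 : 1 ≤ Y := by linarith
  have heY : 1 ≤ Real.exp Y := Real.one_le_exp (by linarith)
  have hG1 : 1 ≤ G := by rw [hG]; nlinarith
  have hM0 : (0:ℝ) < M := by exact_mod_cast (by omega : 0 < M)
  have hL : 1/2 ≤ L := by
    have := Real.log_two_gt_d9
    have h2 : Real.log 2 ≤ L := Real.log_le_log (by norm_num) (by exact_mod_cast hM2)
    linarith
  have hLK : L ≤ K := by nlinarith
  have hℓK : ℓ ≤ 2 * K := by
    have : (ℓ:ℝ) ≤ 2 * K := by nlinarith
    exact_mod_cast this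
  have hMK : (M:ℝ) ≤ Real.exp K := by
    rw [← Real.exp_log hM0]; exact Real.exp_le_exp.mpr hLK
  have hMY : 5 * (M:ℝ) ≤ Real.exp Y := by
    rw [hY, Real.exp_add]
    have h5 : (5:ℝ) ≤ Real.exp 2 := by
      have h2 : Real.exp 2 = Real.exp 1 * Real.exp 1 := by rw [← Real.exp_add]; norm_num
      have := Real.exp_one_gt_d9
      rw [h2]; nlinarith
    nlinarith [Real.exp_pos (K:ℝ)]
  have hD1 : ∀ t, t ≤ ℓ → 1 ≤ D t := fun t ht => hm1.trans (dmin_le ℓ D t ht)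
  have hDM : ∀ t, t ≤ ℓ → D t ≤ M := fun t ht => le_dmax ℓ D t ht
  have hDM' : ∀ t, t ≤ ℓ → (D t:ℝ) ≤ M := fun t ht => by exact_mod_cast hDM t ht
  have hlp : 0 < Real.log (1/δ) := Real.log_pos (by rw [lt_div_iff₀ hδ.1]; linarith [hδ.2])
  -- the probability needed is tiny
  have hsmall : 1 - δ ≤ (1/2)^(ℓ+1) := by
    have h1 : 1 - δ ≤ Real.log (1/δ) := by
      have := Real.log_le_sub_one_of_pos hδ.1
      rw [one_div, Real.log_inv]; linarith
    have e : (240:ℝ) * ℓ = ((240:ℕ):ℝ) * ℓ := by norm_num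
    rw [e, rpow_mul_nat, ← pow_mul] at hd
    set E := Real.exp K * 2^(2*K+1) with hE
    have h2p : (1:ℝ) ≤ 2^(2*K+1) := one_le_pow₀ (by norm_num)
    have heK : 1 ≤ Real.exp (K:ℝ) := Real.one_le_exp (by linarith)
    have hE1 : 1 ≤ E := by rw [hE]; nlinarith
    have h2 : E ≤ C * ℓ * L := by
      have : 2 * E * (1/2) ≤ C * (ℓ * L) := mul_le_mul hC (by nlinarith) (by norm_num) (by linarith)
      linarith
    have h3 : E ≤ (C * ℓ * L)^(ℓ*240) := h2.trans (le_self_pow₀ (by linarith) (by omega))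
    have h4 : E * Real.log (1/δ) ≤ Real.exp K := by
      calc E * Real.log (1/δ) ≤ (C * ℓ * L)^(ℓ*240) * Real.log (1/δ) := by gcongr
        _ ≤ m := hd
        _ ≤ D 0 := by exact_mod_cast dmin_le ℓ D 0 (Nat.zero_le _)
        _ ≤ M := hDM' 0 (Nat.zero_le _)
        _ ≤ _ := hMK
    have h5 : (2:ℝ)^(2*K+1) * Real.log (1/δ) ≤ 1 := by
      refine le_of_mul_le_mul_left ?_ (Real.exp_pos (K:ℝ))
      calc _ = E * Real.log (1/δ) := by rw [hE]; ring
        _ ≤ _ := h4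
        _ = _ := (mul_one _).symm
    have h6 : (2:ℝ)^(ℓ+1) ≤ 2^(2*K+1) := pow_le_pow_right₀ (by norm_num) (by omega)
    rw [one_div_pow, le_div_iff₀ (by positivity)]
    calc (1 - δ) * 2^(ℓ+1) ≤ Real.log (1/δ) * 2^(2*K+1) := by gcongr
      _ ≤ 1 := by linarith
  have hchain := outer_pi_chain ℓ (fun i => Fin (D (i.1+1)) → Fin (D i.1) → ℝ)
    (fun i => gaussMat (D (i.1+1)) (D i.1) (1 / (D i.1 : NNReal)))
    (fun i w => ∀ h : Fin (D i.1) → ℝ, ∑ j, (∑ k, w i j k * h k)^2 ≤ G * nsq h)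
    (by
      intro i w w' h hP
      rw [← h i le_rfl]; exact hP)
    (ENNReal.ofReal (1/2))
    (by
      intro i w _
      simp only [Function.update_self]
      have hi := i.2
      exact op_top_prob _ _ M Y (hD1 _ hi.le) (by omega) (hDM _ hi.le) hY1
        (by have := hDM' (i.1+1) hi; linarith) (by have := hDM' i.1 hi.le; linarith))
  have hprod := outer_prod_ge (hiddenMeasure ℓ D)
    (Measure.pi fun _ : Fin (D ℓ) => gaussianReal 0 (1 / (D ℓ : NNReal)))
    {w | ∀ i : Fin ℓ, ∀ h : Fin (D i.1) → ℝ, ∑ j, (∑ k, w i j k * h k)^2 ≤ G * nsq h}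
    {ω | (∀ i : Fin ℓ, ∀ h : Fin (D i.1) → ℝ, ∑ j, (∑ k, ω.1 i j k * h k)^2 ≤ G * nsq h) ∧
      ∀ h : Fin (D ℓ) → ℝ, (∑ k, ω.2 k * h k)^2 ≤ G * nsq h} (ENNReal.ofReal (1/2))
    (by
      intro w hw
      refine (op_top_prob 1 (D ℓ) M Y (hD1 _ le_rfl) (by omega) (hDM _ le_rfl) hY1
        (by push_cast; linarith) (by have := hDM' ℓ le_rfl; linarith)).trans
        (le_trans (measure_mono ?_) (row_transfer (D ℓ) _ _))
      intro Mat hMat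
      refine ⟨hw, fun h => ?_⟩
      simpa using hMat h)
  refine le_trans (ENNReal.ofReal_le_ofReal hsmall) ?_
  refine le_trans (le_trans ?_ hprod) (measure_mono ?_)
  · rw [ENNReal.ofReal_pow (by norm_num), pow_succ, mul_comm]
    gcongr
    exact hchain
  · rintro ω ⟨hω, hωv⟩ y -
    apply bits_univ
    intro b
    have hgb := grad_bound ℓ hℓ D (extendW ℓ D ω.1) ω.2 (extendB ℓ D b) G (by linarith)
      (fun t ht => by rw [extendW_lt ℓ D ω.1 t ht]; exact hω ⟨t, ht⟩) hωv
    have h1 := nsq_sub_le (gradVec ℓ D (extendW ℓ D ω.1) (extendB ℓ D b) ω.2 x)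
      (gradVec ℓ D (extendW ℓ D ω.1) (extendB ℓ D b) ω.2 y)
    have hx := hgb x
    have hy := hgb y
    rw [evNorm_eq]
    have hL0 : 0 < L := by linarith
    have hGK : 0 ≤ 2 * G * K := by positivity
    have hC0 : 0 ≤ C' := by linarith
    apply Real.sqrt_le_iff.mpr
    refine ⟨by positivity, ?_⟩
    have h2 : 2 * G ≤ C' / L := by
      rw [le_div_iff₀ hL0]
      refine le_trans ?_ hC'
      gcongr
    rw [← div_pow, ← pow_mul]
    calc _ ≤ 4 * G^(ℓ+1) := by linarith
      _ ≤ 2^(ℓ*2) * G^(ℓ*2) := by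
        have h4 : (4:ℝ) ≤ 2^(ℓ*2) := by
          calc (4:ℝ) = 2^2 := by norm_num
            _ ≤ _ := pow_le_pow_right₀ (by norm_num) (by omega)
        have h5 : G^(ℓ+1) ≤ G^(ℓ*2) := pow_le_pow_right₀ hG1 (by omega)
        gcongr
      _ = (2 * G)^(ℓ*2) := (mul_pow 2 G (ℓ*2)).symm
      _ ≤ (C'/L)^(ℓ*2) := by gcongr

theorem stmt9 :
    ∃ C C' : ℝ, 0 < C ∧ 0 < C' ∧
      ∀ (ℓ : ℕ), 1 ≤ ℓ → ∀ (D : ℕ → ℕ) (δ : ℝ), δ ∈ Set.Ioo (0:ℝ) 1 →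
      ((dminN ℓ D : ℝ) ≥
        (C * ℓ * Real.log (dmaxN ℓ D)) ^ (240 * (ℓ:ℝ)) * Real.log (1/δ)) →
      ∀ x : Fin (D 0) → ℝ, evNorm x = Real.sqrt (D 0) →
        weightMeasure ℓ D {ω | ∀ y : Fin (D 0) → ℝ,
            evNorm (fun m => y m - x m) ≤ Rball ℓ D →
            bitsMeasure ℓ D {b |
              evNorm (fun c =>
                  gradVec ℓ D (extendW ℓ D ω.1) (extendB ℓ D b) ω.2 x c -
                    gradVec ℓ D (extendW ℓ D ω.1) (extendB ℓ D b) ω.2 y c) ≤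
                C' ^ ℓ / Real.log (dmaxN ℓ D) ^ ℓ} = 1} ≥
          ENNReal.ofReal (1 - δ) := by
  obtain ⟨C0, C0', hsm⟩ := small_regime 2000000 (by norm_num)
  refine ⟨max 1 C0, max 1 C0', by positivity, by positivity, ?_⟩
  intro ℓ hℓ D δ hδ hd x hx
  have hℓ1 : (1:ℝ) ≤ ℓ := by exact_mod_cast hℓ
  by_cases hM : 2 ≤ dmaxN ℓ D
  · have hlp : 0 < Real.log (1/δ) := Real.log_pos (by rw [lt_div_iff₀ hδ.1]; linarith [hδ.2])
    have hL : 0 < Real.log (dmaxN ℓ D) := Real.log_pos (by exact_mod_cast hM)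
    have hm1 : 1 ≤ dminN ℓ D := by
      have h1 : (0:ℝ) < dminN ℓ D := lt_of_lt_of_le (by positivity) hd
      exact_mod_cast h1
    by_cases hX : 2000000 ≤ (ℓ:ℝ) * Real.log (dmaxN ℓ D)
    · exact main_regime ℓ hℓ D δ _ _ (le_max_left _ _) (le_max_left _ _) hδ hM hm1 hX hd x hx
    · exact hsm _ _ (le_max_right _ _) (le_max_right _ _) ℓ hℓ D δ hδ hM hm1
        (by push_cast; exact not_le.mp hX) hd x
  · have hL : Real.log (dmaxN ℓ D) = 0 := by
      have : dmaxN ℓ D = 0 ∨ dmaxN ℓ D = 1 := by omega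
      rcases this with h | h <;> rw [h] <;> simp
    have huniv : ∀ ω : ((∀ i : Fin ℓ, Fin (D (i.1+1)) → Fin (D i.1) → ℝ) × (Fin (D ℓ) → ℝ)),
        ∀ y : Fin (D 0) → ℝ,
            evNorm (fun m => y m - x m) ≤ Rball ℓ D →
            bitsMeasure ℓ D {b |
              evNorm (fun c =>
                  gradVec ℓ D (extendW ℓ D ω.1) (extendB ℓ D b) ω.2 x c -
                    gradVec ℓ D (extendW ℓ D ω.1) (extendB ℓ D b) ω.2 y c) ≤
                (max 1 C0') ^ ℓ / Real.log (dmaxN ℓ D) ^ ℓ} = 1 := by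
      intro ω y hy
      apply bits_univ
      intro b
      have hR : Rball ℓ D = 0 := by
        unfold Rball
        rw [hL, mul_zero, Real.zero_rpow (by positivity), div_zero]
      rw [hR, evNorm_eq] at hy
      have h0 : nsq (fun m => y m - x m) ≤ 0 := by
        have := Real.sqrt_eq_zero'.mp (le_antisymm hy (Real.sqrt_nonneg _))
        exact this
      have hyx : y = x := by
        have h1 := (Finset.sum_eq_zero_iff_of_nonneg (fun i _ => sq_nonneg (y i - x i))).mp
          (le_antisymm h0 (nsq_nonneg (fun m => y m - x m)))
        ext i
        have := h1 i (Finset.mem_univ _)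
        have := pow_eq_zero_iff (two_ne_zero) |>.mp this
        linarith
      rw [hyx, hL]
      have : evNorm (fun c =>
                  gradVec ℓ D (extendW ℓ D ω.1) (extendB ℓ D b) ω.2 x c -
                    gradVec ℓ D (extendW ℓ D ω.1) (extendB ℓ D b) ω.2 x c) = 0 := by
        simp [evNorm]
      rw [this]
      positivity
    have : {ω : ((∀ i : Fin ℓ, Fin (D (i.1+1)) → Fin (D i.1) → ℝ) × (Fin (D ℓ) → ℝ)) |
        ∀ y : Fin (D 0) → ℝ,
            evNorm (fun m => y m - x m) ≤ Rball ℓ D →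
            bitsMeasure ℓ D {b |
              evNorm (fun c =>
                  gradVec ℓ D (extendW ℓ D ω.1) (extendB ℓ D b) ω.2 x c -
                    gradVec ℓ D (extendW ℓ D ω.1) (extendB ℓ D b) ω.2 y c) ≤
                (max 1 C0') ^ ℓ / Real.log (dmaxN ℓ D) ^ ℓ} = 1} = Set.univ :=
      Set.eq_univ_of_forall huniv
    rw [this, measure_univ]
    exact ENNReal.ofReal_le_one.mpr (by linarith [hδ.1])

end
end

section
/- Let d ∈ ℕ and fix x, y ∈ ℝ^d with x, y ≠ 0. Let θ = arccos(xᵀy/(‖x‖‖y‖)). Then for g ~ N(0, I_d): E[max{gᵀx, 0}·max{gᵀy, 0}] / √( E[(max{gᵀx, 0})²] · E[(max{gᵀy, 0})²] ) = sin θ/π + (1 − θ/π) cos θ. -/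
open MeasureTheory ProbabilityTheory

noncomputable section

/-- The standard Gaussian measure `N(0, I_d)` on `ℝ^d`. -/
def stdGauss (d : ℕ) : Measure (Fin d → ℝ) :=
  Measure.pi fun _ => gaussianReal 0 1

lemma charInt (t : ℝ) : ∫ u, Complex.exp (((t * u : ℝ) : ℂ) * Complex.I) ∂(gaussianReal 0 1)
    = Complex.exp (((-(t ^ 2) / 2 : ℝ)) : ℂ) := by
  have h := charFun_gaussianReal (μ := 0) (v := 1) t
  rw [charFun_apply_real] at h
  push_cast
  rw [h]
  simp [neg_div]

lemma jointLaw (d : ℕ) (x y : Fin d → ℝ) (a b c s : ℝ) (ha : a ^ 2 = ∑ i, x i ^ 2)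
    (hb : b ^ 2 = ∑ i, y i ^ 2) (hab : a * b * c = ∑ i, x i * y i) (hcs : c ^ 2 + s ^ 2 = 1) :
    (stdGauss d).map (fun g => (∑ i, g i * x i, ∑ i, g i * y i)) =
      ((gaussianReal 0 1).prod (gaussianReal 0 1)).map
        (fun p : ℝ × ℝ => (a * p.1, b * (c * p.1 + s * p.2))) := by
  unfold stdGauss
  have m1 : Measurable (fun g : Fin d → ℝ => (∑ i, g i * x i, ∑ i, g i * y i)) := by fun_prop
  have m2 : Measurable (fun p : ℝ × ℝ => (a * p.1, b * (c * p.1 + s * p.2))) := by fun_prop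
  have := Measure.isProbabilityMeasure_map (μ := Measure.pi fun _ : Fin d => gaussianReal 0 1)
    m1.aemeasurable
  have := Measure.isProbabilityMeasure_map (μ := (gaussianReal 0 1).prod (gaussianReal 0 1))
    m2.aemeasurable
  apply Measure.ext_of_charFunDual
  ext L
  rw [charFunDual_apply, charFunDual_apply, integral_map m1.aemeasurable (by fun_prop),
    integral_map m2.aemeasurable (by fun_prop)]
  have hL : ∀ u v : ℝ, L (u, v) = L (1, 0) * u + L (0, 1) * v := by
    intro u v
    have : ((u, v) : ℝ × ℝ) = u • ((1, 0) : ℝ × ℝ) + v • ((0, 1) : ℝ × ℝ) := by simp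
    rw [this, map_add, map_smul, map_smul]
    simp [mul_comm]
  generalize L (1, 0) = p at hL
  generalize L (0, 1) = q at hL
  have e1 : ∀ g : Fin d → ℝ, Complex.exp ((L (∑ i, g i * x i, ∑ i, g i * y i) : ℝ) * Complex.I) =
      ∏ i, Complex.exp ((((p * x i + q * y i) * g i : ℝ) : ℂ) * Complex.I) := by
    intro g
    rw [← Complex.exp_sum, ← Finset.sum_mul, ← Complex.ofReal_sum, hL, Finset.mul_sum,
      Finset.mul_sum, ← Finset.sum_add_distrib]
    congr 3
    apply Finset.sum_congr rfl
    intros; ring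
  have e2 : ∀ z : ℝ × ℝ, Complex.exp ((L (a * z.1, b * (c * z.1 + s * z.2)) : ℝ) * Complex.I) =
      Complex.exp ((((p * a + q * b * c) * z.1 : ℝ) : ℂ) * Complex.I) *
      Complex.exp ((((q * b * s) * z.2 : ℝ) : ℂ) * Complex.I) := by
    intro z
    rw [← Complex.exp_add, hL]
    congr 1
    push_cast; ring
  simp_rw [e1, e2]
  rw [integral_fintype_prod_eq_prod (f := fun i u =>
    Complex.exp ((((p * x i + q * y i) * u : ℝ) : ℂ) * Complex.I)),
    integral_prod_mul (fun u : ℝ => Complex.exp ((((p * a + q * b * c) * u : ℝ) : ℂ) * Complex.I))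
      (fun u : ℝ => Complex.exp ((((q * b * s) * u : ℝ) : ℂ) * Complex.I))]
  simp_rw [charInt]
  rw [← Complex.exp_sum, ← Complex.exp_add, ← Complex.ofReal_sum, ← Complex.ofReal_add]
  congr 2
  have : ∑ i, (-(p * x i + q * y i) ^ 2 / 2) =
      -(p ^ 2 * ∑ i, x i ^ 2 + 2 * p * q * ∑ i, x i * y i + q ^ 2 * ∑ i, y i ^ 2) / 2 := by
    simp only [Finset.mul_sum, ← Finset.sum_add_distrib, neg_div, Finset.sum_div,
      ← Finset.sum_neg_distrib]
    apply Finset.sum_congr rfl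
    intros; ring
  rw [this, ← ha, ← hb, ← hab]
  linear_combination (q ^ 2 * b ^ 2 / 2) * hcs

lemma radial : ∫ r in Set.Ioi (0 : ℝ), r ^ 3 * Real.exp (-r ^ 2 / 2) = 2 := by
  have h := integral_rpow_mul_exp_neg_mul_rpow (p := 2) (q := 3) (b := 1 / 2)
    (by norm_num) (by norm_num) (by norm_num)
  have e : Real.Gamma ((3 + 1) / 2) = 1 := by
    rw [show ((3 : ℝ) + 1) / 2 = 2 by norm_num, Real.Gamma_two]
  rw [e, show (-((3 : ℝ) + 1) / 2) = -(2 : ℕ) by norm_num, Real.rpow_neg (by norm_num),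
    Real.rpow_natCast] at h
  norm_num at h
  refine Eq.trans ?_ h
  apply setIntegral_congr_fun measurableSet_Ioi
  intro r _
  beta_reduce
  ring_nf

lemma angular (θ : ℝ) (h0 : 0 ≤ θ) (h1 : θ ≤ Real.pi) :
    ∫ φ in Set.Ioo (-Real.pi) Real.pi, max (Real.cos φ) 0 * max (Real.cos (φ - θ)) 0 =
      (Real.sin θ + (Real.pi - θ) * Real.cos θ) / 2 := by
  have hpi := Real.pi_pos
  have key : ∫ φ in Set.Ioo (-Real.pi) Real.pi, max (Real.cos φ) 0 * max (Real.cos (φ - θ)) 0 =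
      ∫ φ in Set.Ioc (θ - Real.pi / 2) (Real.pi / 2), Real.cos φ * Real.cos (φ - θ) := by
    rw [← integral_indicator measurableSet_Ioo, ← integral_indicator measurableSet_Ioc]
    congr 1
    ext φ
    by_cases hA : φ ∈ Set.Ioc (θ - Real.pi / 2) (Real.pi / 2)
    · have hB : φ ∈ Set.Ioo (-Real.pi) Real.pi := ⟨by linarith [hA.1], by linarith [hA.2]⟩
      rw [Set.indicator_of_mem hA, Set.indicator_of_mem hB, max_eq_left, max_eq_left]
      · exact Real.cos_nonneg_of_neg_pi_div_two_le_of_le (by linarith [hA.1]) (by linarith [hA.2])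
      · exact Real.cos_nonneg_of_neg_pi_div_two_le_of_le (by linarith [hA.1]) (by linarith [hA.2])
    · rw [Set.indicator_of_notMem hA]
      by_cases hB : φ ∈ Set.Ioo (-Real.pi) Real.pi
      · rw [Set.indicator_of_mem hB]
        obtain ⟨hB1, hB2⟩ := hB
        by_cases c1 : Real.pi / 2 < φ
        · rw [max_eq_right (Real.cos_nonpos_of_pi_div_two_le_of_le c1.le (by linarith)), zero_mul]
        have c2 : φ ≤ θ - Real.pi / 2 := by
          by_contra h
          exact hA ⟨by linarith, by linarith⟩
        by_cases c3 : φ < -(Real.pi / 2)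
        · rw [← Real.cos_neg φ, max_eq_right (Real.cos_nonpos_of_pi_div_two_le_of_le
            (x := -φ) (by linarith) (by linarith)), zero_mul]
        · rw [← Real.cos_neg (φ - θ), max_eq_right (Real.cos_nonpos_of_pi_div_two_le_of_le
            (x := -(φ - θ)) (by linarith) (by linarith)), mul_zero]
      · rw [Set.indicator_of_notMem hB]
  rw [key, ← intervalIntegral.integral_of_le (by linarith)]
  have hd : ∀ φ ∈ Set.uIcc (θ - Real.pi / 2) (Real.pi / 2),
      HasDerivAt (fun φ => Real.sin (2 * φ - θ) / 4 + φ * (Real.cos θ / 2))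
        (Real.cos φ * Real.cos (φ - θ)) φ := by
    intro φ _
    have h := ((((hasDerivAt_id φ).const_mul 2).sub_const θ).sin.div_const 4).add
      ((hasDerivAt_id φ).mul_const (Real.cos θ / 2))
    refine HasDerivAt.congr_deriv h ?_
    have e1 : Real.cos (2 * φ - θ) = Real.cos (φ + (φ - θ)) := by ring_nf
    have e2 : Real.cos θ = Real.cos (φ - (φ - θ)) := by ring_nf
    change Real.cos (2 * φ - θ) * (2 * 1) / 4 + 1 * (Real.cos θ / 2) = _
    rw [e1, e2, Real.cos_add, Real.cos_sub φ (φ - θ)]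
    ring
  rw [intervalIntegral.integral_eq_sub_of_hasDerivAt hd
    ((by fun_prop : Continuous fun φ => Real.cos φ * Real.cos (φ - θ)).intervalIntegrable _ _)]
  rw [show 2 * (Real.pi / 2) - θ = Real.pi - θ by ring,
    show 2 * (θ - Real.pi / 2) - θ = θ - Real.pi by ring, Real.sin_pi_sub, Real.sin_sub_pi]
  ring

lemma planar (θ a b : ℝ) (ha : 0 ≤ a) (hb : 0 ≤ b) (h0 : 0 ≤ θ) (h1 : θ ≤ Real.pi) :
    ∫ p : ℝ × ℝ, max (a * p.1) 0 * max (b * (Real.cos θ * p.1 + Real.sin θ * p.2)) 0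
      ∂((gaussianReal 0 1).prod (gaussianReal 0 1)) =
      a * b * ((Real.sin θ + (Real.pi - θ) * Real.cos θ) / (2 * Real.pi)) := by
  have hpi := Real.pi_pos
  rw [gaussianReal_of_var_ne_zero 0 one_ne_zero, prod_withDensity (measurable_gaussianPDF _ _)
    (measurable_gaussianPDF _ _), integral_withDensity_eq_integral_toReal_smul (by
      have := measurable_gaussianPDF 0 1
      fun_prop) (ae_of_all _ fun z => ENNReal.mul_lt_top (by simp [gaussianPDF])
        (by simp [gaussianPDF]))]
  rw [← Measure.volume_eq_prod, ← integral_comp_polarCoord_symm, polarCoord_target,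
    Measure.volume_eq_prod]
  have e : ∀ p ∈ Set.Ioi (0 : ℝ) ×ˢ Set.Ioo (-Real.pi) Real.pi,
      p.1 • ((gaussianPDF 0 1 (polarCoord.symm p).1 * gaussianPDF 0 1 (polarCoord.symm p).2).toReal •
        (max (a * (polarCoord.symm p).1) 0 * max (b * (Real.cos θ * (polarCoord.symm p).1 +
          Real.sin θ * (polarCoord.symm p).2)) 0)) =
      (a * b / (2 * Real.pi) * (p.1 ^ 3 * Real.exp (-p.1 ^ 2 / 2))) *
        (max (Real.cos p.2) 0 * max (Real.cos (p.2 - θ)) 0) := by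
    rintro ⟨r, φ⟩ ⟨hr, _⟩
    have hr' : 0 < r := hr
    simp only [polarCoord_symm_apply, smul_eq_mul, ENNReal.toReal_mul, toReal_gaussianPDF]
    have f1 : a * (r * Real.cos φ) = (a * r) * Real.cos φ := by ring
    have f2 : b * (Real.cos θ * (r * Real.cos φ) + Real.sin θ * (r * Real.sin φ)) =
        (b * r) * Real.cos (φ - θ) := by rw [Real.cos_sub]; ring
    have f3 : ∀ k u : ℝ, 0 ≤ k → max (k * u) 0 = k * max u 0 := by
      intro k u hk
      rw [mul_max_of_nonneg _ _ hk, mul_zero]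
    rw [f1, f2, f3 _ _ (by positivity), f3 _ _ (by positivity)]
    have f4 : gaussianPDFReal 0 1 (r * Real.cos φ) * gaussianPDFReal 0 1 (r * Real.sin φ) =
        (2 * Real.pi)⁻¹ * Real.exp (-r ^ 2 / 2) := by
      simp only [gaussianPDFReal_def, NNReal.coe_one, mul_one, sub_zero]
      rw [mul_mul_mul_comm, ← Real.exp_add, ← mul_inv, Real.mul_self_sqrt (by positivity)]
      congr 2
      linear_combination (-r ^ 2 / 2) * Real.sin_sq_add_cos_sq φ
    rw [f4]
    field_simp
  rw [setIntegral_congr_fun (measurableSet_Ioi.prod measurableSet_Ioo) e,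
    setIntegral_prod_mul (fun r : ℝ => a * b / (2 * Real.pi) * (r ^ 3 * Real.exp (-r ^ 2 / 2)))
      (fun φ : ℝ => max (Real.cos φ) 0 * max (Real.cos (φ - θ)) 0), integral_const_mul, radial,
    angular θ h0 h1]
  field_simp

lemma mainInt (d : ℕ) (x y : Fin d → ℝ) (θ a b : ℝ) (ha : 0 ≤ a) (hb : 0 ≤ b)
    (h0 : 0 ≤ θ) (h1 : θ ≤ Real.pi) (ha2 : a ^ 2 = ∑ i, x i ^ 2)
    (hb2 : b ^ 2 = ∑ i, y i ^ 2) (hab : a * b * Real.cos θ = ∑ i, x i * y i) :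
    (∫ g, max (∑ i, g i * x i) 0 * max (∑ i, g i * y i) 0 ∂(stdGauss d)) =
      a * b * ((Real.sin θ + (Real.pi - θ) * Real.cos θ) / (2 * Real.pi)) := by
  rw [← planar θ a b ha hb h0 h1]
  have h := jointLaw d x y a b _ _ ha2 hb2 hab (Real.cos_sq_add_sin_sq θ)
  have m1 : Measurable (fun g : Fin d → ℝ => (∑ i, g i * x i, ∑ i, g i * y i)) := by fun_prop
  have m2 : Measurable (fun p : ℝ × ℝ => (a * p.1, b * (Real.cos θ * p.1 + Real.sin θ * p.2))) := by
    fun_prop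
  have h2 := congrArg (fun μ => ∫ z : ℝ × ℝ, max z.1 0 * max z.2 0 ∂μ) h
  beta_reduce at h2
  rwa [integral_map m1.aemeasurable (by fun_prop), integral_map m2.aemeasurable (by fun_prop)] at h2

lemma evNorm_pos {d : ℕ} {x : Fin d → ℝ} (hx : x ≠ 0) : 0 < evNorm x := by
  obtain ⟨i, hi⟩ := Function.ne_iff.1 hx
  apply Real.sqrt_pos.2
  exact Finset.sum_pos' (fun _ _ => sq_nonneg _) ⟨i, Finset.mem_univ _, by
    have : x i ≠ 0 := hi
    positivity⟩

lemma evNorm_sq {d : ℕ} (x : Fin d → ℝ) : evNorm x ^ 2 = ∑ i, x i ^ 2 :=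
  Real.sq_sqrt (Finset.sum_nonneg fun _ _ => sq_nonneg _)

lemma selfInt (d : ℕ) (x : Fin d → ℝ) :
    (∫ g, (max (∑ i, g i * x i) 0) ^ 2 ∂(stdGauss d)) = evNorm x ^ 2 / 2 := by
  have h := mainInt d x x 0 (evNorm x) (evNorm x) (Real.sqrt_nonneg _) (Real.sqrt_nonneg _) le_rfl
    Real.pi_pos.le (evNorm_sq x) (evNorm_sq x) (by
      rw [Real.cos_zero, mul_one, ← sq, evNorm_sq]; simp only [sq])
  simp only [sq (max _ _)]
  rw [h]
  have := Real.pi_pos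
  simp
  field_simp

/-- **Statement 12** (Lemma on expected inner products of ReLU images): for `g ~ N(0, I_d)`
and nonzero `x, y`, the normalized correlation of `relu(gᵀx)` and `relu(gᵀy)` equals
`sin θ/π + (1 − θ/π) cos θ`, where `θ` is the angle between `x` and `y`. -/
theorem stmt12 (d : ℕ) (x y : Fin d → ℝ) (hx : x ≠ 0) (hy : y ≠ 0) :
    (∫ g, max (∑ i, g i * x i) 0 * max (∑ i, g i * y i) 0 ∂(stdGauss d)) /
      Real.sqrt ((∫ g, (max (∑ i, g i * x i) 0) ^ 2 ∂(stdGauss d)) *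
        (∫ g, (max (∑ i, g i * y i) 0) ^ 2 ∂(stdGauss d))) =
      Real.sin (Real.arccos ((∑ i, x i * y i) / (evNorm x * evNorm y))) / Real.pi +
        (1 - Real.arccos ((∑ i, x i * y i) / (evNorm x * evNorm y)) / Real.pi) *
          Real.cos (Real.arccos ((∑ i, x i * y i) / (evNorm x * evNorm y))) := by
  have ha := evNorm_pos hx
  have hb := evNorm_pos hy
  have hcs : |∑ i, x i * y i| ≤ evNorm x * evNorm y := by
    apply abs_le_of_sq_le_sq _ (by positivity)
    rw [mul_pow, evNorm_sq, evNorm_sq]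
    exact Finset.sum_mul_sq_le_sq_mul_sq _ _ _
  have hcos := Real.cos_arccos (x := (∑ i, x i * y i) / (evNorm x * evNorm y))
    (by rw [le_div_iff₀ (by positivity)]; linarith [(abs_le.1 hcs).1])
    (by rw [div_le_iff₀ (by positivity)]; linarith [(abs_le.1 hcs).2])
  have h0 := Real.arccos_nonneg ((∑ i, x i * y i) / (evNorm x * evNorm y))
  have h1 := Real.arccos_le_pi ((∑ i, x i * y i) / (evNorm x * evNorm y))
  have hab : evNorm x * evNorm y * Real.cos (Real.arccos
      ((∑ i, x i * y i) / (evNorm x * evNorm y))) = ∑ i, x i * y i := by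
    rw [hcos]; field_simp
  generalize Real.arccos ((∑ i, x i * y i) / (evNorm x * evNorm y)) = θ at *
  rw [mainInt d x y θ _ _ ha.le hb.le h0 h1 (evNorm_sq x) (evNorm_sq y) hab, selfInt, selfInt,
    show evNorm x ^ 2 / 2 * (evNorm y ^ 2 / 2) = (evNorm x * evNorm y / 2) ^ 2 by ring,
    Real.sqrt_sq (by positivity)]
  have := Real.pi_pos
  field_simp

end
end
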